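/- Let H : ℝ² → ℝ be real-analytic in a neighborhood of the origin, with H(0,0) = 0 a critical point of H that is not a local extremum and is isolated among critical points. Fix a sufficiently small ρ > 0 and a separatrix sector S_ρ ⊂ B_ρ. Then there exist h₀ > 0, a positive integer q, an integer k₀, and real sequences (a_k)_{k≥k₀}, (b_k)_{k≥k₀} such that for every h ∈ (0, h₀) the series ∑_{k=k₀}^∞ (a_k + b_k ln h) h^{k/q} converges and equals the Lebesgue area (two-dimensional Lebesgue measure) of the sublevel set S_ρ(h) = {p ∈ S_ρ : |H(p)| < h}. -/

import Mathlib

/-- The closed Euclidean ball of radius `ρ` centered at the origin of `ℝ²`. -/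
def euclBall (ρ : ℝ) : Set (ℝ × ℝ) := {p | p.1 ^ 2 + p.2 ^ 2 ≤ ρ ^ 2}

/-- The separatrix sector of `H` in `B_ρ` containing `x₀`: the connected component of
`B_ρ ∩ {H ≠ 0}` containing `x₀`. -/
def sector (H : ℝ × ℝ → ℝ) (ρ : ℝ) (x₀ : ℝ × ℝ) : Set (ℝ × ℝ) :=
  connectedComponentIn {p ∈ euclBall ρ | H p ≠ 0} x₀

namespace SectorArea

open Filter Topology Set MeasureTheory

/-- `F` is a convergent log-Puiseux series in `h`, with nonnegative exponents, for small `h > 0`. -/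
def LogPuiseux (F : ℝ → ℝ) : Prop :=
  ∃ q : ℕ, 0 < q ∧ ∃ P Q : ℝ → ℝ, AnalyticAt ℝ P 0 ∧ AnalyticAt ℝ Q 0 ∧
    ∀ᶠ h in 𝓝[>] (0 : ℝ), F h = P (h ^ (1 / q : ℝ)) + Q (h ^ (1 / q : ℝ)) * Real.log h

theorem LogPuiseux.congr {F G : ℝ → ℝ} (hF : LogPuiseux F) (h : ∀ᶠ x in 𝓝[>] (0 : ℝ), F x = G x) :
    LogPuiseux G := by
  obtain ⟨q, hq, P, Q, hP, hQ, hF⟩ := hF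
  refine ⟨q, hq, P, Q, hP, hQ, ?_⟩
  filter_upwards [hF, h] with x h1 h2
  rw [← h2, h1]

theorem LogPuiseux.zero : LogPuiseux (fun _ => 0) :=
  ⟨1, one_pos, 0, 0, analyticAt_const, analyticAt_const, by simp⟩

theorem rpow_inv_pow {h : ℝ} (hh : 0 < h) {q r : ℕ} (hr : 0 < r) :
    (h ^ (1 / (q * r : ℕ) : ℝ)) ^ r = h ^ (1 / q : ℝ) := by
  rw [← Real.rpow_natCast, ← Real.rpow_mul hh.le]
  congr 1
  have : (r : ℝ) ≠ 0 := by positivity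
  push_cast
  rcases eq_or_ne (q : ℝ) 0 with h0 | h0
  · simp [h0]
  · field_simp

theorem analyticAt_comp_pow {P : ℝ → ℝ} (hP : AnalyticAt ℝ P 0) {r : ℕ} (hr : 0 < r) :
    AnalyticAt ℝ (fun x => P (x ^ r)) 0 := by
  apply AnalyticAt.fun_comp (g := P)
  · simpa [hr.ne'] using hP
  · fun_prop

theorem LogPuiseux.add {F G : ℝ → ℝ} (hF : LogPuiseux F) (hG : LogPuiseux G) :
    LogPuiseux (fun h => F h + G h) := by
  obtain ⟨q, hq, P, Q, hP, hQ, hF⟩ := hF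
  obtain ⟨r, hr, P', Q', hP', hQ', hG⟩ := hG
  refine ⟨q * r, by positivity, fun x => P (x ^ r) + P' (x ^ q), fun x => Q (x ^ r) + Q' (x ^ q),
    (analyticAt_comp_pow hP hr).add (analyticAt_comp_pow hP' hq),
    (analyticAt_comp_pow hQ hr).add (analyticAt_comp_pow hQ' hq), ?_⟩
  filter_upwards [hF, hG, self_mem_nhdsWithin] with h h1 h2 h3
  rw [h1, h2, rpow_inv_pow h3 hr, mul_comm q r, rpow_inv_pow h3 hq]
  ring

theorem LogPuiseux.sum {ι : Type*} (s : Finset ι) {F : ι → ℝ → ℝ} (hF : ∀ i ∈ s, LogPuiseux (F i)) :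
    LogPuiseux (fun h => ∑ i ∈ s, F i h) := by
  classical
  induction s using Finset.induction_on with
  | empty => simpa using LogPuiseux.zero
  | insert a s ha ih =>
    simp only [Finset.sum_insert ha]
    exact (hF a (by simp)).add (ih fun i hi => hF i (by simp [hi]))

theorem LogPuiseux.comp_root {F : ℝ → ℝ} (hF : LogPuiseux F) {a : ℕ} (ha : 0 < a) :
    LogPuiseux (fun h => F (h ^ (1 / a : ℝ))) := by
  obtain ⟨q, hq, P, Q, hP, hQ, hF⟩ := hF
  refine ⟨a * q, by positivity, P, fun x => Q x * (1 / a), hP, hQ.mul analyticAt_const, ?_⟩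
  have ha' : (0 : ℝ) < 1 / a := by positivity
  have ht : Tendsto (fun h : ℝ => h ^ (1 / a : ℝ)) (𝓝[>] 0) (𝓝[>] 0) := by
    apply tendsto_nhdsWithin_of_tendsto_nhds_of_eventually_within
    · have : ContinuousAt (fun h : ℝ => h ^ (1 / a : ℝ)) 0 :=
        Real.continuousAt_rpow_const _ _ (Or.inr ha'.le)
      have h2 := this.tendsto
      rw [Real.zero_rpow ha'.ne'] at h2
      exact h2.mono_left nhdsWithin_le_nhds
    · filter_upwards [self_mem_nhdsWithin] with h hh
      exact Real.rpow_pos_of_pos hh _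
  filter_upwards [ht.eventually hF, self_mem_nhdsWithin] with h h1 h2
  rw [h1, ← Real.rpow_mul (le_of_lt h2), Real.log_rpow h2]
  have : (1 / (a : ℝ)) * (1 / q) = 1 / ((a * q : ℕ) : ℝ) := by push_cast; field_simp
  rw [this]
  ring

theorem hasSum_of_analyticAt {P : ℝ → ℝ} (hP : AnalyticAt ℝ P 0) :
    ∃ a : ℕ → ℝ, ∀ᶠ x in 𝓝 (0 : ℝ), HasSum (fun n => a n * x ^ n) (P x) := by
  obtain ⟨p, hp⟩ := hP
  refine ⟨fun n => p.coeff n, ?_⟩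
  filter_upwards [hp.eventually_hasSum] with x hx
  simpa [mul_comm] using hx

theorem LogPuiseux.exists_hasSum {F : ℝ → ℝ} (hF : LogPuiseux F) :
    ∃ h₀ > (0 : ℝ), ∃ q : ℕ, 0 < q ∧ ∃ (k₀ : ℤ) (A B : ℤ → ℝ),
      ∀ h ∈ Set.Ioo (0 : ℝ) h₀,
        HasSum
          (fun k : ℕ =>
            (A (k₀ + k) + B (k₀ + k) * Real.log h) *
              h ^ (((k₀ + k : ℤ) : ℝ) / (q : ℝ)))
          (F h) := by
  obtain ⟨q, hq, P, Q, hP, hQ, hF⟩ := hF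
  obtain ⟨a, ha⟩ := hasSum_of_analyticAt hP
  obtain ⟨b, hb⟩ := hasSum_of_analyticAt hQ
  have hq' : (0 : ℝ) < 1 / q := by positivity
  have ht : Tendsto (fun h : ℝ => h ^ (1 / q : ℝ)) (𝓝[>] 0) (𝓝 0) := by
    have : ContinuousAt (fun h : ℝ => h ^ (1 / q : ℝ)) 0 :=
      Real.continuousAt_rpow_const _ _ (Or.inr hq'.le)
    have h2 := this.tendsto
    rw [Real.zero_rpow hq'.ne'] at h2
    exact h2.mono_left nhdsWithin_le_nhds
  obtain ⟨h₀, hh₀, H⟩ := (nhdsGT_basis (0 : ℝ)).eventually_iff.1 ((hF.and (ht.eventually ha)).and (ht.eventually hb))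
  refine ⟨h₀, hh₀, q, hq, 0, fun k => a k.toNat, fun k => b k.toNat, fun h hh => ?_⟩
  obtain ⟨⟨h1, h2⟩, h3⟩ := H hh
  rw [h1]
  refine (h2.add (h3.mul_right (Real.log h))).congr_fun ?_
  intro k
  have : h ^ (((0 + k : ℤ) : ℝ) / (q : ℝ)) = (h ^ (1 / q : ℝ)) ^ k := by
    rw [← Real.rpow_natCast, ← Real.rpow_mul hh.1.le]
    congr 1
    push_cast
    ring
  rw [this]
  simp
  ring

/-- Up to `μ`-null sets, `X ∩ {G ≠ 0}` is a finite disjoint union of preconnected pieces, each having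
log-Puiseux sublevel areas. -/
def Good (G : ℝ × ℝ → ℝ) (μ : Measure (ℝ × ℝ)) (X : Set (ℝ × ℝ)) : Prop :=
  ∃ (ι : Type) (_ : Finite ι) (C : ι → Set (ℝ × ℝ)),
    (∀ i, IsPreconnected (C i) ∧ C i ⊆ X ∧ (∀ z ∈ C i, G z ≠ 0) ∧ μ (C i) ≠ ⊤ ∧
      MeasurableSet (C i) ∧ (∀ h, MeasurableSet (C i ∩ {z | |G z| < h})) ∧
      LogPuiseux (fun h => (μ (C i ∩ {z | |G z| < h})).toReal)) ∧
    (∀ i j, i ≠ j → μ (C i ∩ C j) = 0) ∧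
    μ {z ∈ X | G z ≠ 0 ∧ ∀ i, z ∉ C i} = 0

theorem Good.mono_ae {G : ℝ × ℝ → ℝ} {μ : Measure (ℝ × ℝ)} {X Y : Set (ℝ × ℝ)} (h : Good G μ X)
    (hXY : X ⊆ Y) (h0 : μ {z ∈ Y | z ∉ X ∧ G z ≠ 0} = 0) : Good G μ Y := by
  obtain ⟨ι, hι, C, h1, h2, h3⟩ := h
  refine ⟨ι, hι, C, fun i => ⟨(h1 i).1, (h1 i).2.1.trans hXY, (h1 i).2.2⟩, h2, ?_⟩
  refine measure_mono_null ?_ (measure_union_null h3 h0)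
  rintro z ⟨hz, hG, hC⟩
  by_cases hX : z ∈ X
  · exact Or.inl ⟨hX, hG, hC⟩
  · exact Or.inr ⟨hz, hX, hG⟩

theorem Good.of_eq_zero {G : ℝ × ℝ → ℝ} {μ : Measure (ℝ × ℝ)} {X : Set (ℝ × ℝ)}
    (h : ∀ z ∈ X, G z = 0) : Good G μ X := by
  refine ⟨Empty, inferInstance, fun _ => ∅, fun i => i.elim, fun i => i.elim, ?_⟩
  convert measure_empty (μ := μ)
  ext z
  simp only [mem_ofPred_eq, mem_empty_iff_false, iff_false]
  exact fun hz => hz.2.1 (h z hz.1)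

theorem Good.single {G : ℝ × ℝ → ℝ} {μ : Measure (ℝ × ℝ)} {X : Set (ℝ × ℝ)}
    (hc : IsPreconnected X) (hG : ∀ z ∈ X, G z ≠ 0) (hf : μ X ≠ ⊤) (hm : MeasurableSet X)
    (hm' : ∀ h, MeasurableSet (X ∩ {z | |G z| < h}))
    (hL : LogPuiseux (fun h => (μ (X ∩ {z | |G z| < h})).toReal)) : Good G μ X := by
  refine ⟨Unit, inferInstance, fun _ => X, fun _ => ⟨hc, subset_rfl, hG, hf, hm, hm', hL⟩,
    fun i j h => absurd rfl h, ?_⟩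
  convert measure_empty (μ := μ)
  ext z
  simp only [mem_ofPred_eq, mem_empty_iff_false, iff_false]
  exact fun hz => hz.2.2 () hz.1

theorem Good.union {G : ℝ × ℝ → ℝ} {μ : Measure (ℝ × ℝ)} {X Y : Set (ℝ × ℝ)} (hX : Good G μ X)
    (hY : Good G μ Y) (h0 : μ (X ∩ Y) = 0) : Good G μ (X ∪ Y) := by
  obtain ⟨ι, hι, C, h1, h2, h3⟩ := hX
  obtain ⟨κ, hκ, E, k1, k2, k3⟩ := hY
  refine ⟨ι ⊕ κ, inferInstance, Sum.elim C E, ?_, ?_, ?_⟩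
  · rintro (i | i)
    · exact ⟨(h1 i).1, (h1 i).2.1.trans subset_union_left, (h1 i).2.2⟩
    · exact ⟨(k1 i).1, (k1 i).2.1.trans subset_union_right, (k1 i).2.2⟩
  · rintro (i | i) (j | j) hij
    · exact h2 i j (by simpa using hij)
    · exact measure_mono_null (inter_subset_inter (h1 i).2.1 (k1 j).2.1) h0
    · exact measure_mono_null (t := X ∩ Y) (fun z hz => ⟨(h1 j).2.1 hz.2, (k1 i).2.1 hz.1⟩) h0
    · exact k2 i j (by simpa using hij)
  · refine measure_mono_null ?_ (measure_union_null h3 k3)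
    rintro z ⟨hz | hz, hG, hC⟩
    · exact Or.inl ⟨hz, hG, fun i => hC (Sum.inl i)⟩
    · exact Or.inr ⟨hz, hG, fun i => hC (Sum.inr i)⟩

/-- A set saturated with respect to the preconnected subsets of `X ∩ {G ≠ 0}` has log-Puiseux
sublevel areas. -/
theorem Good.logPuiseux {G : ℝ × ℝ → ℝ} {μ : Measure (ℝ × ℝ)} {X S : Set (ℝ × ℝ)} (hX : Good G μ X)
    (hS : S ⊆ X) (hS0 : ∀ z ∈ S, G z ≠ 0)
    (hsat : ∀ C ⊆ X, (∀ z ∈ C, G z ≠ 0) → IsPreconnected C → C ⊆ S ∨ Disjoint C S) :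
    LogPuiseux (fun h => (μ (S ∩ {z | |G z| < h})).toReal) := by
  classical
  obtain ⟨ι, hι, C, h1, h2, h3⟩ := hX
  have := Fintype.ofFinite ι
  let J : Finset ι := Finset.univ.filter fun i => C i ⊆ S
  refine LogPuiseux.congr (LogPuiseux.sum J (F := fun i h => (μ (C i ∩ {z | |G z| < h})).toReal)
    fun i _ => (h1 i).2.2.2.2.2.2) (Eventually.of_forall fun h => ?_)
  have hfin : ∀ i ∈ J, μ (C i ∩ {z | |G z| < h}) ≠ ⊤ := fun i _ =>
    ne_top_of_le_ne_top (h1 i).2.2.2.1 (measure_mono inter_subset_left)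
  rw [← ENNReal.toReal_sum hfin, ← measure_biUnion_finset₀ _
    (fun i _ => ((h1 i).2.2.2.2.2.1 h).nullMeasurableSet)]
  · congr 1
    apply le_antisymm
    · apply measure_mono
      refine iUnion₂_subset fun i hi => inter_subset_inter_left _ ?_
      simpa [J] using hi
    · have : S ∩ {z | |G z| < h} ⊆ (⋃ b ∈ J, C b ∩ {z | |G z| < h}) ∪
          {z ∈ X | G z ≠ 0 ∧ ∀ i, z ∉ C i} := by
        rintro z ⟨hz, hzh⟩
        by_cases hC : ∀ i, z ∉ C i
        · exact Or.inr ⟨hS hz, hS0 z hz, hC⟩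
        · push Not at hC
          obtain ⟨i, hi⟩ := hC
          left
          simp only [mem_iUnion]
          refine ⟨i, ?_, hi, hzh⟩
          rcases hsat (C i) (h1 i).2.1 (h1 i).2.2.1 (h1 i).1 with h | h
          · simpa [J] using h
          · exact absurd hz (disjoint_left.1 h hi)
      refine (measure_mono this).trans ((measure_union_le _ _).trans ?_)
      rw [h3, add_zero]
  · intro i _ j _ hij
    exact measure_mono_null (inter_subset_inter inter_subset_left inter_subset_left) (h2 i j hij)

/-- The measure on the plane with density `D`. -/
noncomputable def dens (D : ℝ × ℝ → ℝ) : Measure (ℝ × ℝ) :=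
  volume.withDensity fun z => ENNReal.ofReal (D z)

theorem dens_null {D : ℝ × ℝ → ℝ} {s : Set (ℝ × ℝ)} (h : volume s = 0) : dens D s = 0 :=
  withDensity_absolutelyContinuous _ _ h

theorem Good.transport {G G' : ℝ × ℝ → ℝ} {D D' : ℝ × ℝ → ℝ} {R X : Set (ℝ × ℝ)}
    {Φ : ℝ × ℝ → ℝ × ℝ} {Φ' : ℝ × ℝ → ℝ × ℝ →L[ℝ] ℝ × ℝ} (h : Good G' (dens D') R)
    (hR : MeasurableSet R) (hinj : InjOn Φ R) (hd : ∀ z ∈ R, HasFDerivAt Φ (Φ' z) z)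
    (hG : ∀ z ∈ R, G (Φ z) = G' z)
    (hD : ∀ z ∈ R, |(Φ' z).det| * D (Φ z) = D' z) (hX : X = Φ '' R) : Good G (dens D) X := by
  have key : ∀ S ⊆ R, MeasurableSet S → MeasurableSet (Φ '' S) ∧ dens D (Φ '' S) = dens D' S := by
    intro S hS hSm
    have hd' : ∀ z ∈ S, HasFDerivWithinAt Φ (Φ' z) S z := fun z hz => (hd z (hS hz)).hasFDerivWithinAt
    have hm := measurable_image_of_fderivWithin hSm hd' (hinj.mono hS)
    refine ⟨hm, ?_⟩
    rw [dens, withDensity_apply _ hm,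
      lintegral_image_eq_lintegral_abs_det_fderiv_mul volume hSm hd' (hinj.mono hS), dens,
      withDensity_apply _ hSm]
    refine setLIntegral_congr_fun hSm fun z hz => ?_
    rw [← ENNReal.ofReal_mul (abs_nonneg _), hD z (hS hz)]
  have hcont : ContinuousOn Φ R := fun z hz => (hd z hz).continuousAt.continuousWithinAt
  obtain ⟨ι, hι, C, h1, h2, h3⟩ := h
  have hsub : ∀ S h, S ⊆ R → Φ '' S ∩ {z | |G z| < h} = Φ '' (S ∩ {z | |G' z| < h}) := by
    intro S h hS
    ext z
    constructor
    · rintro ⟨⟨w, hw, rfl⟩, hz⟩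
      exact ⟨w, ⟨hw, by simpa [hG w (hS hw)] using hz⟩, rfl⟩
    · rintro ⟨w, ⟨hw, hw'⟩, rfl⟩
      exact ⟨⟨w, hw, rfl⟩, by simpa [hG w (hS hw)] using hw'⟩
  subst hX
  have hCi : ∀ i h, C i ∩ {z | |G' z| < h} ⊆ R := fun i h => inter_subset_left.trans (h1 i).2.1
  refine ⟨ι, hι, fun i => Φ '' C i, fun i => ⟨(h1 i).1.image _ (hcont.mono (h1 i).2.1),
    image_mono (h1 i).2.1, ?_, ?_, (key _ (h1 i).2.1 (h1 i).2.2.2.2.1).1, fun h => ?_, ?_⟩, ?_, ?_⟩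
  · rintro _ ⟨z, hz, rfl⟩
    rw [hG z ((h1 i).2.1 hz)]
    exact (h1 i).2.2.1 z hz
  · rw [(key _ (h1 i).2.1 (h1 i).2.2.2.2.1).2]
    exact (h1 i).2.2.2.1
  · rw [hsub _ _ (h1 i).2.1]
    exact (key _ (hCi i h) ((h1 i).2.2.2.2.2.1 h)).1
  · refine (h1 i).2.2.2.2.2.2.congr (Eventually.of_forall fun h => ?_)
    dsimp only
    rw [hsub _ _ (h1 i).2.1, (key _ (hCi i h) ((h1 i).2.2.2.2.2.1 h)).2]
  · intro i j hij
    rw [← hinj.image_inter (h1 i).2.1 (h1 j).2.1,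
      (key _ (inter_subset_left.trans (h1 i).2.1) ((h1 i).2.2.2.2.1.inter (h1 j).2.2.2.2.1)).2,
      h2 i j hij]
  · obtain ⟨T, hT, hTm, hT0⟩ := exists_measurable_superset_of_null h3
    have h4 : dens D (Φ '' (T ∩ R)) = 0 := by
      rw [(key _ inter_subset_right (hTm.inter hR)).2]
      exact measure_mono_null inter_subset_left hT0
    refine measure_mono_null ?_ h4
    rintro _ ⟨⟨z, hz, rfl⟩, hG0, hC⟩
    refine ⟨z, ⟨hT ⟨hz, ?_, fun i hi => hC i ⟨z, hi, rfl⟩⟩, hz⟩, rfl⟩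
    rwa [hG z hz] at hG0

theorem det_eq (L : ℝ × ℝ →L[ℝ] ℝ × ℝ) :
    L.det = (L (1, 0)).1 * (L (0, 1)).2 - (L (0, 1)).1 * (L (1, 0)).2 := by
  rw [ContinuousLinearMap.det, ← LinearMap.det_toMatrix (Module.Basis.finTwoProd ℝ), Matrix.det_fin_two]
  simp [LinearMap.toMatrix_apply]

theorem hasSum_antidiagonal {f : ℕ × ℕ → ℝ} {T : ℝ} (h : HasSum f T) :
    HasSum (fun n => ∑ ij ∈ Finset.HasAntidiagonal.antidiagonal n, f ij) T := by
  have h1 := (Finset.HasAntidiagonal.sigmaAntidiagonalEquivProd (A := ℕ)).hasSum_iff.2 h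
  refine h1.sigma fun n => ?_
  have := hasSum_fintype (fun b : ↥(Finset.HasAntidiagonal.antidiagonal n) => f b)
  rw [← Finset.sum_coe_sort]
  exact this

/-- The double power series with coefficients `c` converges absolutely on the closed polydisc of
radius `R`. -/
def DConv (c : ℕ × ℕ → ℝ) (R : ℝ) : Prop :=
  Summable fun ij : ℕ × ℕ => |c ij| * R ^ (ij.1 + ij.2)

/-- The sum of a double power series. -/
noncomputable def dsum (c : ℕ × ℕ → ℝ) (z : ℝ × ℝ) : ℝ :=
  ∑' ij : ℕ × ℕ, c ij * (z.1 ^ ij.1 * z.2 ^ ij.2)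

theorem abs_monomial_le {R x y : ℝ} (hx : |x| ≤ R) (hy : |y| ≤ R) (a : ℝ) (i j : ℕ) :
    ‖a * (x ^ i * y ^ j)‖ ≤ |a| * R ^ (i + j) := by
  have hR := (abs_nonneg x).trans hx
  rw [Real.norm_eq_abs, abs_mul, abs_mul, abs_pow, abs_pow, pow_add]
  gcongr

theorem DConv.hasSum {c : ℕ × ℕ → ℝ} {R x y : ℝ} (h : DConv c R) (hx : |x| ≤ R) (hy : |y| ≤ R) :
    HasSum (fun ij : ℕ × ℕ => c ij * (x ^ ij.1 * y ^ ij.2)) (dsum c (x, y)) := by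
  refine Summable.hasSum (Summable.of_norm_bounded h fun ij => ?_)
  exact abs_monomial_le hx hy _ _ _

theorem DConv.mono_coeff {c c' : ℕ × ℕ → ℝ} {R : ℝ} (h : DConv c R) (hR : 0 ≤ R)
    (hc : ∀ ij, |c' ij| ≤ |c ij|) : DConv c' R := by
  refine Summable.of_nonneg_of_le (fun ij => by positivity) (fun ij => ?_) h
  have := hc ij
  gcongr

theorem DConv.mono {c : ℕ × ℕ → ℝ} {R r : ℝ} (h : DConv c R) (hr : 0 ≤ r) (hrR : r ≤ R) :
    DConv c r := by
  refine Summable.of_nonneg_of_le (fun ij => by positivity) (fun ij => ?_) h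
  gcongr

/-- The monomial `x ^ i * y ^ (n - i)` as a continuous multilinear map. -/
noncomputable def monomialCMM (i n : ℕ) : ContinuousMultilinearMap ℝ (fun _ : Fin n => ℝ × ℝ) ℝ :=
  (ContinuousMultilinearMap.mkPiAlgebraFin ℝ n ℝ).compContinuousLinearMap fun k =>
    if (k : ℕ) < i then ContinuousLinearMap.fst ℝ ℝ ℝ else ContinuousLinearMap.snd ℝ ℝ ℝ

theorem monomialCMM_apply (i j : ℕ) (z : ℝ × ℝ) :
    monomialCMM i (i + j) (fun _ => z) = z.1 ^ i * z.2 ^ j := by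
  simp only [monomialCMM, ContinuousMultilinearMap.compContinuousLinearMap_apply,
    ContinuousMultilinearMap.mkPiAlgebraFin_apply]
  rw [List.prod_ofFn, Fin.prod_univ_add]
  simp

theorem norm_monomialCMM_le (i n : ℕ) : ‖monomialCMM i n‖ ≤ 1 := by
  refine (ContinuousMultilinearMap.norm_compContinuousLinearMap_le _ _).trans ?_
  rw [ContinuousMultilinearMap.norm_mkPiAlgebraFin, one_mul]
  refine Finset.prod_le_one (fun _ _ => norm_nonneg _) fun k _ => ?_
  split_ifs
  · exact ContinuousLinearMap.norm_fst_le _ _ _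
  · exact ContinuousLinearMap.norm_snd_le _ _ _

theorem DConv.analyticOnNhd {c : ℕ × ℕ → ℝ} {R : ℝ} (h : DConv c R) (hR : 0 < R) :
    AnalyticOnNhd ℝ (dsum c) (Metric.ball 0 R) := by
  let p : FormalMultilinearSeries ℝ (ℝ × ℝ) ℝ := fun n =>
    ∑ ij ∈ Finset.HasAntidiagonal.antidiagonal n, c ij • monomialCMM ij.1 n
  have hp : HasFPowerSeriesOnBall (dsum c) p 0 (ENNReal.ofReal R) := by
    refine ⟨?_, by simpa using hR, ?_⟩
    · refine p.le_radius_of_summable_norm (r := R.toNNReal) ?_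
      have h1 := (hasSum_antidiagonal (Summable.hasSum h)).summable
      refine Summable.of_nonneg_of_le (fun n => by positivity) (fun n => ?_) h1
      rw [Real.coe_toNNReal R hR.le]
      have : ‖p n‖ ≤ ∑ ij ∈ Finset.HasAntidiagonal.antidiagonal n, |c ij| := by
        refine (norm_sum_le _ _).trans (Finset.sum_le_sum fun ij _ => ?_)
        rw [norm_smul, Real.norm_eq_abs]
        exact mul_le_of_le_one_right (abs_nonneg _) (norm_monomialCMM_le _ _)
      calc ‖p n‖ * R ^ n ≤ (∑ ij ∈ Finset.HasAntidiagonal.antidiagonal n, |c ij|) * R ^ n := by gcongr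
        _ = _ := by
          rw [Finset.sum_mul]
          refine Finset.sum_congr rfl fun ij hij => ?_
          rw [Finset.HasAntidiagonal.mem_antidiagonal.1 hij]
    · intro z hz
      rw [Metric.eball_ofReal, mem_ball_zero_iff, Prod.norm_def, max_lt_iff] at hz
      have h1 := hasSum_antidiagonal (h.hasSum hz.1.le hz.2.le)
      rw [zero_add]
      refine h1.congr_fun fun n => ?_
      simp only [p, sum_apply, smul_apply, smul_eq_mul]
      refine Finset.sum_congr rfl fun ij hij => ?_
      obtain ⟨i, j⟩ := ij
      obtain rfl := Finset.HasAntidiagonal.mem_antidiagonal.1 hij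
      rw [monomialCMM_apply]
  have := hp.analyticOnNhd
  rwa [Metric.eball_ofReal] at this

theorem DConv.analyticAt_zero {c : ℕ × ℕ → ℝ} {R : ℝ} (h : DConv c R) (hR : 0 < R) :
    AnalyticAt ℝ (dsum c) 0 :=
  h.analyticOnNhd hR 0 (by simpa using hR)

theorem exists_dsum {f : ℝ × ℝ → ℝ} (hf : AnalyticAt ℝ f 0) :
    ∃ R > 0, ∃ c, DConv c R ∧ ∀ x y, |x| ≤ R → |y| ≤ R → f (x, y) = dsum c (x, y) := by
  obtain ⟨p, r, hp⟩ := hf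
  obtain ⟨ρ, hρ0, hρ⟩ := ENNReal.lt_iff_exists_nnreal_btwn.1 hp.r_pos
  obtain ⟨C, hC, hCn⟩ := p.norm_mul_pow_le_of_lt_radius (hρ.trans_le hp.r_le)
  have hρ0' : (0 : ℝ) < ρ := by simpa using hρ0
  let e (n : ℕ) (s : Finset (Fin n)) : ℝ :=
    p n (s.piecewise (fun _ => ((1 : ℝ), (0 : ℝ))) (fun _ => ((0 : ℝ), (1 : ℝ))))
  have he : ∀ n s, |e n s| ≤ ‖p n‖ := by
    intro n s
    refine ((p n).le_opNorm _).trans (mul_le_of_le_one_right (norm_nonneg _) ?_)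
    refine Finset.prod_le_one (fun _ _ => norm_nonneg _) fun k _ => ?_
    by_cases hk : k ∈ s <;> simp [hk, Prod.norm_def]
  let c : ℕ × ℕ → ℝ := fun ij =>
    ∑ s ∈ (Finset.univ : Finset (Finset (Fin (ij.1 + ij.2)))) with s.card = ij.1, e _ s
  have hc : ∀ ij, |c ij| ≤ 2 ^ (ij.1 + ij.2) * ‖p (ij.1 + ij.2)‖ := by
    intro ij
    refine (Finset.abs_sum_le_sum_abs _ _).trans ((Finset.sum_le_sum fun s _ => he _ s).trans ?_)
    rw [Finset.sum_const, nsmul_eq_mul]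
    gcongr
    have := Finset.card_le_univ ((Finset.univ : Finset (Finset (Fin (ij.1 + ij.2)))).filter
      fun s => s.card = ij.1)
    rw [Fintype.card_finset, Fintype.card_fin] at this
    exact_mod_cast this
  have hR : (0 : ℝ) < ρ / 4 := by positivity
  have hconv : DConv c (ρ / 4) := by
    have hg : Summable fun ij : ℕ × ℕ => C * ((1 / 2 : ℝ) ^ ij.1 * (1 / 2 : ℝ) ^ ij.2) := by
      refine Summable.mul_left _ (Summable.mul_of_nonneg summable_geometric_two
        summable_geometric_two (fun _ => by positivity) fun _ => by positivity)
    refine Summable.of_nonneg_of_le (fun ij => by positivity) (fun ij => ?_) hg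
    calc |c ij| * (ρ / 4 : ℝ) ^ (ij.1 + ij.2)
        ≤ 2 ^ (ij.1 + ij.2) * ‖p (ij.1 + ij.2)‖ * (ρ / 4 : ℝ) ^ (ij.1 + ij.2) := by
          gcongr; exact hc ij
      _ = ‖p (ij.1 + ij.2)‖ * (ρ : ℝ) ^ (ij.1 + ij.2) * (1 / 2) ^ (ij.1 + ij.2) := by
          rw [mul_comm (2 ^ _), mul_assoc, mul_assoc, ← mul_pow, ← mul_pow]; congr 2; ring
      _ ≤ C * (1 / 2) ^ (ij.1 + ij.2) := by gcongr; exact hCn _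
      _ = _ := by rw [pow_add]
  refine ⟨ρ / 4, hR, c, hconv, fun x y hx hy => ?_⟩
  have hz : (x, y) ∈ Metric.eball (0 : ℝ × ℝ) r := by
    rw [mem_eball_zero_iff]
    refine lt_of_le_of_lt ?_ hρ
    have : ‖(x, y)‖ ≤ ρ := by
      rw [Prod.norm_def, max_le_iff]
      exact ⟨hx.trans (by linarith), hy.trans (by linarith)⟩
    rw [← ofReal_norm, ← ENNReal.ofReal_coe_nnreal]
    exact ENNReal.ofReal_le_ofReal this
  have h1 := hp.hasSum hz
  rw [zero_add] at h1
  refine h1.unique ?_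
  refine (hasSum_antidiagonal (hconv.hasSum hx hy)).congr_fun fun n => ?_
  have hxy : (fun _ : Fin n => (x, y)) = (fun _ : Fin n => x • ((1 : ℝ), (0 : ℝ))) +
      fun _ => y • ((0 : ℝ), (1 : ℝ)) := by
    ext <;> simp
  rw [hxy, (p n).map_add_univ]
  have hterm : ∀ s : Finset (Fin n), p n (s.piecewise (fun _ => x • ((1 : ℝ), (0 : ℝ)))
      fun _ => y • ((0 : ℝ), (1 : ℝ))) = x ^ s.card * y ^ (n - s.card) * e n s := by
    intro s
    have : (s.piecewise (fun _ : Fin n => x • ((1 : ℝ), (0 : ℝ))) fun _ => y • ((0 : ℝ), (1 : ℝ))) =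
        fun k => (s.piecewise (fun _ => x) (fun _ => y) : Fin n → ℝ) k •
          (s.piecewise (fun _ => ((1 : ℝ), (0 : ℝ))) (fun _ => ((0 : ℝ), (1 : ℝ))) : Fin n → ℝ × ℝ) k := by
      funext k
      by_cases hk : k ∈ s <;> simp [hk]
    rw [this, (p n).map_smul_univ, Finset.prod_piecewise, smul_eq_mul]
    simp [e, Finset.card_sdiff]
  simp_rw [hterm]
  rw [← Finset.sum_fiberwise_of_maps_to (s := Finset.univ) (t := Finset.HasAntidiagonal.antidiagonal n)
    (g := fun s : Finset (Fin n) => (s.card, n - s.card))]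
  · refine Finset.sum_congr rfl fun ij hij => ?_
    obtain ⟨i, j⟩ := ij
    obtain rfl := Finset.HasAntidiagonal.mem_antidiagonal.1 hij
    simp only [c]
    rw [Finset.sum_mul]
    have hset : (Finset.univ.filter fun s : Finset (Fin (i + j)) => (s.card, i + j - s.card) = (i, j)) =
        Finset.univ.filter fun s : Finset (Fin (i + j)) => s.card = i := by
      ext s
      simp only [Finset.mem_filter, Finset.mem_univ, true_and, Prod.mk.injEq]
      omega
    rw [hset]
    refine Finset.sum_congr rfl fun s hs => ?_
    rw [(Finset.mem_filter.1 hs).2, Nat.add_sub_cancel_left]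
    ring
  · intro s _
    have := Finset.card_le_univ s
    rw [Fintype.card_fin] at this
    simp; omega

theorem eventually_box {p : ℝ × ℝ → Prop} (h : ∀ᶠ z in 𝓝 (0 : ℝ × ℝ), p z) :
    ∃ δ > 0, ∀ x y : ℝ, |x| ≤ δ → |y| ≤ δ → p (x, y) := by
  obtain ⟨δ, hδ, H⟩ := Metric.nhds_basis_closedBall.eventually_iff.1 h
  refine ⟨δ, hδ, fun x y hx hy => H ?_⟩
  rw [mem_closedBall_zero_iff, Prod.norm_def, max_le_iff]
  exact ⟨hx, hy⟩

theorem eventually_of_box {p : ℝ × ℝ → Prop} {δ : ℝ} (hδ : 0 < δ)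
    (h : ∀ x y : ℝ, |x| ≤ δ → |y| ≤ δ → p (x, y)) : ∀ᶠ z in 𝓝 (0 : ℝ × ℝ), p z := by
  refine Metric.nhds_basis_closedBall.eventually_iff.2 ⟨δ, hδ, fun z hz => ?_⟩
  rw [mem_closedBall_zero_iff, Prod.norm_def, max_le_iff] at hz
  exact h z.1 z.2 hz.1 hz.2

theorem tendsto_prodMk_zero_right : Tendsto (fun x : ℝ => (x, (0 : ℝ))) (𝓝 0) (𝓝 0) := by
  have : ContinuousAt (fun x : ℝ => (x, (0 : ℝ))) 0 := by fun_prop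
  exact this.tendsto

theorem tendsto_prodMk_zero_left : Tendsto (fun y : ℝ => ((0 : ℝ), y)) (𝓝 0) (𝓝 0) := by
  have : ContinuousAt (fun y : ℝ => ((0 : ℝ), y)) 0 := by fun_prop
  exact this.tendsto

/-- Division by the second variable. -/
theorem exists_div_snd {f : ℝ × ℝ → ℝ} (hf : AnalyticAt ℝ f 0) :
    ∃ g : ℝ × ℝ → ℝ, AnalyticAt ℝ g 0 ∧ ∀ᶠ z in 𝓝 (0 : ℝ × ℝ), f z = f (z.1, 0) + z.2 * g z := by
  obtain ⟨R, hR, c, hc, hfc⟩ := exists_dsum hf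
  have hinj : Function.Injective fun ij : ℕ × ℕ => (ij.1, ij.2 + 1) := fun a b h => by
    simpa [Prod.ext_iff] using h
  have hc' : DConv (fun ij => c (ij.1, ij.2 + 1)) R := by
    have := ((hc : Summable _).comp_injective hinj).mul_right R⁻¹
    refine this.congr fun ij => ?_
    simp only [Function.comp]
    field_simp
    ring
  refine ⟨dsum fun ij => c (ij.1, ij.2 + 1), hc'.analyticAt_zero hR, eventually_of_box hR ?_⟩
  intro x y hx hy
  rw [hfc x y hx hy, hfc x 0 hx (by simpa using hR.le)]
  rw [← sub_eq_iff_eq_add']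
  refine ((hc.hasSum hx hy).sub (hc.hasSum hx (y := 0) (by simpa using hR.le))).unique ?_
  refine (hinj.hasSum_iff ?_).1 ?_
  · rintro ⟨i, j⟩ hij
    rcases j with - | j
    · simp
    · exact absurd ⟨(i, j), rfl⟩ hij
  · refine ((hc'.hasSum hx hy).mul_left y).congr_fun fun ij => ?_
    simp only [Function.comp]
    ring

/-- Division by `t ^ d`. -/
theorem exists_div_pow {f : ℝ × ℝ → ℝ} (hf : AnalyticAt ℝ f 0) (d : ℕ) :
    ∃ (a : ℕ → ℝ → ℝ) (U : ℝ × ℝ → ℝ), (∀ j, AnalyticAt ℝ (a j) 0) ∧ AnalyticAt ℝ U 0 ∧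
      ∀ᶠ z in 𝓝 (0 : ℝ × ℝ), f z = ∑ j ∈ Finset.range d, a j z.1 * z.2 ^ j + z.2 ^ d * U z := by
  induction d generalizing f with
  | zero => exact ⟨fun _ _ => 0, f, fun _ => analyticAt_const, hf, by simp⟩
  | succ d ih =>
    obtain ⟨g, hg, hfg⟩ := exists_div_snd hf
    obtain ⟨a, U, ha, hU, h⟩ := ih hg
    refine ⟨fun j => Nat.casesOn j (fun x => f (x, 0)) a, U, ?_, hU, ?_⟩
    · rintro (- | j)
      · exact AnalyticAt.fun_comp (g := f) (f := fun x => (x, (0 : ℝ))) hf (by fun_prop)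
      · exact ha j
    · filter_upwards [hfg, h] with z h1 h2
      rw [h1, h2, Finset.sum_range_succ', mul_add, Finset.mul_sum]
      have : ∑ j ∈ Finset.range d, z.2 * (a j z.1 * z.2 ^ j) =
          ∑ j ∈ Finset.range d, a j z.1 * z.2 ^ (j + 1) :=
        Finset.sum_congr rfl fun j _ => by ring
      change _ = ∑ j ∈ Finset.range d, a j z.1 * z.2 ^ (j + 1) + f (z.1, 0) * z.2 ^ 0 + _
      rw [this]
      ring

theorem eventually_zero_of_hasSum {g : ℝ → ℝ} {c : ℕ → ℝ}
    (h : ∀ᶠ x in 𝓝 (0 : ℝ), HasSum (fun n => c n * x ^ n) (g x))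
    (h0 : ∀ᶠ x in 𝓝 (0 : ℝ), g x = 0) (n : ℕ) : c n = 0 := by
  have hp : HasFPowerSeriesAt g (FormalMultilinearSeries.ofScalars ℝ c) 0 := by
    rw [hasFPowerSeriesAt_iff]
    filter_upwards [h] with x hx
    simpa [FormalMultilinearSeries.coeff_ofScalars, mul_comm] using hx
  have h1 : HasFPowerSeriesAt (0 : ℝ → ℝ) (FormalMultilinearSeries.ofScalars ℝ c) 0 := hp.congr h0
  have h2 := h1.eq_zero
  rw [← FormalMultilinearSeries.coeff_ofScalars (𝕜 := ℝ) (p := c) (n := n), h2]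
  rfl

/-- Division by the maximal power of the first variable. -/
theorem exists_factor_fst {f : ℝ × ℝ → ℝ} (hf : AnalyticAt ℝ f 0) :
    (∀ᶠ z in 𝓝 (0 : ℝ × ℝ), f z = 0) ∨ ∃ (m : ℕ) (g : ℝ × ℝ → ℝ), AnalyticAt ℝ g 0 ∧
      (∀ᶠ z in 𝓝 (0 : ℝ × ℝ), f z = z.1 ^ m * g z) ∧ ¬ ∀ᶠ t in 𝓝 (0 : ℝ), g (0, t) = 0 := by
  classical
  obtain ⟨R, hR, c, hc, hfc⟩ := exists_dsum hf
  by_cases h0 : ∃ i, ∃ j, c (i, j) ≠ 0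
  · right
    let m := Nat.find h0
    have hm : ∃ j, c (m, j) ≠ 0 := Nat.find_spec h0
    have hm' : ∀ i < m, ∀ j, c (i, j) = 0 := fun i hi j => by
      have := Nat.find_min h0 hi
      push Not at this
      exact this j
    have hinj : Function.Injective fun ij : ℕ × ℕ => (ij.1 + m, ij.2) := fun a b h => by
      simpa [Prod.ext_iff] using h
    have hc' : DConv (fun ij => c (ij.1 + m, ij.2)) R := by
      have := ((hc : Summable _).comp_injective hinj).mul_right (R ^ m)⁻¹
      refine this.congr fun ij => ?_
      simp only [Function.comp]
      field_simp
      ring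
    refine ⟨m, dsum fun ij => c (ij.1 + m, ij.2), hc'.analyticAt_zero hR, eventually_of_box hR ?_, ?_⟩
    · intro x y hx hy
      rw [hfc x y hx hy]
      refine (hc.hasSum hx hy).unique ((hinj.hasSum_iff ?_).1 ?_)
      · rintro ⟨i, j⟩ hij
        rcases lt_or_ge i m with hi | hi
        · simp [hm' i hi j]
        · exact absurd ⟨(i - m, j), by simp [Nat.sub_add_cancel hi]⟩ hij
      · refine ((hc'.hasSum hx hy).mul_left (x ^ m)).congr_fun fun ij => ?_
        simp only [Function.comp]
        ring
    · intro hz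
      obtain ⟨j, hj⟩ := hm
      refine hj (eventually_zero_of_hasSum (c := fun j => c (m, j)) ?_ hz j)
      have hb : ∀ᶠ t : ℝ in 𝓝 0, |t| ≤ R := by
        have := Metric.closedBall_mem_nhds (0 : ℝ) hR
        filter_upwards [this] with t ht
        simpa using ht
      filter_upwards [hb] with t ht
      have h1 := hc'.hasSum (x := 0) (y := t) (by simpa using hR.le) ht
      have hi : Function.Injective fun j : ℕ => (0, j) := fun a b h => by simpa using h
      rw [← hi.hasSum_iff] at h1
      · refine h1.congr_fun fun j => ?_
        simp
      · rintro ⟨i, j⟩ hij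
        rcases i with - | i
        · exact absurd ⟨j, rfl⟩ hij
        · simp
  · left
    push Not at h0
    refine eventually_of_box hR fun x y hx hy => ?_
    rw [hfc x y hx hy]
    simp [dsum, h0]

theorem DConv.hasSum_integral {k : ℕ × ℕ → ℝ} {R Y δ : ℝ} (hk : DConv k R) (hYδ : Y ≤ δ) {p : ℝ → ℝ}
    (hpm : Measurable p) (hp : ∀ y ∈ Icc Y δ, |p y| ≤ R) (hR : ∀ y ∈ Icc Y δ, |y| ≤ R) :
    HasSum (fun ij : ℕ × ℕ => ∫ y in Y..δ, k ij * (p y ^ ij.1 * y ^ ij.2))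
      (∫ y in Y..δ, dsum k (p y, y)) := by
  have hsub : ∀ t, t ∈ uIoc Y δ → t ∈ Icc Y δ := fun t ht => by
    rw [uIoc_of_le hYδ] at ht
    exact Ioc_subset_Icc_self ht
  refine intervalIntegral.hasSum_integral_of_dominated_convergence
    (fun ij _ => |k ij| * R ^ (ij.1 + ij.2)) (fun ij => ?_) (fun ij => ?_) ?_ ?_ ?_
  · exact Measurable.aestronglyMeasurable (by fun_prop)
  · exact Eventually.of_forall fun t ht => abs_monomial_le (hp t (hsub t ht)) (hR t (hsub t ht)) _ _ _
  · exact Eventually.of_forall fun t _ => hk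
  · exact intervalIntegrable_const
  · exact Eventually.of_forall fun t ht => hk.hasSum (hp t (hsub t ht)) (hR t (hsub t ht))

/-- Primitives with respect to the second variable of analytic functions. -/
theorem exists_primitive {f : ℝ × ℝ → ℝ} (hf : AnalyticAt ℝ f 0) :
    ∃ L : ℝ × ℝ → ℝ, AnalyticAt ℝ L 0 ∧ ∃ R > 0, ∀ x Y δ, |x| ≤ R → -R ≤ Y → Y ≤ δ → δ ≤ R →
      ∫ y in Y..δ, f (x, y) = L (x, δ) - L (x, Y) := by
  obtain ⟨R, hR, k, hk, hfk⟩ := exists_dsum hf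
  let l : ℕ × ℕ → ℝ := fun ij => k ij / (ij.2 + 1)
  have hl : DConv l R := hk.mono_coeff hR.le fun ij => by
    rw [abs_div]
    refine div_le_self (abs_nonneg _) ?_
    rw [abs_of_nonneg (by positivity)]
    have : (0 : ℝ) ≤ ij.2 := by positivity
    linarith
  refine ⟨fun z => z.2 * dsum l z, analyticAt_snd.mul (hl.analyticAt_zero hR), R, hR, ?_⟩
  intro x Y δ hx hY hYδ hδ
  have hyR : ∀ y ∈ Icc Y δ, |y| ≤ R := fun y hy => abs_le.2 ⟨hY.trans hy.1, hy.2.trans hδ⟩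
  have h1 := hk.hasSum_integral hYδ (p := fun _ => x) measurable_const (fun _ _ => hx) hyR
  have h2 : ∫ y in Y..δ, f (x, y) = ∫ y in Y..δ, dsum k (x, y) := by
    refine intervalIntegral.integral_congr fun y hy => ?_
    rw [uIcc_of_le hYδ] at hy
    exact hfk x y hx (hyR y hy)
  rw [h2]
  refine h1.unique ((((hl.hasSum hx (hyR δ ⟨hYδ, le_rfl⟩)).mul_left δ).sub
    ((hl.hasSum hx (hyR Y ⟨le_rfl, hYδ⟩)).mul_left Y)).congr_fun fun ij => ?_)
  simp only [intervalIntegral.integral_const_mul, integral_pow, l]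
  ring

theorem inv_pow_mul_pow_eq_zpow {y : ℝ} (hy : y ≠ 0) (b i j : ℕ) :
    ((y ^ b)⁻¹) ^ i * y ^ j = y ^ ((j : ℤ) - b * i) := by
  rw [zpow_sub₀ hy, zpow_natCast, inv_pow, ← pow_mul, div_eq_inv_mul]
  norm_cast

/-- The integral of an analytic function along the curves `s * y ^ b = κ`. -/
theorem exists_curve_primitive {K : ℝ × ℝ → ℝ} (hK : AnalyticAt ℝ K 0) (b : ℕ) :
    ∃ R > 0, ∃ L : ℝ × ℝ → ℝ, ∃ S : ℝ → ℝ,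
      (∀ s y, |s| ≤ R → |y| ≤ R → AnalyticAt ℝ L (s, y)) ∧ AnalyticAt ℝ S 0 ∧
      ∀ κ Y δ, 0 ≤ κ → 0 < Y → Y ≤ δ → δ ≤ R → κ ≤ R * Y ^ b →
        ∫ y in Y..δ, K (κ * (y ^ b)⁻¹, y) = L (κ * (δ ^ b)⁻¹, δ) - L (κ * (Y ^ b)⁻¹, Y) +
          S κ * (Real.log δ - Real.log Y) := by
  classical
  obtain ⟨R, hR, k, hk, hfk⟩ := exists_dsum hK
  let β : ℕ × ℕ → ℤ := fun ij => ij.2 - b * ij.1 + 1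
  let l : ℕ × ℕ → ℝ := fun ij => k ij / β ij
  let m : ℕ × ℕ → ℝ := fun ij => if β ij = 0 then k ij else 0
  have hl : DConv l R := hk.mono_coeff hR.le fun ij => by
    simp only [l]
    by_cases h : β ij = 0
    · simp [h]
    rw [abs_div]
    refine div_le_self (abs_nonneg _) ?_
    exact_mod_cast Int.one_le_abs h
  have hm : DConv m R := hk.mono_coeff hR.le fun ij => by
    simp only [m]
    split_ifs <;> simp
  have han : ∀ {c : ℕ × ℕ → ℝ}, DConv c R → ∀ s y, |s| ≤ R / 2 → |y| ≤ R / 2 →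
      AnalyticAt ℝ (dsum c) (s, y) := fun hc s y hs hy => by
    refine hc.analyticOnNhd hR _ ?_
    rw [mem_ball_zero_iff, Prod.norm_def, max_lt_iff]
    exact ⟨lt_of_le_of_lt hs (by linarith), lt_of_le_of_lt hy (by linarith)⟩
  have hR2 : 0 < R / 2 := by positivity
  refine ⟨R / 2, hR2, fun z => z.2 * dsum l z,
    fun κ => R / 2 * dsum m (κ * ((R / 2) ^ b)⁻¹, R / 2),
    fun s y hs hy => analyticAt_snd.mul (han hl s y hs hy), ?_, ?_⟩
  · refine analyticAt_const.mul (AnalyticAt.fun_comp (g := dsum m)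
      (f := fun κ : ℝ => (κ * ((R / 2) ^ b)⁻¹, R / 2)) (han hm _ _ ?_ ?_) (by fun_prop))
    · simpa using hR2.le
    · rw [abs_of_pos hR2]
  intro κ Y δ hκ hY hYδ hδ hκY
  have hyR : ∀ y ∈ Icc Y δ, |y| ≤ R := fun y hy => by
    rw [abs_of_pos (hY.trans_le hy.1)]
    linarith [hy.2]
  have hsR : ∀ y, Y ≤ y → |κ * (y ^ b)⁻¹| ≤ R / 2 := fun y hy => by
    have hy0 := hY.trans_le hy
    rw [abs_of_nonneg (by positivity), ← div_eq_mul_inv, div_le_iff₀ (by positivity)]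
    refine hκY.trans ?_
    gcongr
  have hsR' : ∀ y, Y ≤ y → |κ * (y ^ b)⁻¹| ≤ R := fun y hy => (hsR y hy).trans (by linarith)
  have h1 := hk.hasSum_integral hYδ (p := fun y => κ * (y ^ b)⁻¹) (by fun_prop)
    (fun y hy => hsR' y hy.1) hyR
  have h2 : ∫ y in Y..δ, K (κ * (y ^ b)⁻¹, y) = ∫ y in Y..δ, dsum k (κ * (y ^ b)⁻¹, y) := by
    refine intervalIntegral.integral_congr fun y hy => ?_
    rw [uIcc_of_le hYδ] at hy
    exact hfk _ y (hsR' y hy.1) (hyR y hy)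
  rw [h2]
  have hδ0 : 0 < δ := hY.trans_le hYδ
  have e1 := (hl.hasSum (hsR' δ hYδ) (hyR δ ⟨hYδ, le_rfl⟩)).mul_left δ
  have e2 := (hl.hasSum (hsR' Y le_rfl) (hyR Y ⟨le_rfl, hYδ⟩)).mul_left Y
  have e3 := ((hm.hasSum (hsR' (R / 2) (hYδ.trans hδ)) (y := R / 2)
    (by rw [abs_of_pos hR2]; linarith)).mul_left (R / 2)).mul_right (Real.log δ - Real.log Y)
  refine h1.unique (((e1.sub e2).add e3).congr_fun fun ij => ?_)
  have hmono : ∀ y : ℝ, 0 < y → (κ * (y ^ b)⁻¹) ^ ij.1 * y ^ ij.2 = κ ^ ij.1 * y ^ (β ij - 1) := by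
    intro y hy
    rw [mul_pow, mul_assoc, inv_pow_mul_pow_eq_zpow hy.ne']
    congr 2
    simp only [β]
    ring
  have hmono' : ∀ y : ℝ, 0 < y → y * (l ij * ((κ * (y ^ b)⁻¹) ^ ij.1 * y ^ ij.2)) =
      l ij * κ ^ ij.1 * y ^ (β ij) := by
    intro y hy
    rw [hmono y hy, zpow_sub_one₀ hy.ne']
    field_simp
  have hint : ∫ y in Y..δ, k ij * ((κ * (y ^ b)⁻¹) ^ ij.1 * y ^ ij.2) =
      k ij * κ ^ ij.1 * ∫ y in Y..δ, y ^ (β ij - 1) := by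
    rw [← intervalIntegral.integral_const_mul]
    refine intervalIntegral.integral_congr fun y hy => ?_
    rw [uIcc_of_le hYδ] at hy
    simp only [hmono y (hY.trans_le hy.1)]
    ring
  have h0 : (0 : ℝ) ∉ uIcc Y δ := by
    rw [uIcc_of_le hYδ]
    exact fun h => absurd h.1 (not_le.2 hY)
  rw [hint, hmono' δ hδ0, hmono' Y hY, hmono _ hR2]
  simp only [l, m]
  by_cases h : β ij = 0
  · have hRne : R ≠ 0 := hR.ne'
    rw [h]
    simp only [zero_sub, zpow_neg_one, integral_inv h0, Int.cast_zero, div_zero, zero_mul, if_true,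
      sub_zero, zero_add, Real.log_div hδ0.ne' hY.ne']
    field_simp
  · rw [integral_zpow (Or.inr ⟨by omega, h0⟩), if_neg h]
    have : (β ij : ℝ) ≠ 0 := by exact_mod_cast h
    simp only [sub_add_cancel]
    push_cast
    rw [sub_add_cancel]
    field_simp
    ring

theorem clm_apply_eq (A : ℝ × ℝ →L[ℝ] ℝ) (z : ℝ × ℝ) : A z = z.1 * A (1, 0) + z.2 * A (0, 1) := by
  have : z = z.1 • ((1 : ℝ), (0 : ℝ)) + z.2 • ((0 : ℝ), (1 : ℝ)) := by ext <;> simp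
  conv_lhs => rw [this]
  rw [map_add, map_smul, map_smul, smul_eq_mul, smul_eq_mul]

/-- An analytic function with nonvanishing partial derivative can be solved for its second
variable. -/
theorem exists_partial_inverse {F : ℝ × ℝ → ℝ} (hF : AnalyticAt ℝ F 0) (hF0 : F 0 = 0)
    (hd : fderiv ℝ F 0 (0, 1) ≠ 0) :
    ∃ T : ℝ × ℝ → ℝ, AnalyticAt ℝ T 0 ∧ T 0 = 0 ∧ (∀ᶠ z in 𝓝 (0 : ℝ × ℝ), F (z.1, T z) = z.2) ∧
      ∀ᶠ z in 𝓝 (0 : ℝ × ℝ), T (z.1, F z) = z.2 := by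
  let Ψ : ℝ × ℝ → ℝ × ℝ := fun z => (z.1, F z)
  have hΨ : AnalyticAt ℝ Ψ 0 := analyticAt_fst.prod hF
  let A := fderiv ℝ F 0
  let fw : ℝ × ℝ →L[ℝ] ℝ × ℝ := (ContinuousLinearMap.fst ℝ ℝ ℝ).prod A
  let bw : ℝ × ℝ →L[ℝ] ℝ × ℝ := (ContinuousLinearMap.fst ℝ ℝ ℝ).prod
    ((A (0, 1))⁻¹ • (ContinuousLinearMap.snd ℝ ℝ ℝ - A (1, 0) • ContinuousLinearMap.fst ℝ ℝ ℝ))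
  have hA : A (0, 1) ≠ 0 := hd
  let i : (ℝ × ℝ) ≃L[ℝ] ℝ × ℝ := ContinuousLinearEquiv.equivOfInverse fw bw
    (fun z => by
      ext
      · rfl
      · simp only [fw, bw, ContinuousLinearMap.prod_apply, smul_apply,
          sub_apply, ContinuousLinearMap.coe_fst', ContinuousLinearMap.coe_snd',
          smul_eq_mul, clm_apply_eq A z]
        field_simp
        ring)
    (fun z => by
      ext
      · rfl
      · simp only [fw, bw, ContinuousLinearMap.prod_apply, smul_apply,
          sub_apply, ContinuousLinearMap.coe_fst', ContinuousLinearMap.coe_snd',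
          smul_eq_mul]
        rw [clm_apply_eq A]
        field_simp
        ring)
  have hstrict : HasStrictFDerivAt Ψ (i : ℝ × ℝ →L[ℝ] ℝ × ℝ) 0 :=
    hasStrictFDerivAt_fst.prodMk hF.hasStrictFDerivAt
  let e := hstrict.toOpenPartialHomeomorph Ψ
  have he : (e : ℝ × ℝ → ℝ × ℝ) = Ψ := hstrict.toOpenPartialHomeomorph_coe
  have h0 : (0 : ℝ × ℝ) ∈ e.source := hstrict.mem_toOpenPartialHomeomorph_source
  have hΨ0 : Ψ 0 = 0 := by ext <;> simp [Ψ, hF0]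
  have hsymm : AnalyticAt ℝ e.symm 0 := by
    have := e.analyticAt_symm' (i := i) h0 (by rw [he]; exact hΨ)
      (by rw [he]; exact hstrict.hasFDerivAt.fderiv)
    rwa [he, hΨ0] at this
  have hr : ∀ᶠ z in 𝓝 (0 : ℝ × ℝ), Ψ (e.symm z) = z := by
    have := e.eventually_right_inverse' h0
    rwa [he, hΨ0] at this
  have hl : ∀ᶠ z in 𝓝 (0 : ℝ × ℝ), e.symm (Ψ z) = z := by
    have := e.eventually_left_inverse h0
    rwa [he] at this
  refine ⟨fun z => (e.symm z).2, analyticAt_snd.fun_comp hsymm, ?_, ?_, ?_⟩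
  · have := hl.self_of_nhds
    rw [hΨ0] at this
    simp [this]
  · filter_upwards [hr] with z hz
    have h1 : (e.symm z).1 = z.1 := (Prod.ext_iff.1 hz).1
    have h2 : F (e.symm z) = z.2 := (Prod.ext_iff.1 hz).2
    rw [← h1]
    exact h2
  · filter_upwards [hl] with z hz
    exact congrArg Prod.snd hz

/-- A function with positive partial derivative is locally strictly increasing in the second
variable. -/
theorem exists_strictMonoOn {F : ℝ × ℝ → ℝ} (hF : AnalyticAt ℝ F 0) (hd : 0 < fderiv ℝ F 0 (0, 1)) :
    ∃ δ > 0, ∀ x, |x| ≤ δ → StrictMonoOn (fun y => F (x, y)) (Icc (-δ) δ) := by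
  have hc : ContinuousAt (fun z => fderiv ℝ F z (0, 1)) 0 := by
    have : ContinuousAt (fderiv ℝ F) 0 := hF.fderiv.continuousAt
    fun_prop
  obtain ⟨δ, hδ, H⟩ := eventually_box ((hc.eventually (lt_mem_nhds hd)).and hF.eventually_analyticAt)
  refine ⟨δ, hδ, fun x hx => ?_⟩
  have hder : ∀ y ∈ Icc (-δ) δ, HasDerivAt (fun y => F (x, y)) (fderiv ℝ F (x, y) (0, 1)) y := by
    intro y hy
    have h1 := (H x y hx (abs_le.2 hy)).2.differentiableAt.hasFDerivAt
    have h2 : HasDerivAt (fun y : ℝ => (x, y)) ((0 : ℝ), (1 : ℝ)) y :=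
      (hasDerivAt_const y x).prodMk (hasDerivAt_id y)
    exact h1.comp_hasDerivAt y h2
  refine strictMonoOn_of_deriv_pos (convex_Icc _ _) (fun y hy => (hder y hy).continuousAt.continuousWithinAt)
    fun y hy => ?_
  rw [interior_Icc] at hy
  have hy' := Ioo_subset_Icc_self hy
  rw [(hder y hy').deriv]
  exact (H x y hx (abs_le.2 hy')).1

theorem fderiv_snd_mul {u : ℝ × ℝ → ℝ} (hu : AnalyticAt ℝ u 0) :
    fderiv ℝ (fun z : ℝ × ℝ => z.2 * u z) 0 (0, 1) = u 0 := by
  have h : HasFDerivAt (fun z : ℝ × ℝ => z.2 * u z) _ 0 :=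
    (hasFDerivAt_snd (𝕜 := ℝ) (E := ℝ) (F := ℝ) (p := 0)).mul hu.differentiableAt.hasFDerivAt
  rw [h.fderiv]
  simp

/-- Fubini's theorem for regions whose horizontal sections are intervals starting at `0`. -/
theorem dens_region {D : ℝ × ℝ → ℝ} {ε y₁ y₂ : ℝ} (hy : y₁ ≤ y₂)
    (hc : ContinuousOn D (Icc 0 ε ×ˢ Icc y₁ y₂)) (hD : ∀ z ∈ Ioo 0 ε ×ˢ Ioo y₁ y₂, 0 ≤ D z)
    {S : Set (ℝ × ℝ)} (hS : S ⊆ Ioo 0 ε ×ˢ Ioo y₁ y₂) (hm : MeasurableSet S) {g : ℝ → ℝ}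
    (hfib : ∀ y ∈ Ioo y₁ y₂, ∃ x ≥ 0, {ξ | (ξ, y) ∈ S} = Ioo 0 x ∧ ∫ ξ in 0..x, D (ξ, y) = g y) :
    IntervalIntegrable g volume y₁ y₂ ∧ (dens D S).toReal = ∫ y in y₁..y₂, g y := by
  have hint : IntegrableOn D S :=
    (hc.integrableOn_compact (isCompact_Icc.prod isCompact_Icc)).mono_set
      (hS.trans (prod_mono Ioo_subset_Icc_self Ioo_subset_Icc_self))
  have h1 : (dens D S).toReal = ∫ z in S, D z := by
    rw [dens, withDensity_apply _ hm, integral_eq_lintegral_of_nonneg_ae]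
    · exact (ae_restrict_iff' hm).2 (Eventually.of_forall fun z hz => hD z (hS hz))
    · exact hint.aestronglyMeasurable
  have hint' : Integrable (S.indicator D) (volume.prod volume) := by
    rw [← Measure.volume_eq_prod]
    exact hint.integrable_indicator hm
  have h2 : ∀ y, ∫ ξ, S.indicator D (ξ, y) = (Ioo y₁ y₂).indicator g y := by
    intro y
    by_cases hyy : y ∈ Ioo y₁ y₂
    · obtain ⟨x, hx0, hx, hxg⟩ := hfib y hyy
      rw [indicator_of_mem hyy, ← hxg, intervalIntegral.integral_of_le hx0,
        integral_Ioc_eq_integral_Ioo, ← hx, ← integral_indicator]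
      · rfl
      · rw [hx]
        exact measurableSet_Ioo
    · rw [indicator_of_notMem hyy]
      refine (integral_congr_ae (Eventually.of_forall fun ξ => ?_)).trans (integral_zero _ _)
      exact indicator_of_notMem (fun h => hyy (hS h).2) _
  have h3 : Integrable ((Ioo y₁ y₂).indicator g) := by
    have := hint'.integral_prod_right
    simpa only [h2] using this
  refine ⟨?_, ?_⟩
  · rw [intervalIntegrable_iff_integrableOn_Ioo_of_le hy]
    exact (integrable_indicator_iff measurableSet_Ioo).1 h3
  · rw [h1, ← integral_indicator hm, Measure.volume_eq_prod, integral_prod_symm _ hint']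
    simp only [h2]
    rw [integral_indicator measurableSet_Ioo, ← integral_Ioc_eq_integral_Ioo,
      intervalIntegral.integral_of_le hy]

theorem analyticAt_swap {u : ℝ × ℝ → ℝ} (hu : AnalyticAt ℝ u 0) :
    AnalyticAt ℝ (fun z : ℝ × ℝ => u (z.2, z.1)) 0 :=
  AnalyticAt.fun_comp (g := u) (f := fun z : ℝ × ℝ => (z.2, z.1)) hu
    (analyticAt_snd.prod analyticAt_fst)

/-- Description of the sets `{x * u x y < s}` for fixed `y`. -/
theorem exists_section {u D : ℝ × ℝ → ℝ} (hu : AnalyticAt ℝ u 0) (hu0 : 0 < u 0)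
    (hD : AnalyticAt ℝ D 0) :
    ∃ Φ K : ℝ × ℝ → ℝ, AnalyticAt ℝ Φ 0 ∧ AnalyticAt ℝ K 0 ∧ ∃ δ > 0, ∀ y, |y| ≤ δ →
      (∀ x, 0 ≤ x → x ≤ δ → ∫ ξ in 0..x, D (ξ, y) = Φ (x, y)) ∧
      ∀ ε, 0 < ε → ε ≤ δ → ∀ s,
        (ε * u (ε, y) ≤ s → {x ∈ Ioo 0 ε | x * u (x, y) < s} = Ioo 0 ε) ∧
        (0 ≤ s → s < ε * u (ε, y) → ∃ x ∈ Ico 0 ε,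
          {x ∈ Ioo 0 ε | x * u (x, y) < s} = Ioo 0 x ∧ Φ (x, y) = K (s, y)) := by
  have hus := analyticAt_swap hu
  let F : ℝ × ℝ → ℝ := fun z => z.2 * u (z.2, z.1)
  have hF : AnalyticAt ℝ F 0 := analyticAt_snd.mul hus
  have hFd : fderiv ℝ F 0 (0, 1) = u 0 := fderiv_snd_mul hus
  obtain ⟨T, hT, hT0, -, hTl⟩ := exists_partial_inverse hF (by simp [F]) (by rw [hFd]; exact hu0.ne')
  obtain ⟨δ₁, hδ₁, hmono⟩ := exists_strictMonoOn hF (by rw [hFd]; exact hu0)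
  obtain ⟨L, hL, R, hR, hprim⟩ := exists_primitive (analyticAt_swap hD)
  obtain ⟨δ₂, hδ₂, hbox⟩ := eventually_box (hTl.and hF.eventually_continuousAt)
  let Φ : ℝ × ℝ → ℝ := fun z => L (z.2, z.1) - L (z.2, 0)
  have hΦ : AnalyticAt ℝ Φ 0 := (analyticAt_swap hL).sub
    (AnalyticAt.fun_comp (g := L) (f := fun z : ℝ × ℝ => (z.2, (0 : ℝ))) hL
      (analyticAt_snd.prod analyticAt_const))
  have hK : AnalyticAt ℝ (fun z : ℝ × ℝ => Φ (T (z.2, z.1), z.2)) 0 := by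
    refine AnalyticAt.fun_comp (g := Φ) (f := fun z : ℝ × ℝ => (T (z.2, z.1), z.2)) ?_
      ((analyticAt_swap hT).prod analyticAt_snd)
    have : (T ((0 : ℝ × ℝ).2, (0 : ℝ × ℝ).1), (0 : ℝ × ℝ).2) = 0 := by
      ext
      · exact hT0
      · rfl
    rw [this]
    exact hΦ
  refine ⟨Φ, _, hΦ, hK, min (min δ₁ δ₂) R, by positivity, fun y hy => ⟨fun x hx0 hx => ?_,
    fun ε hε0 hε s => ?_⟩⟩
  · have := hprim y 0 x (hy.trans (min_le_right _ _)) (by linarith) hx0 (hx.trans (min_le_right _ _))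
    exact this
  have hδ1 : min (min δ₁ δ₂) R ≤ δ₁ := (min_le_left _ _).trans (min_le_left _ _)
  have hδ2 : min (min δ₁ δ₂) R ≤ δ₂ := (min_le_left _ _).trans (min_le_right _ _)
  have hm := hmono y (hy.trans hδ1)
  have hin : ∀ x ∈ Icc 0 ε, x ∈ Icc (-δ₁) δ₁ := fun x hx => ⟨by linarith [hx.1], by linarith [hx.2]⟩
  have hlt : ∀ x ∈ Icc 0 ε, ∀ x' ∈ Icc 0 ε, (x * u (x, y) < x' * u (x', y) ↔ x < x') :=
    fun x hx x' hx' => hm.lt_iff_lt (hin x hx) (hin x' hx')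
  have hεm : ε ∈ Icc 0 ε := ⟨hε0.le, le_rfl⟩
  refine ⟨fun hs => ?_, fun hs0 hs => ?_⟩
  · ext x
    refine ⟨fun hx => hx.1, fun hx => ⟨hx, lt_of_lt_of_le ?_ hs⟩⟩
    exact (hlt x (Ioo_subset_Icc_self hx) ε hεm).2 hx.2
  · have hcont : ContinuousOn (fun x => x * u (x, y)) (Icc 0 ε) := by
      intro x hx
      have h1 : ContinuousAt F (y, x) := (hbox y x (hy.trans hδ2)
        (abs_le.2 ⟨by linarith [hx.1], by linarith [hx.2]⟩)).2
      exact (ContinuousAt.comp (f := fun x => (y, x)) (g := F) h1 (by fun_prop)).continuousWithinAt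
    obtain ⟨x, hx, hxs⟩ := intermediate_value_Icc hε0.le hcont ⟨by simpa using hs0, hs.le⟩
    simp only at hxs
    have hxε : x < ε := (hlt x hx ε hεm).1 (by rw [hxs]; exact hs)
    refine ⟨x, ⟨hx.1, hxε⟩, ?_, ?_⟩
    · ext x'
      constructor
      · rintro ⟨h1, h2⟩
        rw [← hxs, hlt x' (Ioo_subset_Icc_self h1) x hx] at h2
        exact ⟨h1.1, h2⟩
      · rintro ⟨h1, h2⟩
        refine ⟨⟨h1, h2.trans hxε⟩, ?_⟩
        rw [← hxs, hlt x' ⟨h1.le, (h2.trans hxε).le⟩ x hx]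
        exact h2
    · have h1 : T (y, x * u (x, y)) = x := (hbox y x (hy.trans hδ2)
        (abs_le.2 ⟨by linarith [hx.1], by linarith [hx.2]⟩)).1
      simp only
      rw [← hxs, h1]

/-- The positive `b`-th root. -/
noncomputable def posRoot (b : ℕ) (x : ℝ) : ℝ := Real.exp (Real.log x / b)

theorem posRoot_pos (b : ℕ) (x : ℝ) : 0 < posRoot b x := Real.exp_pos _

theorem posRoot_pow {b : ℕ} (hb : 0 < b) {x : ℝ} (hx : 0 < x) : posRoot b x ^ b = x := by
  rw [posRoot, ← Real.exp_nat_mul, mul_div_cancel₀, Real.exp_log hx]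
  positivity

theorem analyticAt_posRoot (b : ℕ) {E : Type*} [NormedAddCommGroup E] [NormedSpace ℝ E] {u : E → ℝ}
    {z : E} (hu : AnalyticAt ℝ u z) (hz : 0 < u z) : AnalyticAt ℝ (fun z => posRoot b (u z)) z := by
  have h1 : AnalyticAt ℝ (fun x : ℝ => posRoot b x) (u z) :=
    ((analyticAt_id.log hz).div_const (c := (b : ℝ))).rexp
  exact h1.fun_comp hu

theorem tendsto_rpow_inv {q : ℕ} (hq : 0 < q) :
    Tendsto (fun h : ℝ => h ^ (1 / q : ℝ)) (𝓝[>] 0) (𝓝[>] 0) := by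
  have hq' : (0 : ℝ) < 1 / q := by positivity
  apply tendsto_nhdsWithin_of_tendsto_nhds_of_eventually_within
  · have : ContinuousAt (fun h : ℝ => h ^ (1 / q : ℝ)) 0 :=
      Real.continuousAt_rpow_const _ _ (Or.inr hq'.le)
    have h2 := this.tendsto
    rw [Real.zero_rpow hq'.ne'] at h2
    exact h2.mono_left nhdsWithin_le_nhds
  · filter_upwards [self_mem_nhdsWithin] with h hh
    exact Real.rpow_pos_of_pos hh _

/-- An open set of the form `{z ∈ X | u z < κ}`. -/
theorem isOpen_sublevel {u : ℝ × ℝ → ℝ} {X : Set (ℝ × ℝ)} (hX : IsOpen X) (hu : ContinuousOn u X)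
    (κ : ℝ) : IsOpen {z ∈ X | u z < κ} :=
  hu.isOpen_inter_preimage hX isOpen_Iio

theorem logPuiseux_strip {u D : ℝ × ℝ → ℝ} (hu : AnalyticAt ℝ u 0) (hu0 : 0 < u 0)
    (hD : AnalyticAt ℝ D 0) :
    ∃ δ > 0, ∀ ε y₁ y₂, 0 < ε → ε ≤ δ → -δ ≤ y₁ → y₁ ≤ y₂ → y₂ ≤ δ →
      (∀ z ∈ Ioo 0 ε ×ˢ Ioo y₁ y₂, 0 ≤ D z) → LogPuiseux fun κ =>
        (dens D {z ∈ Ioo 0 ε ×ˢ Ioo y₁ y₂ | z.1 * u z < κ}).toReal := by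
  obtain ⟨Φ, K, -, hK, δ₁, hδ₁, hsec⟩ := exists_section hu hu0 hD
  obtain ⟨L, hL, R, hR, hprim⟩ := exists_primitive hK
  obtain ⟨δ₂, hδ₂, hbox⟩ := eventually_box
    ((hu.continuousAt.eventually (lt_mem_nhds (half_lt_self hu0))).and
      (hu.eventually_continuousAt.and hD.eventually_continuousAt))
  obtain ⟨δ₃, hδ₃, hLan⟩ := eventually_box hL.eventually_analyticAt
  refine ⟨min (min δ₁ δ₂) (min R δ₃), by positivity, ?_⟩
  intro ε y₁ y₂ hε0 hε hy₁ hy hy₂ hDpos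
  simp only [le_min_iff] at hε hy₂
  have hy₁' := neg_le.1 hy₁
  simp only [le_min_iff] at hy₁'
  have habs : ∀ y ∈ Icc y₁ y₂, |y| ≤ δ₁ ∧ |y| ≤ δ₂ ∧ |y| ≤ R ∧ |y| ≤ δ₃ := by
    intro y hy
    refine ⟨abs_le.2 ⟨?_, ?_⟩, abs_le.2 ⟨?_, ?_⟩, abs_le.2 ⟨?_, ?_⟩, abs_le.2 ⟨?_, ?_⟩⟩ <;>
      linarith [hy.1, hy.2]
  have hxabs : ∀ x ∈ Icc 0 ε, |x| ≤ δ₂ := fun x hx =>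
    abs_le.2 ⟨by linarith [hx.1], by linarith [hx.2]⟩
  have key : ∀ κ, 0 < κ → κ < ε * (u 0 / 2) → κ ≤ R →
      (dens D {z ∈ Ioo 0 ε ×ˢ Ioo y₁ y₂ | z.1 * u z < κ}).toReal = L (κ, y₂) - L (κ, y₁) := by
    intro κ hκ hκ' hκR
    have hcu : ContinuousOn (fun z : ℝ × ℝ => z.1 * u z) (Ioo 0 ε ×ˢ Ioo y₁ y₂) := fun z hz =>
      (continuousAt_fst.mul (hbox z.1 z.2 (hxabs _ (Ioo_subset_Icc_self hz.1))
        (habs _ (Ioo_subset_Icc_self hz.2)).2.1).2.1).continuousWithinAt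
    rw [(dens_region (D := D) (ε := ε) hy (g := fun y => K (κ, y)) (fun z hz =>
      (hbox z.1 z.2 (hxabs _ hz.1) (habs _ hz.2).2.1).2.2.continuousWithinAt) hDpos
      (fun z hz => hz.1) (isOpen_sublevel (isOpen_Ioo.prod isOpen_Ioo) hcu κ).measurableSet ?_).2]
    · exact hprim κ y₁ y₂ (by rwa [abs_of_pos hκ]) (by linarith) hy hy₂.2.1
    · intro y hyy
      have hyI := Ioo_subset_Icc_self hyy
      obtain ⟨h1, h2⟩ := hsec y (habs y hyI).1
      have hue := (hbox ε y (hxabs ε ⟨hε0.le, le_rfl⟩) (habs y hyI).2.1).1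
      obtain ⟨x, hx, hxs, hxK⟩ := (h2 ε hε0 hε.1.1 κ).2 hκ.le (hκ'.trans (by gcongr))
      refine ⟨x, hx.1, ?_, ?_⟩
      · rw [← hxs]
        ext ξ
        exact ⟨fun h => ⟨h.1.1, h.2⟩, fun h => ⟨⟨h.1, hyy⟩, h.2⟩⟩
      · rw [h1 x hx.1 (hx.2.le.trans hε.1.1), hxK]
  refine ⟨1, one_pos, fun t => L (t, y₂) - L (t, y₁), fun _ => 0, ?_, analyticAt_const, ?_⟩
  · have : ∀ y ∈ Icc y₁ y₂, AnalyticAt ℝ (fun t => L (t, y)) 0 := fun y hy =>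
      AnalyticAt.fun_comp (g := L) (f := fun t : ℝ => (t, y))
        (hLan 0 y (by simpa using hδ₃.le) (habs y hy).2.2.2) (by fun_prop)
    exact (this y₂ ⟨hy, le_rfl⟩).sub (this y₁ ⟨le_rfl, hy⟩)
  · have hpos : 0 < min (ε * (u 0 / 2)) R := by positivity
    filter_upwards [Ioo_mem_nhdsGT hpos] with κ hκ
    rw [key κ hκ.1 (hκ.2.trans_le (min_le_left _ _)) (hκ.2.le.trans (min_le_right _ _))]
    simp

/-- Local solution of `y * w y = z`. -/
theorem exists_inverse_mul {w : ℝ → ℝ} (hw : AnalyticAt ℝ w 0) (hw0 : w 0 ≠ 0) :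
    ∃ θ : ℝ → ℝ, AnalyticAt ℝ θ 0 ∧ θ 0 = 0 ∧ ∀ᶠ z in 𝓝 (0 : ℝ), θ z * w (θ z) = z := by
  let f : ℝ → ℝ := fun y => y * w y
  have hf : AnalyticAt ℝ f 0 := analyticAt_id.mul hw
  have hd : deriv f 0 = w 0 := by
    have : HasDerivAt f (1 * w 0 + 0 * deriv w 0) 0 :=
      (hasDerivAt_id (0 : ℝ)).mul hw.differentiableAt.hasDerivAt
    rw [this.deriv]
    ring
  have hf0 : f 0 = 0 := by simp [f]
  have hd' : deriv f 0 ≠ 0 := by rwa [hd]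
  have h1 := hf.analyticAt_localInverse hd'
  have h2 := hf.hasStrictDerivAt.eventually_right_inverse hd'
  rw [hf0] at h1 h2
  refine ⟨_, h1, ?_, h2⟩
  have h3 : hf.hasStrictDerivAt.localInverse f (deriv f 0) 0 hd' (f 0) = 0 :=
    HasStrictFDerivAt.localInverse_apply_image _
  rwa [hf0] at h3

theorem logPuiseux_corner {u D : ℝ × ℝ → ℝ} (hu : AnalyticAt ℝ u 0) (hu0 : 0 < u 0)
    (hD : AnalyticAt ℝ D 0) {b : ℕ} (hb : 0 < b) :
    ∃ δ₀ > 0, ∀ ε δ, 0 < ε → ε ≤ δ₀ → 0 < δ → δ ≤ δ₀ →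
      (∀ z ∈ Ioo 0 ε ×ˢ Ioo 0 δ, 0 ≤ D z) → LogPuiseux fun κ =>
        (dens D {z ∈ Ioo 0 ε ×ˢ Ioo 0 δ | z.1 * z.2 ^ b * u z < κ}).toReal := by
  obtain ⟨Φ, K, hΦ, hK, δ₁, hδ₁, hsec⟩ := exists_section hu hu0 hD
  obtain ⟨R, hR, L, S, hLan, hS, hcurve⟩ := exists_curve_primitive hK b
  obtain ⟨M, hM, R', hR', hprim⟩ := exists_primitive hΦ
  let w : ℝ × ℝ → ℝ := fun z => posRoot b (u z)
  have hw : AnalyticAt ℝ w 0 := analyticAt_posRoot b hu hu0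
  obtain ⟨δ₄, hδ₄, hmono⟩ := exists_strictMonoOn (F := fun z => z.2 * w z) (analyticAt_snd.mul hw)
    (by rw [fderiv_snd_mul hw]; exact posRoot_pos _ _)
  have hxu : ∀ᶠ z : ℝ × ℝ in 𝓝 0, |z.1 * u z| < R := by
    have : ContinuousAt (fun z : ℝ × ℝ => |z.1 * u z|) 0 := (continuousAt_fst.mul hu.continuousAt).abs
    exact this.eventually (gt_mem_nhds (by simpa using hR))
  obtain ⟨δ₂, hδ₂, hbox⟩ := eventually_box
    ((hu.continuousAt.eventually (lt_mem_nhds hu0)).and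
      (hxu.and (hu.eventually_analyticAt.and (hD.eventually_continuousAt.and hM.eventually_analyticAt))))
  refine ⟨min (min δ₁ δ₂) (min (min R R') δ₄), by positivity, ?_⟩
  intro ε δ hε0 hε hδ0 hδ hDpos
  simp only [le_min_iff] at hε hδ
  have habs : ∀ y ∈ Icc 0 δ, |y| ≤ δ₁ ∧ |y| ≤ δ₂ ∧ |y| ≤ R ∧ |y| ≤ R' ∧ |y| ≤ δ₄ := by
    intro y hy
    rw [abs_of_nonneg hy.1]
    refine ⟨?_, ?_, ?_, ?_, ?_⟩ <;> linarith [hy.2]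
  have hxabs : ∀ x ∈ Icc 0 ε, |x| ≤ δ₂ := fun x hx => by
    rw [abs_of_nonneg hx.1]; linarith [hx.2]
  have hεm : ε ∈ Icc 0 ε := ⟨hε0.le, le_rfl⟩
  have hδm : δ ∈ Icc 0 δ := ⟨hδ0.le, le_rfl⟩
  have h0m : (0 : ℝ) ∈ Icc 0 δ := ⟨le_rfl, hδ0.le⟩
  have hu_an : ∀ x ∈ Icc 0 ε, ∀ y ∈ Icc 0 δ, AnalyticAt ℝ u (x, y) := fun x hx y hy =>
    (hbox x y (hxabs x hx) (habs y hy).2.1).2.2.1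
  have hu_pos : ∀ x ∈ Icc 0 ε, ∀ y ∈ Icc 0 δ, 0 < u (x, y) := fun x hx y hy =>
    (hbox x y (hxabs x hx) (habs y hy).2.1).1
  have hw_an : AnalyticAt ℝ (fun y => w (ε, y)) 0 :=
    AnalyticAt.fun_comp (g := w) (f := fun y => (ε, y))
      (analyticAt_posRoot b (hu_an ε hεm 0 h0m) (hu_pos ε hεm 0 h0m)) (by fun_prop)
  obtain ⟨θ, hθ, hθ0, hθr⟩ := exists_inverse_mul hw_an (posRoot_pos _ _).ne'
  have hmonoε := hmono ε (by rw [abs_of_pos hε0]; exact hε.2.2)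
  -- the value of the integral
  have key : ∀ κ Y, 0 < κ → Y ∈ Ioo 0 δ → ε * u (ε, Y) * Y ^ b = κ →
      (dens D {z ∈ Ioo 0 ε ×ˢ Ioo 0 δ | z.1 * z.2 ^ b * u z < κ}).toReal =
        (M (ε, Y) - M (ε, 0)) + (L (κ * (δ ^ b)⁻¹, δ) - L (ε * u (ε, Y), Y) +
          S κ * (Real.log δ - Real.log Y)) := by
    intro κ Y hκ hY hYκ
    have hcu : ContinuousOn (fun z : ℝ × ℝ => z.1 * z.2 ^ b * u z) (Ioo 0 ε ×ˢ Ioo 0 δ) := fun z hz =>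
      ((continuousAt_fst.mul (continuousAt_snd.pow b)).mul (hu_an z.1 (Ioo_subset_Icc_self hz.1) z.2
        (Ioo_subset_Icc_self hz.2)).continuousAt).continuousWithinAt
    have hpw : ∀ y ∈ Icc 0 δ, (y * w (ε, y)) ^ b * ε = ε * u (ε, y) * y ^ b := fun y hy => by
      rw [mul_pow, posRoot_pow hb (hu_pos ε hεm y hy)]
      ring
    have hle : ∀ y ∈ Ioo 0 δ, (y ≤ Y ↔ ε * u (ε, y) ≤ κ * (y ^ b)⁻¹) := by
      intro y hy
      have hy' := Ioo_subset_Icc_self hy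
      have hY' := Ioo_subset_Icc_self hY
      have h1 : y ≤ Y ↔ y * w (ε, y) ≤ Y * w (ε, Y) :=
        (hmonoε.le_iff_le (abs_le.1 (habs y hy').2.2.2.2) (abs_le.1 (habs Y hY').2.2.2.2)).symm
      rw [h1, ← div_eq_mul_inv, le_div_iff₀ (pow_pos hy.1 b), ← hYκ, ← hpw y hy', ← hpw Y hY',
        mul_le_mul_iff_left₀ hε0, pow_le_pow_iff_left₀ (mul_nonneg hy.1.le (posRoot_pos _ _).le)
          (mul_nonneg hY.1.le (posRoot_pos _ _).le) hb.ne']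
    let g : ℝ → ℝ := fun y => if y ≤ Y then Φ (ε, y) else K (κ * (y ^ b)⁻¹, y)
    obtain ⟨hgi, hg⟩ := dens_region (D := D) (ε := ε) hδ0.le (g := g) (fun z hz =>
      (hbox z.1 z.2 (hxabs _ hz.1) (habs _ hz.2).2.1).2.2.2.1.continuousWithinAt) hDpos
      (S := {z ∈ Ioo 0 ε ×ˢ Ioo 0 δ | z.1 * z.2 ^ b * u z < κ})
      (fun z hz => hz.1) (isOpen_sublevel (isOpen_Ioo.prod isOpen_Ioo) hcu κ).measurableSet (by
        intro y hy
        have hyI := Ioo_subset_Icc_self hy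
        obtain ⟨h1, h2⟩ := hsec y (habs y hyI).1
        obtain ⟨h3, h4⟩ := h2 ε hε0 hε.1.1 (κ * (y ^ b)⁻¹)
        have hset : {ξ | (ξ, y) ∈ {z ∈ Ioo 0 ε ×ˢ Ioo 0 δ | z.1 * z.2 ^ b * u z < κ}} =
            {x ∈ Ioo 0 ε | x * u (x, y) < κ * (y ^ b)⁻¹} := by
          ext ξ
          have : ξ * u (ξ, y) < κ * (y ^ b)⁻¹ ↔ ξ * y ^ b * u (ξ, y) < κ := by
            rw [← div_eq_mul_inv, lt_div_iff₀ (pow_pos hy.1 b)]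
            ring_nf
          constructor
          · rintro ⟨h5, h6⟩
            exact ⟨h5.1, this.2 h6⟩
          · rintro ⟨h5, h6⟩
            exact ⟨⟨h5, hy⟩, this.1 h6⟩
        rw [hset]
        by_cases hyY : y ≤ Y
        · exact ⟨ε, hε0.le, h3 ((hle y hy).1 hyY), by simp only [g, if_pos hyY]; exact h1 ε hε0.le hε.1.1⟩
        · obtain ⟨x, hx, hxs, hxK⟩ := h4 (mul_nonneg hκ.le (inv_nonneg.2 (pow_nonneg hy.1.le b)))
            (not_le.1 fun h => hyY ((hle y hy).2 h))
          refine ⟨x, hx.1, hxs, ?_⟩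
          simp only [g, if_neg hyY]
          rw [h1 x hx.1 (hx.2.le.trans hε.1.1), hxK])
    rw [hg, ← intervalIntegral.integral_add_adjacent_intervals (b := Y)
      (hgi.mono_set (by rw [uIcc_of_le hY.1.le, uIcc_of_le hδ0.le]; exact Icc_subset_Icc_right hY.2.le))
      (hgi.mono_set (by rw [uIcc_of_le hY.2.le, uIcc_of_le hδ0.le]; exact Icc_subset_Icc_left hY.1.le))]
    have e1 : ∫ y in 0..Y, g y = M (ε, Y) - M (ε, 0) := by
      rw [← hprim ε 0 Y (by rw [abs_of_pos hε0]; exact hε.2.1.2) (by linarith) hY.1.le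
        (hY.2.le.trans hδ.2.1.2)]
      refine intervalIntegral.integral_congr fun y hy => ?_
      rw [uIcc_of_le hY.1.le] at hy
      simp only [g, if_pos hy.2]
    have hκeq : κ * (Y ^ b)⁻¹ = ε * u (ε, Y) := by
      rw [← hYκ, mul_assoc, mul_inv_cancel₀ (pow_pos hY.1 b).ne', mul_one]
    have hκle : κ ≤ R * Y ^ b := by
      rw [← hYκ]
      have h5 := (hbox ε Y (hxabs ε hεm) (habs Y (Ioo_subset_Icc_self hY)).2.1).2.1
      have h6 := (le_abs_self _).trans h5.le
      have := pow_pos hY.1 b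
      gcongr
    have e2 : ∫ y in Y..δ, g y = L (κ * (δ ^ b)⁻¹, δ) - L (ε * u (ε, Y), Y) +
          S κ * (Real.log δ - Real.log Y) := by
      rw [← hκeq, ← hcurve κ Y δ hκ.le hY.1 hY.2.le hδ.2.1.1 hκle]
      refine intervalIntegral.integral_congr_ae (Eventually.of_forall fun y hy => ?_)
      rw [uIoc_of_le hY.2.le] at hy
      simp only [g, if_neg (not_le.2 hy.1)]
    rw [e1, e2]
  -- the log-Puiseux expansion
  let c : ℝ := (posRoot b ε)⁻¹
  have hc : 0 < c := inv_pos.2 (posRoot_pos _ _)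
  have hcb : ε * c ^ b = 1 := by
    rw [inv_pow, posRoot_pow hb hε0, mul_inv_cancel₀ hε0.ne']
  let Y : ℝ → ℝ := fun t => θ (c * t)
  have hY_an : AnalyticAt ℝ Y 0 := AnalyticAt.fun_comp (g := θ) (by simpa using hθ) (by fun_prop)
  have hY0 : Y 0 = 0 := by simp [Y, hθ0]
  have hct : Tendsto (fun t : ℝ => c * t) (𝓝 0) (𝓝 0) := by
    have : ContinuousAt (fun t : ℝ => c * t) 0 := by fun_prop
    simpa using this.tendsto
  have hYr : ∀ᶠ t in 𝓝 (0 : ℝ), Y t * w (ε, Y t) = c * t := hct.eventually hθr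
  have hYδ : ∀ᶠ t in 𝓝 (0 : ℝ), Y t < δ :=
    hY_an.continuousAt.eventually (gt_mem_nhds (by rwa [hY0]))
  have huY : AnalyticAt ℝ (fun t => u (ε, Y t)) 0 :=
    AnalyticAt.fun_comp (g := u) (f := fun t => (ε, Y t)) (by rw [hY0]; exact hu_an ε hεm 0 h0m)
      (analyticAt_const.prod hY_an)
  have hwY : AnalyticAt ℝ (fun t => Real.log (w (ε, Y t))) 0 :=
    (analyticAt_posRoot b huY (by rw [hY0]; exact hu_pos ε hεm 0 h0m)).log (posRoot_pos _ _)
  have hSt : AnalyticAt ℝ (fun t : ℝ => S (t ^ b)) 0 := analyticAt_comp_pow hS hb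
  have hMY : AnalyticAt ℝ (fun t => M (ε, Y t)) 0 :=
    AnalyticAt.fun_comp (g := M) (f := fun t => (ε, Y t))
      (by rw [hY0]; exact (hbox ε 0 (hxabs ε hεm) (habs 0 h0m).2.1).2.2.2.2)
      (analyticAt_const.prod hY_an)
  have hL1 : AnalyticAt ℝ (fun t : ℝ => L (t ^ b * (δ ^ b)⁻¹, δ)) 0 := by
    refine AnalyticAt.fun_comp (g := L) (f := fun t : ℝ => (t ^ b * (δ ^ b)⁻¹, δ))
      (hLan _ _ ?_ (habs δ hδm).2.2.1) (by fun_prop)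
    simpa [hb.ne'] using hR.le
  have hL2 : AnalyticAt ℝ (fun t => L (ε * u (ε, Y t), Y t)) 0 := by
    refine AnalyticAt.fun_comp (g := L) (f := fun t => (ε * u (ε, Y t), Y t))
      (hLan _ _ ?_ ?_) ((analyticAt_const.mul huY).prod hY_an)
    · rw [hY0]
      exact (hbox ε 0 (hxabs ε hεm) (habs 0 h0m).2.1).2.1.le
    · rw [hY0]
      exact (habs 0 h0m).2.2.1
  refine ⟨b, hb, fun t => (M (ε, Y t) - M (ε, 0)) + (L (t ^ b * (δ ^ b)⁻¹, δ) - L (ε * u (ε, Y t), Y t) +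
    S (t ^ b) * (Real.log δ - Real.log c + Real.log (w (ε, Y t)))), fun t => -(S (t ^ b) * (1 / b)), ?_,
    (hSt.mul analyticAt_const).neg, ?_⟩
  · exact (hMY.sub analyticAt_const).add ((hL1.sub hL2).add (hSt.mul (analyticAt_const.add hwY)))
  · have ht := tendsto_rpow_inv hb
    filter_upwards [(ht.mono_right nhdsWithin_le_nhds).eventually (hYr.and hYδ), self_mem_nhdsWithin]
      with κ ⟨h1, h2⟩ hκ
    have hκ0 : 0 < κ := hκ
    have htb : (κ ^ (1 / b : ℝ)) ^ b = κ := by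
      have := rpow_inv_pow hκ0 (q := 1) hb
      simpa using this
    have htpos : 0 < κ ^ (1 / b : ℝ) := Real.rpow_pos_of_pos hκ0 _
    have hlog : Real.log (κ ^ (1 / b : ℝ)) = 1 / b * Real.log κ := Real.log_rpow hκ0 _
    generalize κ ^ (1 / b : ℝ) = t at *
    have hYpos : 0 < Y t := by
      have : 0 < Y t * w (ε, Y t) := by rw [h1]; positivity
      exact pos_of_mul_pos_left this (posRoot_pos _ _).le
    have hYm : Y t ∈ Icc 0 δ := ⟨hYpos.le, h2.le⟩
    have hYκ : ε * u (ε, Y t) * (Y t) ^ b = κ := by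
      have h3 : (Y t * w (ε, Y t)) ^ b = c ^ b * t ^ b := by rw [h1, mul_pow]
      rw [mul_pow, posRoot_pow hb (hu_pos ε hεm _ hYm), htb] at h3
      calc _ = ε * (Y t ^ b * u (ε, Y t)) := by ring
        _ = ε * c ^ b * κ := by rw [h3]; ring
        _ = κ := by rw [hcb, one_mul]
    have hlogY : Real.log (Y t) = Real.log c + 1 / b * Real.log κ - Real.log (w (ε, Y t)) := by
      have h4 : Real.log (Y t * w (ε, Y t)) = Real.log c + Real.log t := by
        rw [h1, Real.log_mul hc.ne' htpos.ne']
      rw [Real.log_mul hYpos.ne' (posRoot_pos _ _).ne', hlog] at h4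
      linarith
    rw [key κ (Y t) hκ0 ⟨hYpos, h2⟩ hYκ, hlogY, htb]
    ring

theorem volume_prod_singleton (s : Set ℝ) (b : ℝ) : (volume : Measure (ℝ × ℝ)) (s ×ˢ {b}) = 0 := by
  rw [Measure.volume_eq_prod, Measure.prod_prod]
  simp

theorem volume_singleton_prod (s : Set ℝ) (b : ℝ) : (volume : Measure (ℝ × ℝ)) ({b} ×ˢ s) = 0 := by
  rw [Measure.volume_eq_prod, Measure.prod_prod]
  simp

theorem dens_ne_top {D : ℝ × ℝ → ℝ} {K X : Set (ℝ × ℝ)} (hK : IsCompact K) (hX : MeasurableSet X)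
    (hXK : X ⊆ K) (hc : ContinuousOn D K) : dens D X ≠ ⊤ := by
  rw [dens, withDensity_apply _ hX]
  exact (((hc.integrableOn_compact hK).mono_set hXK).lintegral_lt_top).ne

theorem isPreconnected_box (a b c d : ℝ) : IsPreconnected (Ioo a b ×ˢ Ioo c d) :=
  isPreconnected_Ioo.prod isPreconnected_Ioo

theorem isOpen_box (a b c d : ℝ) : IsOpen (Ioo a b ×ˢ Ioo c d) := isOpen_Ioo.prod isOpen_Ioo

theorem box_subset (a b c d : ℝ) : Ioo a b ×ˢ Ioo c d ⊆ Icc a b ×ˢ Icc c d :=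
  prod_mono Ioo_subset_Icc_self Ioo_subset_Icc_self

theorem Good.congr {G G' D D' : ℝ × ℝ → ℝ} {X : Set (ℝ × ℝ)} (h : Good G (dens D) X)
    (hX : MeasurableSet X) (hG : ∀ z ∈ X, G z = G' z) (hD : ∀ z ∈ X, D z = D' z) :
    Good G' (dens D') X := by
  refine h.transport (Φ := id) (Φ' := fun _ => ContinuousLinearMap.id ℝ _) hX (injOn_id X)
    (fun z _ => hasFDerivAt_id z) (fun z hz => (hG z hz).symm) (fun z hz => ?_) (image_id X).symm
  rw [det_eq]
  simp [hD z hz]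

/-- A box on which `|G|` is a power of a function with log-Puiseux sublevel areas is good. -/
theorem good_box {G g D : ℝ × ℝ → ℝ} {ε y₁ y₂ : ℝ} {a : ℕ} (ha : 0 < a)
    (hg0 : ∀ z ∈ Ioo 0 ε ×ˢ Ioo y₁ y₂, 0 < g z) (hG : ∀ z ∈ Ioo 0 ε ×ˢ Ioo y₁ y₂, |G z| = g z ^ a)
    (hgc : ContinuousOn g (Ioo 0 ε ×ˢ Ioo y₁ y₂)) (hD : ContinuousOn D (Icc 0 ε ×ˢ Icc y₁ y₂))
    (hL : LogPuiseux fun κ => (dens D {z ∈ Ioo 0 ε ×ˢ Ioo y₁ y₂ | g z < κ}).toReal) :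
    Good G (dens D) (Ioo 0 ε ×ˢ Ioo y₁ y₂) := by
  refine Good.single (isPreconnected_box _ _ _ _) (fun z hz => ?_)
    (dens_ne_top (isCompact_Icc.prod isCompact_Icc) (isOpen_box _ _ _ _).measurableSet
      (box_subset _ _ _ _) hD) (isOpen_box _ _ _ _).measurableSet (fun h => ?_) ?_
  · rw [← abs_pos, hG z hz]
    exact pow_pos (hg0 z hz) a
  · have : Ioo 0 ε ×ˢ Ioo y₁ y₂ ∩ {z | |G z| < h} = {z ∈ Ioo 0 ε ×ˢ Ioo y₁ y₂ | g z ^ a < h} := by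
      ext z
      constructor
      · rintro ⟨h1, h2⟩
        exact ⟨h1, by rw [← hG z h1]; exact h2⟩
      · rintro ⟨h1, h2⟩
        exact ⟨h1, by rw [← hG z h1] at h2; exact h2⟩
    rw [this]
    exact (isOpen_sublevel (isOpen_box _ _ _ _) (hgc.pow a) h).measurableSet
  · refine (hL.comp_root ha).congr ?_
    filter_upwards [self_mem_nhdsWithin] with h hh
    have hh0 : 0 < h := hh
    congr 2
    ext z
    have hz : z ∈ Ioo 0 ε ×ˢ Ioo y₁ y₂ → (g z < h ^ (1 / a : ℝ) ↔ |G z| < h) := by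
      intro hz
      have hr := rpow_inv_pow hh0 (q := 1) ha
      simp only [one_mul, Nat.cast_one, div_one, Real.rpow_one] at hr
      rw [hG z hz]
      nth_rw 2 [← hr]
      rw [pow_lt_pow_iff_left₀ (hg0 z hz).le (Real.rpow_nonneg hh0.le _) ha.ne']
    constructor
    · rintro ⟨h1, h2⟩
      exact ⟨h1, (hz h1).1 h2⟩
    · rintro ⟨h1, h2⟩
      exact ⟨h1, (hz h1).2 h2⟩

/-- A box on which `|G|` is bounded below is good. -/
theorem good_of_le {G D : ℝ × ℝ → ℝ} {x₁ x₂ y₁ y₂ c : ℝ} (hc : 0 < c)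
    (hG : ∀ z ∈ Ioo x₁ x₂ ×ˢ Ioo y₁ y₂, c ≤ |G z|) (hGc : ContinuousOn G (Ioo x₁ x₂ ×ˢ Ioo y₁ y₂))
    (hD : ContinuousOn D (Icc x₁ x₂ ×ˢ Icc y₁ y₂)) : Good G (dens D) (Ioo x₁ x₂ ×ˢ Ioo y₁ y₂) := by
  refine Good.single (isPreconnected_box _ _ _ _) (fun z hz => ?_)
    (dens_ne_top (isCompact_Icc.prod isCompact_Icc) (isOpen_box _ _ _ _).measurableSet
      (box_subset _ _ _ _) hD) (isOpen_box _ _ _ _).measurableSet (fun h => ?_) ?_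
  · exact abs_pos.1 (hc.trans_le (hG z hz))
  · exact (isOpen_sublevel (isOpen_box _ _ _ _) hGc.abs h).measurableSet
  · refine LogPuiseux.zero.congr ?_
    filter_upwards [Ioo_mem_nhdsGT hc] with h hh
    have : Ioo x₁ x₂ ×ˢ Ioo y₁ y₂ ∩ {z | |G z| < h} = ∅ := by
      ext z
      simp only [mem_inter_iff, mem_ofPred_eq, mem_empty_iff_false, iff_false, not_and, not_lt]
      exact fun hz => hh.2.le.trans (hG z hz)
    rw [this]
    simp

/-- All sufficiently thin boxes over `(a, b)` are good. -/
def EvGood (G D : ℝ × ℝ → ℝ) (a b : ℝ) : Prop :=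
  ∃ ε₀ > 0, ∀ ε, 0 < ε → ε ≤ ε₀ → Good G (dens D) (Ioo 0 ε ×ˢ Ioo a b)

/-- All sufficiently thin boxes over small intervals near `τ` are good. -/
def FullGood (G D : ℝ × ℝ → ℝ) (τ : ℝ) : Prop :=
  ∃ δ > 0, ∀ a b, τ - δ ≤ a → a ≤ b → b ≤ τ + δ → EvGood G D a b

/-- All sufficiently thin boxes over small intervals around `τ` are good, and the points near `τ`
have the stronger property. -/
def PunctGood (G D : ℝ × ℝ → ℝ) (τ : ℝ) : Prop :=
  ∃ δ > 0, (∀ a b, τ - δ ≤ a → a < τ → τ < b → b ≤ τ + δ → EvGood G D a b) ∧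
    ∀ x, x ≠ τ → |x - τ| ≤ δ → FullGood G D x

theorem EvGood.trans {G D : ℝ × ℝ → ℝ} {a b c : ℝ} (h₁ : EvGood G D a b) (h₂ : EvGood G D b c)
    (hab : a ≤ b) (hbc : b ≤ c) : EvGood G D a c := by
  obtain ⟨ε₁, hε₁, h1⟩ := h₁
  obtain ⟨ε₂, hε₂, h2⟩ := h₂
  refine ⟨min ε₁ ε₂, by positivity, fun ε hε hε' => ?_⟩
  refine ((h1 ε hε (hε'.trans (min_le_left _ _))).union (h2 ε hε (hε'.trans (min_le_right _ _)))
    ?_).mono_ae ?_ ?_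
  · convert measure_empty (μ := dens D)
    ext z
    simp only [mem_inter_iff, mem_prod, mem_Ioo, mem_empty_iff_false, iff_false]
    intro h
    linarith [h.1.2.2, h.2.2.1]
  · refine union_subset (prod_mono subset_rfl (Ioo_subset_Ioo_right hbc))
      (prod_mono subset_rfl (Ioo_subset_Ioo_left hab))
  · refine measure_mono_null ?_ (dens_null (volume_prod_singleton univ b))
    rintro z ⟨hz, hz', -⟩
    refine ⟨mem_univ _, ?_⟩
    by_contra hne
    refine hz' ?_
    rcases lt_or_gt_of_ne hne with h | h
    · exact Or.inl ⟨hz.1, hz.2.1, h⟩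
    · exact Or.inr ⟨hz.1, h, hz.2.2⟩

/-- Continuous induction for additive interval predicates. -/
theorem interval_additive {E : ℝ → ℝ → Prop} {W : Set ℝ} {A B : ℝ} (hAB : A ≤ B) (hA : A ∈ W)
    (hB : B ∈ W) (htrans : ∀ a b c, a ≤ b → b ≤ c → E a b → E b c → E a c)
    (hloc : ∀ x ∈ Icc A B, ∃ δ > 0, (∀ a b, x - δ ≤ a → a ≤ b → b ≤ x + δ → a ∈ W → b ∈ W → E a b) ∧
      ∀ y, y ≠ x → |y - x| ≤ δ → y ∈ W) : E A B := by
  let P : ℝ → Prop := fun x => ∀ y ∈ Icc A x, y ∈ W → E A y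
  let S : Set ℝ := {x ∈ Icc A B | P x}
  have hAS : A ∈ S := by
    refine ⟨⟨le_rfl, hAB⟩, fun y hy hyW => ?_⟩
    obtain rfl : A = y := le_antisymm hy.1 hy.2
    obtain ⟨δ, hδ, h1, -⟩ := hloc A ⟨le_rfl, hAB⟩
    exact h1 A A (by linarith) le_rfl (by linarith) hA hA
  have hbdd : BddAbove S := ⟨B, fun x hx => hx.1.2⟩
  have hsA : A ≤ sSup S := le_csSup hbdd hAS
  have hsB : sSup S ≤ B := csSup_le ⟨A, hAS⟩ fun x hx => hx.1.2
  obtain ⟨δ, hδ, h1, h2⟩ := hloc (sSup S) ⟨hsA, hsB⟩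
  obtain ⟨x, hx, hxs⟩ := exists_lt_of_lt_csSup ⟨A, hAS⟩ (show sSup S - δ < sSup S by linarith)
  have hxle : x ≤ sSup S := le_csSup hbdd hx
  obtain ⟨a, haA, hax, hasδ, haW⟩ : ∃ a, A ≤ a ∧ a ≤ x ∧ sSup S - δ ≤ a ∧ a ∈ W := by
    rcases hxle.lt_or_eq with h | h
    · exact ⟨x, hx.1.1, le_rfl, hxs.le, h2 x h.ne (abs_le.2 ⟨by linarith, by linarith⟩)⟩
    · rcases hsA.lt_or_eq with h' | h'
      · refine ⟨max A (sSup S - δ), le_max_left _ _, max_le hx.1.1 hxs.le, le_max_right _ _, ?_⟩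
        have : max A (sSup S - δ) < sSup S := max_lt h' (by linarith)
        refine h2 _ this.ne (abs_le.2 ⟨?_, by linarith⟩)
        linarith [le_max_right A (sSup S - δ)]
      · exact ⟨A, le_rfl, hx.1.1, by linarith, hA⟩
  have hP : P (min (sSup S + δ) B) := by
    intro y hy hyW
    rcases le_total y a with h | h
    · exact hx.2 y ⟨hy.1, h.trans hax⟩ hyW
    · exact htrans A a y haA h (hx.2 a ⟨haA, hax⟩ haW)
        (h1 a y hasδ h (hy.2.trans (min_le_left _ _)) haW hyW)
  rcases le_total (sSup S + δ) B with h | h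
  · rw [min_eq_left h] at hP
    have := le_csSup hbdd (show sSup S + δ ∈ S from ⟨⟨by linarith, h⟩, hP⟩)
    linarith
  · rw [min_eq_right h] at hP
    exact hP B ⟨hAB, le_rfl⟩ hB

theorem FullGood.near {G D : ℝ × ℝ → ℝ} {τ : ℝ} (h : FullGood G D τ) :
    ∃ δ > 0, ∀ x, |x - τ| ≤ δ → FullGood G D x := by
  obtain ⟨δ, hδ, h⟩ := h
  refine ⟨δ / 2, by positivity, fun x hx => ⟨δ / 2, by positivity, fun a b ha hab hb => ?_⟩⟩
  obtain ⟨h1, h2⟩ := abs_le.1 hx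
  exact h a b (by linarith) hab (by linarith)

theorem FullGood.punctGood {G D : ℝ × ℝ → ℝ} {τ : ℝ} (h : FullGood G D τ) : PunctGood G D τ := by
  obtain ⟨δ, hδ, h1⟩ := h.near
  obtain ⟨δ', hδ', h2⟩ := h
  exact ⟨min δ δ', by positivity, fun a b ha ha' hb hb' => h2 a b
    (by linarith [min_le_right δ δ']) (ha'.trans hb).le (by linarith [min_le_right δ δ']),
    fun x _ hx => h1 x (hx.trans (min_le_left _ _))⟩

theorem EvGood.of_fullGood {G D : ℝ × ℝ → ℝ} {A B : ℝ} (hAB : A ≤ B)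
    (h : ∀ x ∈ Icc A B, FullGood G D x) : EvGood G D A B := by
  refine interval_additive (W := univ) hAB (mem_univ _) (mem_univ _)
    (fun a b c h1 h2 h3 h4 => h3.trans h4 h1 h2) fun x hx => ?_
  obtain ⟨δ, hδ, h1⟩ := h x hx
  exact ⟨δ, hδ, fun a b ha hab hb _ _ => h1 a b ha hab hb, fun _ _ _ => mem_univ _⟩

theorem EvGood.of_punctGood {G D : ℝ × ℝ → ℝ} {A B : ℝ} (hAB : A ≤ B)
    (h : ∀ x ∈ Icc A B, PunctGood G D x) (hA : FullGood G D A) (hB : FullGood G D B) :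
    EvGood G D A B := by
  refine interval_additive (W := {x | FullGood G D x}) hAB hA hB
    (fun a b c h1 h2 h3 h4 => h3.trans h4 h1 h2) fun x hx => ?_
  by_cases hxF : FullGood G D x
  · obtain ⟨δ, hδ, h1⟩ := hxF.near
    obtain ⟨δ', hδ', h2⟩ := hxF
    exact ⟨min δ δ', by positivity, fun a b ha hab hb _ _ => h2 a b
      (by linarith [min_le_right δ δ']) hab (by linarith [min_le_right δ δ']),
      fun y _ hy => h1 y (hy.trans (min_le_left _ _))⟩
  · obtain ⟨δ, hδ, h1, h2⟩ := h x hx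
    refine ⟨δ, hδ, fun a b ha hab hb haW hbW => ?_, h2⟩
    have hax : a ≠ x := fun h => hxF (h ▸ haW)
    have hbx : b ≠ x := fun h => hxF (h ▸ hbW)
    rcases lt_or_gt_of_ne hax with h3 | h3
    · rcases lt_or_gt_of_ne hbx with h4 | h4
      · refine EvGood.of_fullGood hab fun y hy => h2 y (by linarith [hy.2] : y < x).ne ?_
        exact abs_le.2 ⟨by linarith [hy.1], by linarith [hy.2]⟩
      · exact h1 a b ha h3 h4 hb
    · refine EvGood.of_fullGood hab fun y hy => h2 y (by linarith [hy.1] : x < y).ne' ?_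
      exact abs_le.2 ⟨by linarith [hy.1], by linarith [hy.2]⟩

theorem exists_abs_root {U : ℝ × ℝ → ℝ} (hU : AnalyticAt ℝ U 0) (hU0 : U 0 ≠ 0) {m : ℕ} (hm : 0 < m) :
    ∃ u : ℝ × ℝ → ℝ, AnalyticAt ℝ u 0 ∧ (∀ z, 0 < u z) ∧ ∀ z, U z ≠ 0 → |U z| = u z ^ m := by
  refine ⟨fun z => posRoot (2 * m) (U z ^ 2), analyticAt_posRoot _ (hU.pow 2) (by positivity),
    fun z => posRoot_pos _ _, fun z hz => ?_⟩
  have h := posRoot_pow (b := 2 * m) (by positivity) (show 0 < U z ^ 2 by positivity)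
  have h' : (posRoot (2 * m) (U z ^ 2) ^ m) ^ 2 = |U z| ^ 2 := by
    rw [sq_abs, ← pow_mul, mul_comm m 2, h]
  exact ((pow_left_inj₀ (pow_nonneg (posRoot_pos _ _).le m) (abs_nonneg _) two_ne_zero).1 h').symm

/-- Good boxes along `{r = 0}` where `G = r ^ m * U` with `U ≠ 0`. -/
theorem good_strip {G U D : ℝ × ℝ → ℝ} {m : ℕ} (hU : AnalyticAt ℝ U 0) (hU0 : U 0 ≠ 0)
    (hD : AnalyticAt ℝ D 0) (hD0 : ∀ᶠ z in 𝓝 (0 : ℝ × ℝ), 0 < z.1 → 0 ≤ D z)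
    (hG : ∀ᶠ z in 𝓝 (0 : ℝ × ℝ), 0 < z.1 → G z = z.1 ^ m * U z) :
    ∃ δ > 0, ∀ ε y₁ y₂, 0 < ε → ε ≤ δ → -δ ≤ y₁ → y₁ ≤ y₂ → y₂ ≤ δ →
      Good G (dens D) (Ioo 0 ε ×ˢ Ioo y₁ y₂) := by
  obtain ⟨δ₁, hδ₁, hbox⟩ := eventually_box ((hU.eventually_continuousAt.and
    hD.eventually_continuousAt).and ((hD0.and hG).and
      (hU.continuousAt.abs.eventually (lt_mem_nhds (half_lt_self (abs_pos.2 hU0))))))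
  have hin : ∀ {ε y₁ y₂ δ : ℝ}, δ ≤ δ₁ → ε ≤ δ → -δ ≤ y₁ → y₂ ≤ δ → ∀ z ∈ Icc 0 ε ×ˢ Icc y₁ y₂,
      |z.1| ≤ δ₁ ∧ |z.2| ≤ δ₁ := by
    intro ε y₁ y₂ δ h0 h1 h2 h3 z hz
    exact ⟨abs_le.2 ⟨by linarith [hz.1.1, hz.1.2], by linarith [hz.1.2]⟩,
      abs_le.2 ⟨by linarith [hz.2.1], by linarith [hz.2.2]⟩⟩
  rcases Nat.eq_zero_or_pos m with rfl | hm
  · refine ⟨δ₁, hδ₁, fun ε y₁ y₂ hε0 hε hy₁ hy hy₂ => ?_⟩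
    have hin := hin le_rfl hε hy₁ hy₂
    have hin' := fun z hz => hin z (box_subset _ _ _ _ hz)
    have hGU : ∀ z ∈ Ioo 0 ε ×ˢ Ioo y₁ y₂, U z = G z := fun z hz => by
      simpa using ((hbox z.1 z.2 (hin' z hz).1 (hin' z hz).2).2.1.2 hz.1.1).symm
    refine good_of_le (c := |U 0| / 2) (by positivity) (fun z hz => ?_) ?_ ?_
    · rw [← hGU z hz]
      exact (hbox z.1 z.2 (hin' z hz).1 (hin' z hz).2).2.2.le
    · refine ContinuousOn.congr (f := U) (fun z hz => ?_) fun z hz => (hGU z hz).symm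
      exact (hbox z.1 z.2 (hin' z hz).1 (hin' z hz).2).1.1.continuousWithinAt
    · exact fun z hz => (hbox z.1 z.2 (hin z hz).1 (hin z hz).2).1.2.continuousWithinAt
  · obtain ⟨u, hu, hu0, huU⟩ := exists_abs_root hU hU0 hm
    obtain ⟨δ₂, hδ₂, hL⟩ := logPuiseux_strip hu (hu0 0) hD
    obtain ⟨δ₃, hδ₃, huc⟩ := eventually_box hu.eventually_continuousAt
    refine ⟨min δ₁ (min δ₂ δ₃), by positivity, fun ε y₁ y₂ hε0 hε hy₁ hy hy₂ => ?_⟩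
    have h3 : min δ₁ (min δ₂ δ₃) ≤ δ₃ := (min_le_right _ _).trans (min_le_right _ _)
    have h2 : min δ₁ (min δ₂ δ₃) ≤ δ₂ := (min_le_right _ _).trans (min_le_left _ _)
    have hin := hin (min_le_left _ _) hε hy₁ hy₂
    have hin' := fun z hz => hin z (box_subset _ _ _ _ hz)
    refine good_box (g := fun z => z.1 * u z) hm (fun z hz => mul_pos hz.1.1 (hu0 z)) (fun z hz => ?_)
      ?_ ?_ (hL ε y₁ y₂ hε0 (hε.trans h2) (by linarith) hy (hy₂.trans h2) fun z hz =>
        (hbox z.1 z.2 (hin' z hz).1 (hin' z hz).2).2.1.1 hz.1.1)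
    · have hb := hbox z.1 z.2 (hin' z hz).1 (hin' z hz).2
      rw [hb.2.1.2 hz.1.1, abs_mul, huU z, mul_pow, abs_of_pos (pow_pos hz.1.1 m)]
      exact abs_pos.1 ((half_pos (abs_pos.2 hU0)).trans hb.2.2)
    · refine continuousOn_fst.mul fun z hz => (huc z.1 z.2 ?_ ?_).continuousWithinAt
      · exact abs_le.2 ⟨by linarith [hz.1.1, hz.1.2], by linarith [hz.1.2]⟩
      · exact abs_le.2 ⟨by linarith [hz.2.1], by linarith [hz.2.2]⟩
    · exact fun z hz => (hbox z.1 z.2 (hin z hz).1 (hin z hz).2).1.2.continuousWithinAt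

theorem fullGood_zero {G U D : ℝ × ℝ → ℝ} {m : ℕ} (hU : AnalyticAt ℝ U 0) (hU0 : U 0 ≠ 0)
    (hD : AnalyticAt ℝ D 0) (hD0 : ∀ᶠ z in 𝓝 (0 : ℝ × ℝ), 0 < z.1 → 0 ≤ D z)
    (hG : ∀ᶠ z in 𝓝 (0 : ℝ × ℝ), 0 < z.1 → G z = z.1 ^ m * U z) : FullGood G D 0 := by
  obtain ⟨δ, hδ, h⟩ := good_strip hU hU0 hD hD0 hG
  exact ⟨δ, hδ, fun a b ha hab hb => ⟨δ, hδ, fun ε hε hε' =>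
    h ε a b hε hε' (by linarith) hab (by linarith)⟩⟩

theorem exists_root {q : ℕ} (hq : q ≠ 0) {x : ℝ} (hx : 0 < x) : ∃ y, 0 < y ∧ y ^ q = x :=
  ⟨posRoot q x, posRoot_pos _ _, posRoot_pow (Nat.pos_of_ne_zero hq) hx⟩

theorem hasFDerivAt_pow {f : ℝ × ℝ → ℝ} {f' : ℝ × ℝ →L[ℝ] ℝ} {z : ℝ × ℝ} (h : HasFDerivAt f f' z)
    (n : ℕ) : HasFDerivAt (fun z => f z ^ n) ((n * f z ^ (n - 1)) • f') z := by
  simpa [nsmul_eq_mul] using h.pow n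

theorem det_prod (a b c d : ℝ) (A B : ℝ × ℝ →L[ℝ] ℝ) (hA : A (1, 0) = a) (hA' : A (0, 1) = b)
    (hB : B (1, 0) = c) (hB' : B (0, 1) = d) : (A.prod B).det = a * d - b * c := by
  rw [det_eq]
  simp [hA', hB', hA, hB]

/-- Good boxes at the corner where `G = x ^ a * y ^ e * U` with `U ≠ 0`. -/
theorem good_corner {G U D : ℝ × ℝ → ℝ} {a : ℕ} (ha : 0 < a) (e : ℕ) (hU : AnalyticAt ℝ U 0)
    (hU0 : U 0 ≠ 0) (hD : AnalyticAt ℝ D 0)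
    (hD0 : ∀ᶠ z in 𝓝 (0 : ℝ × ℝ), 0 < z.1 → 0 < z.2 → 0 ≤ D z)
    (hG : ∀ᶠ z in 𝓝 (0 : ℝ × ℝ), 0 < z.1 → 0 < z.2 → G z = z.1 ^ a * z.2 ^ e * U z) :
    ∃ δ > 0, ∀ ε t, 0 < ε → ε ≤ δ → 0 < t → t ≤ δ → Good G (dens D) (Ioo 0 ε ×ˢ Ioo 0 t) := by
  let Φ : ℝ × ℝ → ℝ × ℝ := fun z => (z.1, z.2 ^ a)
  have hΦ : AnalyticAt ℝ Φ 0 := analyticAt_fst.prod (analyticAt_snd.pow a)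
  have hΦ0 : Φ 0 = 0 := by simp [Φ, ha.ne']
  have hΦt : Tendsto Φ (𝓝 0) (𝓝 0) := by simpa [hΦ0] using hΦ.continuousAt.tendsto
  let U' : ℝ × ℝ → ℝ := fun z => U (Φ z)
  let D' : ℝ × ℝ → ℝ := fun z => a * z.2 ^ (a - 1) * D (Φ z)
  have hU' : AnalyticAt ℝ U' 0 := AnalyticAt.fun_comp (g := U) (f := Φ) (by rwa [hΦ0]) hΦ
  have hD' : AnalyticAt ℝ D' 0 := (analyticAt_const.mul (analyticAt_snd.pow _)).mul
    (AnalyticAt.fun_comp (g := D) (f := Φ) (by rwa [hΦ0]) hΦ)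
  have hU'0 : U' 0 ≠ 0 := by simpa [U', hΦ0] using hU0
  suffices h : ∃ δ > 0, ∀ ε t, 0 < ε → ε ≤ δ → 0 < t → t ≤ δ →
      Good (fun z => G (Φ z)) (dens D') (Ioo 0 ε ×ˢ Ioo 0 t) by
    obtain ⟨δ, hδ, h⟩ := h
    refine ⟨min δ (δ ^ a), by positivity, fun ε t hε0 hε ht0 ht => ?_⟩
    obtain ⟨s, hs0, rfl⟩ := exists_root ha.ne' ht0
    have hsδ : s ≤ δ := by
      have := ht.trans (min_le_right _ _)
      rwa [pow_le_pow_iff_left₀ hs0.le hδ.le ha.ne'] at this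
    let Φ' : ℝ × ℝ → ℝ × ℝ →L[ℝ] ℝ × ℝ := fun z => (ContinuousLinearMap.fst ℝ ℝ ℝ).prod
      ((a * z.2 ^ (a - 1)) • ContinuousLinearMap.snd ℝ ℝ ℝ)
    refine (h ε s hε0 (hε.trans (min_le_left _ _)) hs0 hsδ).transport (Φ := Φ) (Φ' := Φ')
      (isOpen_box _ _ _ _).measurableSet ?_ (fun z hz => ?_) (fun z hz => rfl) (fun z hz => ?_) ?_
    · rintro z hz w hw hzw
      simp only [Φ, Prod.mk.injEq] at hzw
      exact Prod.ext hzw.1 ((pow_left_inj₀ hz.2.1.le hw.2.1.le ha.ne').1 hzw.2)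
    · exact hasFDerivAt_fst.prodMk (hasFDerivAt_pow hasFDerivAt_snd a)
    · have : (Φ' z).det = a * z.2 ^ (a - 1) := by
        rw [det_prod 1 0 0 (a * z.2 ^ (a - 1))] <;> simp
      rw [this, abs_of_nonneg]
      exact mul_nonneg (Nat.cast_nonneg _) (pow_nonneg hz.2.1.le _)
    · ext z
      constructor
      · intro hz
        obtain ⟨y, hy0, hy⟩ := exists_root ha.ne' hz.2.1
        refine ⟨(z.1, y), ⟨hz.1, hy0, ?_⟩, Prod.ext rfl hy⟩
        have := hz.2.2
        rwa [← hy, pow_lt_pow_iff_left₀ hy0.le hs0.le ha.ne'] at this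
      · rintro ⟨w, hw, rfl⟩
        exact ⟨hw.1, pow_pos hw.2.1 a, pow_lt_pow_left₀ hw.2.2 hw.2.1.le ha.ne'⟩
  obtain ⟨δ₁, hδ₁, hbox⟩ := eventually_box ((hU'.eventually_continuousAt.and
    hD'.eventually_continuousAt).and ((hΦt.eventually (hD0.and hG)).and
      (hU'.continuousAt.eventually_ne hU'0)))
  obtain ⟨u, hu, hu0, huU⟩ := exists_abs_root hU' hU'0 ha
  obtain ⟨δ₃, hδ₃, huc⟩ := eventually_box hu.eventually_continuousAt
  obtain ⟨δ₂, hδ₂, hL⟩ : ∃ δ₀ > 0, ∀ ε δ, 0 < ε → ε ≤ δ₀ → 0 < δ → δ ≤ δ₀ →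
      (∀ z ∈ Ioo 0 ε ×ˢ Ioo 0 δ, 0 ≤ D' z) → LogPuiseux fun κ =>
        (dens D' {z ∈ Ioo 0 ε ×ˢ Ioo 0 δ | z.1 * z.2 ^ e * u z < κ}).toReal := by
    rcases Nat.eq_zero_or_pos e with rfl | he
    · obtain ⟨δ, hδ, h⟩ := logPuiseux_strip hu (hu0 0) hD'
      refine ⟨δ, hδ, fun ε t hε0 hε ht0 ht hpos => ?_⟩
      simpa using h ε 0 t hε0 hε (by linarith) ht0.le ht hpos
    · exact logPuiseux_corner hu (hu0 0) hD' he
  refine ⟨min δ₁ (min δ₂ δ₃), by positivity, fun ε t hε0 hε ht0 ht => ?_⟩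
  have h1 : min δ₁ (min δ₂ δ₃) ≤ δ₁ := min_le_left _ _
  have h3 : min δ₁ (min δ₂ δ₃) ≤ δ₃ := (min_le_right _ _).trans (min_le_right _ _)
  have h2 : min δ₁ (min δ₂ δ₃) ≤ δ₂ := (min_le_right _ _).trans (min_le_left _ _)
  have hin : ∀ z ∈ Icc 0 ε ×ˢ Icc 0 t, |z.1| ≤ min δ₁ (min δ₂ δ₃) ∧ |z.2| ≤ min δ₁ (min δ₂ δ₃) :=
    fun z hz => ⟨by rw [abs_of_nonneg hz.1.1]; exact hz.1.2.trans hε,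
      by rw [abs_of_nonneg hz.2.1]; exact hz.2.2.trans ht⟩
  have hb : ∀ z ∈ Icc 0 ε ×ˢ Icc 0 t, _ := fun z hz =>
    hbox z.1 z.2 ((hin z hz).1.trans h1) ((hin z hz).2.trans h1)
  refine good_box (g := fun z => z.1 * z.2 ^ e * u z) ha
    (fun z hz => mul_pos (mul_pos hz.1.1 (pow_pos hz.2.1 _)) (hu0 z)) (fun z hz => ?_)
    ?_ (fun z hz => (hb z hz).1.2.continuousWithinAt)
    (hL ε t hε0 (hε.trans h2) ht0 (ht.trans h2) fun z hz => ?_)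
  · have hz' := hb z (box_subset _ _ _ _ hz)
    have hG' : G (Φ z) = z.1 ^ a * (z.2 ^ a) ^ e * U' z :=
      hz'.2.1.2 hz.1.1 (pow_pos hz.2.1 a)
    rw [hG', abs_mul, huU z hz'.2.2, abs_of_pos (mul_pos (pow_pos hz.1.1 a)
      (pow_pos (pow_pos hz.2.1 a) e)), mul_pow, mul_pow, ← pow_mul, ← pow_mul, mul_comm a e]
  · refine (continuousOn_fst.mul (continuousOn_snd.pow e)).mul fun z hz => ?_
    have hz' := hin z (box_subset _ _ _ _ hz)
    exact (huc z.1 z.2 (hz'.1.trans h3) (hz'.2.trans h3)).continuousWithinAt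
  · have hz' := hb z (box_subset _ _ _ _ hz)
    exact mul_nonneg (mul_nonneg (Nat.cast_nonneg _) (pow_nonneg hz.2.1.le _))
      (hz'.2.1.1 hz.1.1 (pow_pos hz.2.1 a))

theorem EvGood.congr {G G' D D' : ℝ × ℝ → ℝ} {a b : ℝ} (h : EvGood G D a b) {ε : ℝ} (hε : 0 < ε)
    (hG : ∀ z ∈ Ioo 0 ε ×ˢ Ioo a b, G z = G' z) (hD : ∀ z ∈ Ioo 0 ε ×ˢ Ioo a b, D z = D' z) :
    EvGood G' D' a b := by
  obtain ⟨ε₀, hε₀, h⟩ := h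
  refine ⟨min ε₀ ε, by positivity, fun η hη hη' => ?_⟩
  have : Ioo 0 η ×ˢ Ioo a b ⊆ Ioo 0 ε ×ˢ Ioo a b :=
    prod_mono (Ioo_subset_Ioo_right (hη'.trans (min_le_right _ _))) subset_rfl
  exact (h η hη (hη'.trans (min_le_left _ _))).congr (isOpen_box _ _ _ _).measurableSet
    (fun z hz => hG z (this hz)) fun z hz => hD z (this hz)

theorem EvGood.shift {G D : ℝ × ℝ → ℝ} {τ a b : ℝ}
    (h : EvGood (fun z => G (z.1, z.2 + τ)) (fun z => D (z.1, z.2 + τ)) a b) :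
    EvGood G D (a + τ) (b + τ) := by
  obtain ⟨ε₀, hε₀, h⟩ := h
  refine ⟨ε₀, hε₀, fun ε hε hε' => ?_⟩
  refine (h ε hε hε').transport (Φ := fun z => (z.1, z.2 + τ))
    (Φ' := fun _ => (ContinuousLinearMap.fst ℝ ℝ ℝ).prod (ContinuousLinearMap.snd ℝ ℝ ℝ))
    (isOpen_box _ _ _ _).measurableSet ?_ (fun z hz => ?_) (fun z hz => rfl) (fun z hz => ?_) ?_
  · rintro z hz w hw hzw
    simp only [Prod.mk.injEq, add_left_inj] at hzw
    exact Prod.ext hzw.1 hzw.2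
  · exact hasFDerivAt_fst.prodMk (hasFDerivAt_snd.add_const τ)
  · rw [det_prod 1 0 0 1] <;> simp
  · ext z
    constructor
    · intro hz
      exact ⟨(z.1, z.2 - τ), ⟨hz.1, by linarith [hz.2.1], by linarith [hz.2.2]⟩, by simp⟩
    · rintro ⟨w, hw, rfl⟩
      exact ⟨hw.1, by linarith [hw.2.1], by linarith [hw.2.2]⟩

theorem EvGood.reflect {G D : ℝ × ℝ → ℝ} {a b : ℝ}
    (h : EvGood (fun z => G (z.1, -z.2)) (fun z => D (z.1, -z.2)) a b) :
    EvGood G D (-b) (-a) := by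
  obtain ⟨ε₀, hε₀, h⟩ := h
  refine ⟨ε₀, hε₀, fun ε hε hε' => ?_⟩
  refine (h ε hε hε').transport (Φ := fun z => (z.1, -z.2))
    (Φ' := fun _ => (ContinuousLinearMap.fst ℝ ℝ ℝ).prod (-ContinuousLinearMap.snd ℝ ℝ ℝ))
    (isOpen_box _ _ _ _).measurableSet ?_ (fun z hz => ?_) (fun z hz => rfl) (fun z hz => ?_) ?_
  · rintro z hz w hw hzw
    simp only [Prod.mk.injEq, neg_inj] at hzw
    exact Prod.ext hzw.1 hzw.2
  · exact hasFDerivAt_fst.prodMk hasFDerivAt_snd.neg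
  · rw [det_prod 1 0 0 (-1)] <;> simp
  · ext z
    constructor
    · intro hz
      exact ⟨(z.1, -z.2), ⟨hz.1, by linarith [hz.2.2], by linarith [hz.2.1]⟩, by simp⟩
    · rintro ⟨w, hw, rfl⟩
      exact ⟨hw.1, by linarith [hw.2.2], by linarith [hw.2.1]⟩

theorem EvGood.ramify {G D : ℝ × ℝ → ℝ} {a b : ℝ} {q : ℕ} (hq : q ≠ 0)
    (h : EvGood (fun z => G (z.1 ^ q, z.2)) (fun z => q * z.1 ^ (q - 1) * D (z.1 ^ q, z.2)) a b) :
    EvGood G D a b := by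
  obtain ⟨ε₀, hε₀, h⟩ := h
  refine ⟨ε₀ ^ q, by positivity, fun ε hε hε' => ?_⟩
  obtain ⟨s, hs0, rfl⟩ := exists_root hq hε
  rw [pow_le_pow_iff_left₀ hs0.le hε₀.le hq] at hε'
  let Φ' : ℝ × ℝ → ℝ × ℝ →L[ℝ] ℝ × ℝ := fun z =>
    ((q * z.1 ^ (q - 1)) • ContinuousLinearMap.fst ℝ ℝ ℝ).prod (ContinuousLinearMap.snd ℝ ℝ ℝ)
  refine (h s hs0 hε').transport (Φ := fun z => (z.1 ^ q, z.2)) (Φ' := Φ')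
    (isOpen_box _ _ _ _).measurableSet ?_ (fun z hz => ?_) (fun z hz => rfl) (fun z hz => ?_) ?_
  · rintro z hz w hw hzw
    simp only [Prod.mk.injEq] at hzw
    exact Prod.ext ((pow_left_inj₀ hz.1.1.le hw.1.1.le hq).1 hzw.1) hzw.2
  · exact (hasFDerivAt_pow hasFDerivAt_fst q).prodMk hasFDerivAt_snd
  · have : (Φ' z).det = q * z.1 ^ (q - 1) := by
      rw [det_prod (q * z.1 ^ (q - 1)) 0 0 1] <;> simp
    rw [this, abs_of_nonneg]
    exact mul_nonneg (Nat.cast_nonneg _) (pow_nonneg hz.1.1.le _)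
  · ext z
    constructor
    · intro hz
      obtain ⟨y, hy0, hy⟩ := exists_root hq hz.1.1
      refine ⟨(y, z.2), ⟨⟨hy0, ?_⟩, hz.2⟩, Prod.ext hy rfl⟩
      have := hz.1.2
      rwa [← hy, pow_lt_pow_iff_left₀ hy0.le hs0.le hq] at this
    · rintro ⟨w, hw, rfl⟩
      exact ⟨⟨pow_pos hw.1.1 q, pow_lt_pow_left₀ hw.1.2 hw.1.1.le hq⟩, hw.2⟩

theorem FullGood.shift {G D : ℝ × ℝ → ℝ} {τ x : ℝ}
    (h : FullGood (fun z => G (z.1, z.2 + τ)) (fun z => D (z.1, z.2 + τ)) x) :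
    FullGood G D (x + τ) := by
  obtain ⟨δ, hδ, h⟩ := h
  refine ⟨δ, hδ, fun a b ha hab hb => ?_⟩
  simpa using (h (a - τ) (b - τ) (by linarith) (by linarith) (by linarith)).shift

theorem PunctGood.shift {G D : ℝ × ℝ → ℝ} {τ : ℝ}
    (h : PunctGood (fun z => G (z.1, z.2 + τ)) (fun z => D (z.1, z.2 + τ)) 0) :
    PunctGood G D τ := by
  obtain ⟨δ, hδ, h1, h2⟩ := h
  refine ⟨δ, hδ, fun a b ha ha' hb hb' => ?_, fun x hx hxδ => ?_⟩
  · simpa using (h1 (a - τ) (b - τ) (by linarith) (by linarith) (by linarith) (by linarith)).shift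
  · simpa using (h2 (x - τ) (sub_ne_zero.2 hx) (by simpa using hxδ)).shift

theorem fullGood_of_analyticAt {G U D : ℝ × ℝ → ℝ} {m : ℕ} {τ : ℝ} (hU : AnalyticAt ℝ U (0, τ))
    (hU0 : U (0, τ) ≠ 0) (hD : AnalyticAt ℝ D (0, τ)) (hD0 : ∀ᶠ z in 𝓝 (0, τ), 0 < z.1 → 0 ≤ D z)
    (hG : ∀ᶠ z in 𝓝 (0, τ), 0 < z.1 → G z = z.1 ^ m * U z) : FullGood G D τ := by
  let s : ℝ × ℝ → ℝ × ℝ := fun z => (z.1, z.2 + τ)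
  have hs : AnalyticAt ℝ s 0 := analyticAt_fst.prod (analyticAt_snd.add analyticAt_const)
  have hs0 : s 0 = (0, τ) := by simp [s]
  have hst : Tendsto s (𝓝 0) (𝓝 (0, τ)) := by simpa [hs0] using hs.continuousAt.tendsto
  rw [← zero_add τ]
  refine FullGood.shift (fullGood_zero (U := fun z => U (s z)) (m := m) ?_ ?_ ?_ ?_ ?_)
  · exact AnalyticAt.fun_comp (g := U) (f := s) (by rwa [hs0]) hs
  · simpa [hs0] using hU0
  · exact AnalyticAt.fun_comp (g := D) (f := s) (by rwa [hs0]) hs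
  · exact hst.eventually hD0
  · exact hst.eventually hG

/-- Extending a thin good box to a wider one on which `G` does not vanish. -/
theorem EvGood.extend {G D : ℝ × ℝ → ℝ} {a b ε : ℝ} (h : EvGood G D a b) (hε : 0 < ε)
    (hG : ∀ z ∈ Ioc 0 ε ×ˢ Icc a b, ContinuousAt G z ∧ G z ≠ 0)
    (hD : ∀ z ∈ Ioc 0 ε ×ˢ Icc a b, ContinuousAt D z) : Good G (dens D) (Ioo 0 ε ×ˢ Ioo a b) := by
  rcases le_or_gt a b with hab | hab
  swap
  · rw [Ioo_eq_empty (by linarith : ¬ a < b), prod_empty]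
    exact Good.of_eq_zero (by simp)
  obtain ⟨ε₀, hε₀, h⟩ := h
  let η := min ε₀ (ε / 2)
  have hη0 : 0 < η := by positivity
  have hη : η < ε := (min_le_right _ _).trans_lt (by linarith)
  have hsub : Icc η ε ×ˢ Icc a b ⊆ Ioc 0 ε ×ˢ Icc a b :=
    prod_mono (fun x hx => ⟨hη0.trans_le hx.1, hx.2⟩) subset_rfl
  have hGc : ContinuousOn G (Icc η ε ×ˢ Icc a b) := fun z hz =>
    (hG z (hsub hz)).1.continuousWithinAt
  have hne : (Icc η ε ×ˢ Icc a b).Nonempty := ⟨(ε, a), ⟨hη.le, le_rfl⟩, le_rfl, hab⟩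
  obtain ⟨z₀, hz₀, hmin⟩ := (isCompact_Icc.prod isCompact_Icc).exists_isMinOn hne hGc.abs
  have hR : Good G (dens D) (Ioo η ε ×ˢ Ioo a b) :=
    good_of_le (abs_pos.2 (hG z₀ (hsub hz₀)).2) (fun z hz => hmin (box_subset _ _ _ _ hz))
      (hGc.mono (box_subset _ _ _ _)) fun z hz => (hD z (hsub hz)).continuousWithinAt
  refine ((h η hη0 (min_le_left _ _)).union hR ?_).mono_ae ?_ ?_
  · convert measure_empty (μ := dens D)
    ext z
    simp only [mem_inter_iff, mem_prod, mem_Ioo, mem_empty_iff_false, iff_false]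
    intro h
    linarith [h.1.1.2, h.2.1.1]
  · exact union_subset (prod_mono (Ioo_subset_Ioo_right hη.le) subset_rfl)
      (prod_mono (Ioo_subset_Ioo_left hη0.le) subset_rfl)
  · refine measure_mono_null ?_ (dens_null (volume_singleton_prod univ η))
    rintro z ⟨hz, hz', -⟩
    refine ⟨?_, mem_univ _⟩
    by_contra hne
    refine hz' ?_
    rcases lt_or_gt_of_ne hne with h | h
    · exact Or.inl ⟨⟨hz.1.1, h⟩, hz.2⟩
    · exact Or.inr ⟨⟨h, hz.1.2⟩, hz.2⟩

section

/-- A quasi-homogeneously weighted Weierstrass-type polynomial. -/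
def wpoly (B : ℕ → ℝ → ℝ) (U : ℝ × ℝ → ℝ) (d p : ℕ) (z : ℝ × ℝ) : ℝ :=
  ∑ j ∈ Finset.range d, z.1 ^ (p * (d - j)) * B j z.1 * z.2 ^ j + z.2 ^ d * U z

/-- The strict transform of `wpoly` in the chart `(v, σ) ↦ (v * σ, v ^ p)`. -/
def wpolySide (B : ℕ → ℝ → ℝ) (U : ℝ × ℝ → ℝ) (d p : ℕ) (z : ℝ × ℝ) : ℝ :=
  ∑ j ∈ Finset.range d, z.2 ^ (p * (d - j)) * B j (z.1 * z.2) + U (z.1 * z.2, z.1 ^ p)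

theorem wpoly_side (B : ℕ → ℝ → ℝ) (U : ℝ × ℝ → ℝ) (d p : ℕ) (v σ : ℝ) :
    wpoly B U d p (v * σ, v ^ p) = v ^ (p * d) * wpolySide B U d p (v, σ) := by
  simp only [wpoly, wpolySide, mul_add, Finset.mul_sum]
  congr 1
  · refine Finset.sum_congr rfl fun j hj => ?_
    obtain ⟨k, rfl⟩ := Nat.exists_eq_add_of_lt (Finset.mem_range.1 hj)
    rw [show j + k + 1 - j = k + 1 by omega, mul_pow, ← pow_mul,
      show p * (j + k + 1) = p * (k + 1) + p * j by ring, pow_add]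
    ring
  · rw [← pow_mul]

theorem analyticAt_wpoly {B : ℕ → ℝ → ℝ} {U : ℝ × ℝ → ℝ} (d p : ℕ) {z : ℝ × ℝ}
    (hB : ∀ j, AnalyticAt ℝ (B j) z.1) (hU : AnalyticAt ℝ U z) : AnalyticAt ℝ (wpoly B U d p) z := by
  refine AnalyticAt.add (Finset.analyticAt_fun_sum _ fun j _ => ?_) ((analyticAt_snd.pow d).mul hU)
  exact ((analyticAt_fst.pow _).mul (AnalyticAt.fun_comp (g := B j) (f := Prod.fst) (hB j)
    analyticAt_fst)).mul (analyticAt_snd.pow j)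

theorem wpoly_zero {B : ℕ → ℝ → ℝ} {U : ℝ × ℝ → ℝ} {d p : ℕ} (hp : 0 < p) (s : ℝ) :
    wpoly B U d p (0, s) = s ^ d * U (0, s) := by
  rw [wpoly, Finset.sum_eq_zero, zero_add]
  intro j hj
  have : p * (d - j) ≠ 0 := (Nat.mul_pos hp (Nat.sub_pos_of_lt (Finset.mem_range.1 hj))).ne'
  simp [this]

theorem wpolySide_zero {B : ℕ → ℝ → ℝ} {U : ℝ × ℝ → ℝ} {d p : ℕ} (hp : 0 < p) :
    wpolySide B U d p 0 = U 0 := by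
  rw [wpolySide, Finset.sum_eq_zero, zero_add]
  · simp [hp.ne', ← Prod.zero_eq_mk]
  intro j hj
  have : p * (d - j) ≠ 0 := (Nat.mul_pos hp (Nat.sub_pos_of_lt (Finset.mem_range.1 hj))).ne'
  simp [this]

theorem analyticAt_wpolySide {B : ℕ → ℝ → ℝ} {U : ℝ × ℝ → ℝ} (d : ℕ) {p : ℕ} (hp : 0 < p)
    (hB : ∀ j, AnalyticAt ℝ (B j) 0) (hU : AnalyticAt ℝ U 0) :
    AnalyticAt ℝ (wpolySide B U d p) 0 := by
  have h1 : AnalyticAt ℝ (fun z : ℝ × ℝ => z.1 * z.2) 0 := analyticAt_fst.mul analyticAt_snd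
  have h2 : AnalyticAt ℝ (fun z : ℝ × ℝ => (z.1 * z.2, z.1 ^ p)) 0 :=
    h1.prod (analyticAt_fst.pow p)
  refine AnalyticAt.add (Finset.analyticAt_fun_sum _ fun j _ => ?_)
    (AnalyticAt.fun_comp (g := U) (by simpa [hp.ne', ← Prod.zero_eq_mk] using hU) h2)
  exact (analyticAt_snd.pow _).mul (AnalyticAt.fun_comp (g := B j) (by simpa using hB j) h1)

/-- `G` is, up to a power of `r`, a weighted polynomial in `t - φ r`. -/
structure Reduced (G : ℝ × ℝ → ℝ) (φ : ℝ → ℝ) (B : ℕ → ℝ → ℝ) (U : ℝ × ℝ → ℝ) (d p m : ℕ) :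
    Prop where
  hd : 0 < d
  hp : 0 < p
  hG : AnalyticAt ℝ G 0
  hφ : AnalyticAt ℝ φ 0
  hφ0 : φ 0 = 0
  hB : ∀ j, AnalyticAt ℝ (B j) 0
  hU : AnalyticAt ℝ U 0
  hU0 : U 0 ≠ 0
  eq : ∀ᶠ z in 𝓝 (0 : ℝ × ℝ), G (z.1, φ z.1 + z.2) = z.1 ^ m * wpoly B U d p z

variable {G U : ℝ × ℝ → ℝ} {φ : ℝ → ℝ} {B : ℕ → ℝ → ℝ} {d p m : ℕ}

theorem Reduced.neg (h : Reduced G φ B U d p m) :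
    Reduced (fun z => G (z.1, -z.2)) (fun r => -φ r) (fun j r => (-1) ^ j * B j r)
      (fun z => (-1) ^ d * U (z.1, -z.2)) d p m := by
  have hn : AnalyticAt ℝ (fun z : ℝ × ℝ => (z.1, -z.2)) 0 := analyticAt_fst.prod analyticAt_snd.neg
  have hnt : Tendsto (fun z : ℝ × ℝ => (z.1, -z.2)) (𝓝 0) (𝓝 0) := by
    simpa [← Prod.zero_eq_mk] using hn.continuousAt.tendsto
  refine ⟨h.hd, h.hp, AnalyticAt.fun_comp (g := G) (by simpa [← Prod.zero_eq_mk] using h.hG) hn, h.hφ.neg,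
    by simp [h.hφ0], fun j => analyticAt_const.mul (h.hB j),
    analyticAt_const.mul (AnalyticAt.fun_comp (g := U) (by simpa [← Prod.zero_eq_mk] using h.hU) hn), ?_, ?_⟩
  · simpa [← Prod.zero_eq_mk] using h.hU0
  · filter_upwards [hnt.eventually h.eq] with z hz
    rw [show -(-φ z.1 + z.2) = φ z.1 + -z.2 by ring, hz, wpoly, wpoly]
    congr 2
    · refine Finset.sum_congr rfl fun j _ => ?_
      rw [neg_pow z.2 j]
      ring
    · rw [neg_pow z.2 d]
      ring

theorem Reduced.good_side (h : Reduced G φ B U d p m) {C : ℝ} (hC : 0 < C) (c : ℕ) :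
    ∃ δ > 0, ∀ v₀ σ₀, 0 < v₀ → v₀ ≤ δ → 0 < σ₀ → σ₀ ≤ δ → Good G (dens fun z => C * z.1 ^ c)
      {z | 0 < z.1 ∧ (z.1 / σ₀) ^ p < z.2 - φ z.1 ∧ z.2 - φ z.1 < v₀ ^ p} := by
  have hp := h.hp.ne'
  let T : ℝ × ℝ → ℝ × ℝ := fun z => (z.1 * z.2, φ (z.1 * z.2) + z.1 ^ p)
  have hmt : Tendsto (fun z : ℝ × ℝ => (z.1 * z.2, z.1 ^ p)) (𝓝 0) (𝓝 0) := by
    have : ContinuousAt (fun z : ℝ × ℝ => (z.1 * z.2, z.1 ^ p)) 0 := by fun_prop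
    simpa [ContinuousAt, hp, ← Prod.zero_eq_mk] using this
  have hmt' : Tendsto (fun z : ℝ × ℝ => z.1 * z.2) (𝓝 0) (𝓝 0) := by
    have : ContinuousAt (fun z : ℝ × ℝ => z.1 * z.2) 0 := by fun_prop
    simpa [ContinuousAt] using this
  obtain ⟨δ₁, hδ₁, hgood⟩ := good_corner (G := fun z => G (T z)) (U := wpolySide B U d p)
    (D := fun z => p * z.1 ^ p * (C * (z.1 * z.2) ^ c)) (a := m + p * d)
    (Nat.add_pos_right _ (Nat.mul_pos h.hp h.hd)) m
    (analyticAt_wpolySide d h.hp h.hB h.hU) (by rw [wpolySide_zero h.hp]; exact h.hU0)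
    ((analyticAt_const.mul (analyticAt_fst.pow p)).mul
      (analyticAt_const.mul ((analyticAt_fst.mul analyticAt_snd).pow c)))
    (Eventually.of_forall fun z hz1 hz2 => by positivity)
    (by
      filter_upwards [hmt.eventually h.eq] with z hz _ _
      dsimp only [T]
      rw [hz, wpoly_side]
      ring)
  obtain ⟨δ₂, hδ₂, hφd⟩ := eventually_box (hmt'.eventually h.hφ.eventually_analyticAt)
  refine ⟨min δ₁ δ₂, by positivity, fun v₀ σ₀ hv0 hv hσ0 hσ => ?_⟩
  have hin : ∀ z ∈ Ioo 0 v₀ ×ˢ Ioo 0 σ₀, AnalyticAt ℝ φ (z.1 * z.2) := fun z hz =>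
    hφd z.1 z.2 (by rw [abs_of_pos hz.1.1]; exact hz.1.2.le.trans (hv.trans (min_le_right _ _)))
      (by rw [abs_of_pos hz.2.1]; exact hz.2.2.le.trans (hσ.trans (min_le_right _ _)))
  let A : ℝ × ℝ → ℝ × ℝ →L[ℝ] ℝ := fun z =>
    z.1 • ContinuousLinearMap.snd ℝ ℝ ℝ + z.2 • ContinuousLinearMap.fst ℝ ℝ ℝ
  let E : ℝ × ℝ → ℝ × ℝ →L[ℝ] ℝ := fun z =>
    deriv φ (z.1 * z.2) • A z + (p * z.1 ^ (p - 1)) • ContinuousLinearMap.fst ℝ ℝ ℝ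
  refine (hgood v₀ σ₀ hv0 (hv.trans (min_le_left _ _)) hσ0 (hσ.trans (min_le_left _ _))).transport
    (Φ := T) (Φ' := fun z => (A z).prod (E z)) (isOpen_box _ _ _ _).measurableSet ?_
    (fun z hz => ?_) (fun z hz => rfl) (fun z hz => ?_) ?_
  · rintro z hz w hw hzw
    simp only [T, Prod.mk.injEq] at hzw
    obtain ⟨h2, h3⟩ := hzw
    rw [h2, add_right_inj] at h3
    have h1 := (pow_left_inj₀ hz.1.1.le hw.1.1.le hp).1 h3
    refine Prod.ext h1 ?_
    rw [h1] at h2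
    exact mul_left_cancel₀ hw.1.1.ne' h2
  · have hA : HasFDerivAt (fun z : ℝ × ℝ => z.1 * z.2) (A z) z :=
      hasFDerivAt_fst.mul hasFDerivAt_snd
    refine hA.prodMk (HasFDerivAt.add ?_ (hasFDerivAt_pow hasFDerivAt_fst p))
    exact HasDerivAt.comp_hasFDerivAt z (hin z hz).differentiableAt.hasDerivAt hA
  · have hdet : ((A z).prod (E z)).det = -(p * z.1 ^ p) := by
      rw [det_prod z.2 z.1 (deriv φ (z.1 * z.2) * z.2 + p * z.1 ^ (p - 1))
        (deriv φ (z.1 * z.2) * z.1)]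
      · obtain ⟨k, rfl⟩ := Nat.exists_eq_succ_of_ne_zero hp
        simp only [Nat.succ_eq_add_one, Nat.add_sub_cancel]
        ring
      all_goals simp [A, E]
    have : 0 ≤ p * z.1 ^ p := mul_nonneg (Nat.cast_nonneg _) (pow_nonneg hz.1.1.le _)
    rw [hdet, abs_neg, abs_of_nonneg this]
  · ext z
    constructor
    · rintro ⟨h1, h2, h3⟩
      have hs : 0 < z.2 - φ z.1 := (pow_pos (div_pos h1 hσ0) p).trans h2
      obtain ⟨v, hv0', hvs⟩ := exists_root hp hs
      refine ⟨(v, z.1 / v), ⟨⟨hv0', ?_⟩, ⟨div_pos h1 hv0', ?_⟩⟩, ?_⟩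
      · rwa [← hvs, pow_lt_pow_iff_left₀ hv0'.le hv0.le hp] at h3
      · rw [← hvs, pow_lt_pow_iff_left₀ (div_pos h1 hσ0).le hv0'.le hp] at h2
        rw [div_lt_iff₀ hσ0] at h2
        rw [div_lt_iff₀ hv0']
        linarith
      · simp only [T]
        rw [mul_div_cancel₀ _ hv0'.ne', hvs]
        simp
    · rintro ⟨w, hw, rfl⟩
      have h1 := hw.1.1
      have h2 := hw.2.1
      refine ⟨mul_pos h1 h2, ?_, ?_⟩
      · simp only [T, add_sub_cancel_left]
        rw [pow_lt_pow_iff_left₀ (by positivity) h1.le hp, div_lt_iff₀ hσ0]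
        exact mul_lt_mul_of_pos_left hw.2.2 h1
      · simp only [T, add_sub_cancel_left]
        exact pow_lt_pow_left₀ hw.1.2 h1.le hp

theorem Reduced.wpoly_ne_zero (h : Reduced G φ B U d p m) :
    ∃ δ > 0, ∀ r v, 0 < r → 0 < v → r ≤ δ * v → v ≤ δ → wpoly B U d p (r, v ^ p) ≠ 0 := by
  obtain ⟨δ, hδ, hbox⟩ := eventually_box ((analyticAt_wpolySide d h.hp h.hB h.hU).continuousAt.eventually_ne
    (by rw [wpolySide_zero h.hp]; exact h.hU0))
  refine ⟨δ, hδ, fun r v hr hv hrv hvδ => ?_⟩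
  have := wpoly_side B U d p v (r / v)
  rw [mul_div_cancel₀ _ hv.ne'] at this
  rw [this]
  refine mul_ne_zero (pow_pos hv _).ne' (hbox _ _ ?_ ?_)
  · rwa [abs_of_pos hv]
  · rwa [abs_of_pos (div_pos hr hv), div_le_iff₀ hv]

end

section

variable {G U : ℝ × ℝ → ℝ} {φ : ℝ → ℝ} {B : ℕ → ℝ → ℝ} {d p m : ℕ}

theorem Reduced.tendsto (h : Reduced G φ B U d p m) :
    Tendsto (fun z : ℝ × ℝ => (z.1, φ z.1 + z.2)) (𝓝 0) (𝓝 0) := by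
  have h1 : AnalyticAt ℝ (fun z : ℝ × ℝ => (z.1, φ z.1 + z.2)) 0 :=
    analyticAt_fst.prod ((AnalyticAt.fun_comp (g := φ) (f := Prod.fst) h.hφ
      (analyticAt_fst (p := (0 : ℝ × ℝ)))).add analyticAt_snd)
  simpa [h.hφ0, ← Prod.zero_eq_mk] using h1.continuousAt.tendsto

theorem Reduced.good_top (h : Reduced G φ B U d p m) {C : ℝ} (hC : 0 < C) (c : ℕ) :
    ∃ η > 0, ∀ σ₀ b ε, 0 < σ₀ → σ₀ ≤ η → 0 < b → b ≤ η → 0 < ε → ε ≤ η →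
      (∀ r ∈ Icc 0 ε, φ r + (ε / σ₀) ^ p < b) → Good G (dens fun z => C * z.1 ^ c)
        {z | z.1 ∈ Ioo 0 ε ∧ φ z.1 + (ε / σ₀) ^ p ≤ z.2 ∧ z.2 < b} := by
  have hp := h.hp.ne'
  obtain ⟨δ₀, hδ₀, hne⟩ := h.wpoly_ne_zero
  obtain ⟨δ₁, hδ₁, hbox⟩ := eventually_box (h.eq.and ((h.tendsto.eventually
    h.hG.eventually_analyticAt).and (h.hU.eventually_analyticAt.and
      (h.hU.continuousAt.eventually_ne h.hU0))))
  let μ := min δ₁ (δ₀ ^ p) / 2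
  have hμ : 0 < μ := by positivity
  have hμ1 : 2 * μ ≤ δ₁ := by simp only [μ]; linarith [min_le_left δ₁ (δ₀ ^ p)]
  have hμ2 : 2 * μ ≤ δ₀ ^ p := by simp only [μ]; linarith [min_le_right δ₁ (δ₀ ^ p)]
  have hφs : ∀ᶠ r in 𝓝 (0 : ℝ), |φ r| < μ :=
    h.hφ.continuousAt.abs.eventually (gt_mem_nhds (by simpa [h.hφ0] using hμ))
  obtain ⟨δ₂, hδ₂, hφ⟩ := Metric.nhds_basis_closedBall.eventually_iff.1
    (hφs.and h.hφ.eventually_analyticAt)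
  refine ⟨min (min μ δ₀) δ₂, by positivity, fun σ₀ b ε hσ0 hσ hb0 hb hε0 hε hlt => ?_⟩
  have hσδ : σ₀ ≤ δ₀ := hσ.trans ((min_le_left _ _).trans (min_le_right _ _))
  have hbμ : b ≤ μ := hb.trans ((min_le_left _ _).trans (min_le_left _ _))
  have hεμ : ε ≤ μ := hε.trans ((min_le_left _ _).trans (min_le_left _ _))
  have hεδ : ε ≤ δ₂ := hε.trans (min_le_right _ _)
  set s₀ := (ε / σ₀) ^ p with hs₀
  have hs₀0 : 0 < s₀ := by positivity
  have hφ' : ∀ r ∈ Icc 0 ε, |φ r| < μ ∧ AnalyticAt ℝ φ r := fun r hr => hφ (by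
    rw [mem_closedBall_zero_iff, Real.norm_eq_abs, abs_of_nonneg hr.1]; exact hr.2.trans hεδ)
  let β : ℝ → ℝ := fun r => b - (φ r + s₀)
  have hβ : ∀ r ∈ Icc 0 ε, 0 < β r := fun r hr => sub_pos.2 (hlt r hr)
  let s : ℝ × ℝ → ℝ := fun z => s₀ + z.2 * β z.1
  have hs : ∀ z ∈ Icc 0 ε ×ˢ Icc (0 : ℝ) 1, s₀ ≤ s z ∧ s z ≤ 2 * μ := by
    intro z hz
    have h1 := hβ z.1 hz.1
    have h2 := (abs_lt.1 (hφ' z.1 hz.1).1).1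
    have h3 : 0 ≤ z.2 * β z.1 := mul_nonneg hz.2.1 h1.le
    have h4 : z.2 * β z.1 ≤ β z.1 := mul_le_of_le_one_left h1.le hz.2.2
    simp only [s, β] at *
    constructor <;> linarith
  let T : ℝ × ℝ → ℝ × ℝ := fun z => (z.1, φ z.1 + s z)
  have hβa : ∀ r ∈ Icc 0 ε, AnalyticAt ℝ β r := fun r hr =>
    analyticAt_const.sub ((hφ' r hr).2.add analyticAt_const)
  have hβa' : ∀ z : ℝ × ℝ, z.1 ∈ Icc 0 ε → AnalyticAt ℝ (fun z : ℝ × ℝ => β z.1) z := fun z hr =>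
    AnalyticAt.fun_comp (g := β) (f := Prod.fst) (hβa z.1 hr) analyticAt_fst
  have hsa : ∀ z : ℝ × ℝ, z.1 ∈ Icc 0 ε → AnalyticAt ℝ s z := fun z hr =>
    analyticAt_const.add (analyticAt_snd.mul (hβa' z hr))
  have hφa : ∀ z : ℝ × ℝ, z.1 ∈ Icc 0 ε → AnalyticAt ℝ (fun z : ℝ × ℝ => φ z.1) z := fun z hr =>
    AnalyticAt.fun_comp (g := φ) (f := Prod.fst) (hφ' z.1 hr).2 analyticAt_fst
  have hDa : ∀ z : ℝ × ℝ, z.1 ∈ Icc 0 ε → AnalyticAt ℝ (fun z => C * z.1 ^ c * β z.1) z :=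
    fun z hr => (analyticAt_const.mul (analyticAt_fst.pow c)).mul (hβa' z hr)
  have h00 : (0 : ℝ) ∈ Icc 0 ε := ⟨le_rfl, hε0.le⟩
  have habs : ∀ z ∈ Icc 0 ε ×ˢ Icc (0 : ℝ) 1, |z.1| ≤ δ₁ ∧ |s z| ≤ δ₁ := by
    intro z hz
    rw [abs_of_nonneg hz.1.1, abs_of_nonneg (hs₀0.le.trans (hs z hz).1)]
    exact ⟨by linarith [hz.1.2], (hs z hz).2.trans hμ1⟩
  have hGT : ∀ z ∈ Icc 0 ε ×ˢ Icc (0 : ℝ) 1, G (T z) = z.1 ^ m * wpoly B U d p (z.1, s z) :=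
    fun z hz => (hbox z.1 (s z) (habs z hz).1 (habs z hz).2).1
  have hfull : ∀ τ ∈ Icc (0 : ℝ) 1, FullGood (fun z => G (T z)) (fun z => C * z.1 ^ c * β z.1) τ := by
    intro τ hτ
    have hz0 : ((0 : ℝ), τ) ∈ Icc 0 ε ×ˢ Icc (0 : ℝ) 1 := ⟨h00, hτ⟩
    have hb' := hbox 0 (s (0, τ)) (habs _ hz0).1 (habs _ hz0).2
    have hpair : AnalyticAt ℝ (fun z : ℝ × ℝ => (z.1, s z)) (0, τ) :=
      analyticAt_fst.prod (hsa _ h00)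
    refine fullGood_of_analyticAt (U := fun z => wpoly B U d p (z.1, s z)) (m := m) ?_ ?_
      (hDa _ h00) ?_ ?_
    · exact AnalyticAt.fun_comp (g := wpoly B U d p) (analyticAt_wpoly d p h.hB hb'.2.2.1) hpair
    · dsimp only
      rw [wpoly_zero h.hp]
      exact mul_ne_zero (pow_pos (hs₀0.trans_le (hs _ hz0).1) _).ne' hb'.2.2.2
    · filter_upwards [(hβa' (0, τ) h00).continuousAt.eventually (lt_mem_nhds (hβ 0 h00))] with z hz hz'
      have : 0 < β z.1 := hz
      positivity
    · have hlt' : |s (0, τ)| < δ₁ := by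
        have h1 : s (0, τ) ≤ b := by
          have h2 := hβ 0 h00
          have h4 : τ * β 0 ≤ β 0 := mul_le_of_le_one_left h2.le hτ.2
          simp only [s, β, h.hφ0, zero_add] at *
          linarith
        rw [abs_of_pos (hs₀0.trans_le (hs _ hz0).1)]
        linarith
      filter_upwards [(hsa (0, τ) h00).continuousAt.abs.eventually (gt_mem_nhds hlt'),
        continuousAt_fst.abs.eventually (gt_mem_nhds (show |((0 : ℝ), τ).1| < δ₁ by simpa using hδ₁))]
        with z hz hz' _
      exact (hbox z.1 (s z) hz'.le hz.le).1
  have hgood : Good (fun z => G (T z)) (dens fun z => C * z.1 ^ c * β z.1) (Ioo 0 ε ×ˢ Ioo 0 1) := by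
    refine (EvGood.of_fullGood zero_le_one hfull).extend hε0 (fun z hz => ?_) fun z hz => ?_
    · have hz' : z ∈ Icc 0 ε ×ˢ Icc (0 : ℝ) 1 := ⟨Ioc_subset_Icc_self hz.1, hz.2⟩
      have hTc : ContinuousAt T z :=
        continuousAt_fst.prodMk ((hφa z hz'.1).continuousAt.add (hsa z hz'.1).continuousAt)
      refine ⟨ContinuousAt.comp (f := T) (hbox z.1 (s z) (habs z hz').1 (habs z hz').2).2.1.continuousAt
        hTc, ?_⟩
      rw [hGT z hz']
      refine mul_ne_zero (pow_pos hz.1.1 m).ne' ?_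
      obtain ⟨v, hv0, hv⟩ := exists_root hp (hs₀0.trans_le (hs z hz').1)
      rw [← hv]
      refine hne z.1 v hz.1.1 hv0 ?_ ?_
      · have h1 := (hs z hz').1
        rw [← hv, hs₀, pow_le_pow_iff_left₀ (by positivity) hv0.le hp, div_le_iff₀ hσ0] at h1
        calc z.1 ≤ ε := hz.1.2
          _ ≤ v * σ₀ := h1
          _ ≤ v * δ₀ := by gcongr
          _ = δ₀ * v := mul_comm _ _
      · have h1 := (hs z hz').2.trans hμ2
        rwa [← hv, pow_le_pow_iff_left₀ hv0.le hδ₀.le hp] at h1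
    · exact (hDa z (Ioc_subset_Icc_self hz.1)).continuousAt
  have hgood' : Good (fun z => G (T z)) (dens fun z => C * z.1 ^ c * β z.1) (Ioo 0 ε ×ˢ Ico 0 1) := by
    refine hgood.mono_ae (prod_mono subset_rfl Ioo_subset_Ico_self) ?_
    refine measure_mono_null ?_ (dens_null (volume_prod_singleton univ 0))
    rintro z ⟨hz, hz', -⟩
    refine ⟨mem_univ _, ?_⟩
    by_contra hne
    exact hz' ⟨hz.1, lt_of_le_of_ne hz.2.1 (Ne.symm hne), hz.2.2⟩
  have hd : ∀ z ∈ Ioo 0 ε ×ˢ Ico (0 : ℝ) 1, HasFDerivAt T ((ContinuousLinearMap.fst ℝ ℝ ℝ).prod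
      (fderiv ℝ (fun z : ℝ × ℝ => φ z.1) z + fderiv ℝ s z)) z := by
    intro z hz
    have hz1 := Ioo_subset_Icc_self hz.1
    exact hasFDerivAt_fst.prodMk ((hφa z hz1).differentiableAt.hasFDerivAt.add
      (hsa z hz1).differentiableAt.hasFDerivAt)
  refine hgood'.transport (Φ := T) (measurableSet_Ioo.prod measurableSet_Ico) ?_ hd
    (fun z hz => rfl) (fun z hz => ?_) ?_
  · rintro z hz w hw hzw
    simp only [T, s, Prod.mk.injEq] at hzw
    obtain ⟨h1, h2⟩ := hzw
    rw [h1, add_right_inj, add_right_inj] at h2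
    exact Prod.ext h1 (mul_right_cancel₀ (hβ w.1 (Ioo_subset_Icc_self hw.1)).ne' h2)
  · have hz1 := Ioo_subset_Icc_self hz.1
    have e1 : fderiv ℝ (fun z : ℝ × ℝ => φ z.1) z (0, 1) = 0 := by
      have : HasFDerivAt (fun z : ℝ × ℝ => φ z.1) (deriv φ z.1 • ContinuousLinearMap.fst ℝ ℝ ℝ) z :=
        HasDerivAt.comp_hasFDerivAt z (hφ' z.1 hz1).2.differentiableAt.hasDerivAt hasFDerivAt_fst
      rw [this.fderiv]
      simp
    have e2 : fderiv ℝ s z (0, 1) = β z.1 := by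
      have e3 : HasFDerivAt (fun z : ℝ × ℝ => β z.1) (deriv β z.1 • ContinuousLinearMap.fst ℝ ℝ ℝ) z :=
        HasDerivAt.comp_hasFDerivAt (h₂ := β) (f := Prod.fst) z (hβa z.1 hz1).differentiableAt.hasDerivAt hasFDerivAt_fst
      have : HasFDerivAt s _ z := (hasFDerivAt_snd.mul e3).const_add s₀
      rw [this.fderiv]
      simp
    rw [det_prod 1 0 _ (β z.1) _ _ (by simp) (by simp) rfl (by simp [e1, e2]), zero_mul, sub_zero,
      one_mul, abs_of_pos (hβ z.1 hz1)]
    simp only [T]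
    ring
  · ext z
    constructor
    · rintro ⟨h1, h2, h3⟩
      have hb1 := hβ z.1 (Ioo_subset_Icc_self h1)
      refine ⟨(z.1, (z.2 - (φ z.1 + s₀)) / β z.1), ⟨h1, ?_, ?_⟩, ?_⟩
      · exact div_nonneg (by linarith) hb1.le
      · rw [div_lt_one hb1]
        simp only [β]
        linarith
      · simp only [T, s]
        rw [div_mul_cancel₀ _ hb1.ne']
        refine Prod.ext rfl ?_
        dsimp only
        ring
    · rintro ⟨w, hw, rfl⟩
      have hb1 := hβ w.1 (Ioo_subset_Icc_self hw.1)
      refine ⟨hw.1, ?_, ?_⟩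
      · simp only [T, s]
        linarith [mul_nonneg hw.2.1 hb1.le]
      · have := mul_lt_of_lt_one_left hb1 hw.2.2
        simp only [T, s, β] at *
        linarith

theorem Reduced.good_upper (h : Reduced G φ B U d p m) {C : ℝ} (hC : 0 < C) (c : ℕ) :
    ∃ η > 0, ∀ σ₀ b, 0 < σ₀ → σ₀ ≤ η → 0 < b → b ≤ η → ∃ ε₀ > 0, ∀ ε, 0 < ε → ε ≤ ε₀ →
      Good G (dens fun z => C * z.1 ^ c)
        {z | z.1 ∈ Ioo 0 ε ∧ φ z.1 + (z.1 / σ₀) ^ p < z.2 ∧ z.2 < b} := by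
  have hp := h.hp.ne'
  obtain ⟨δ, hδ, hside⟩ := h.good_side hC c
  obtain ⟨η, hη, htop⟩ := h.good_top hC c
  refine ⟨min δ η, by positivity, fun σ₀ b hσ0 hσ hb0 hb => ?_⟩
  have h1 : ∀ᶠ r in 𝓝 (0 : ℝ), φ r < b / 2 :=
    h.hφ.continuousAt.eventually (gt_mem_nhds (by simpa [h.hφ0] using hb0))
  have h2 : ∀ᶠ r in 𝓝 (0 : ℝ), (r / σ₀) ^ p < b / 2 := by
    have : ContinuousAt (fun r : ℝ => (r / σ₀) ^ p) 0 := by fun_prop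
    exact this.eventually (gt_mem_nhds (by simpa [hp] using hb0))
  obtain ⟨δ₂, hδ₂, hsm⟩ := Metric.nhds_basis_closedBall.eventually_iff.1 (h1.and h2)
  refine ⟨min (min δ₂ η) (δ * σ₀), by positivity, fun ε hε0 hε => ?_⟩
  have hε1 : ε ≤ δ₂ := hε.trans ((min_le_left _ _).trans (min_le_left _ _))
  have hε2 : ε ≤ η := hε.trans ((min_le_left _ _).trans (min_le_right _ _))
  have hε3 : ε / σ₀ ≤ δ := (div_le_iff₀ hσ0).2 (hε.trans (min_le_right _ _))
  have hsm' : ∀ r ∈ Icc 0 ε, φ r < b / 2 ∧ (r / σ₀) ^ p < b / 2 := fun r hr => hsm (by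
    rw [mem_closedBall_zero_iff, Real.norm_eq_abs, abs_of_nonneg hr.1]; exact hr.2.trans hε1)
  have hlt : ∀ r ∈ Icc 0 ε, φ r + (ε / σ₀) ^ p < b := fun r hr => by
    linarith [(hsm' r hr).1, (hsm' ε ⟨hε0.le, le_rfl⟩).2]
  have g1 := hside (ε / σ₀) σ₀ (by positivity) hε3 hσ0 (hσ.trans (min_le_left _ _))
  have g2 := htop σ₀ b ε hσ0 (hσ.trans (min_le_right _ _)) hb0 (hb.trans (min_le_right _ _)) hε0 hε2
    hlt
  have hr : ∀ r, 0 < r → ((r / σ₀) ^ p < (ε / σ₀) ^ p ↔ r < ε) := fun r hr => by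
    rw [pow_lt_pow_iff_left₀ (by positivity) (by positivity) hp, div_lt_div_iff_of_pos_right hσ0]
  convert g1.union g2 ?_ using 1
  · ext z
    simp only [mem_union, mem_ofPred_eq, mem_Ioo]
    constructor
    · rintro ⟨⟨ha, hb⟩, hc, hd⟩
      rcases lt_or_ge (z.2 - φ z.1) ((ε / σ₀) ^ p) with h | h
      · exact Or.inl ⟨ha, by linarith, h⟩
      · exact Or.inr ⟨⟨ha, hb⟩, by linarith, hd⟩
    · rintro (⟨ha, hb, hc⟩ | ⟨⟨ha, hb⟩, hc, hd⟩)
      · have hz := (hr z.1 ha).1 (hb.trans hc)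
        exact ⟨⟨ha, hz⟩, by linarith, by linarith [hlt z.1 ⟨ha.le, hz.le⟩]⟩
      · exact ⟨⟨ha, hb⟩, by linarith [(hr z.1 ha).2 hb], hd⟩
  · convert measure_empty (μ := dens fun z => C * z.1 ^ c)
    ext z
    simp only [mem_inter_iff, mem_ofPred_eq, mem_empty_iff_false, iff_false]
    rintro ⟨⟨_, _, h3⟩, _, h4, _⟩
    linarith

end

section

variable {G U : ℝ × ℝ → ℝ} {φ : ℝ → ℝ} {B : ℕ → ℝ → ℝ} {d p m : ℕ}

theorem good_middle (hφ : AnalyticAt ℝ φ 0) (G : ℝ × ℝ → ℝ) (p : ℕ) {C : ℝ} (c : ℕ) {M : ℝ}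
    (h : EvGood (fun z => G (z.1, φ z.1 + z.1 ^ p * z.2)) (fun z => C * z.1 ^ (c + p)) (-M) M) :
    ∃ ε₀ > 0, ∀ ε, 0 < ε → ε ≤ ε₀ → Good G (dens fun z => C * z.1 ^ c)
      {z | z.1 ∈ Ioo 0 ε ∧ |z.2 - φ z.1| ≤ M * z.1 ^ p} := by
  obtain ⟨ε₁, hε₁, h⟩ := h
  obtain ⟨δ, hδ, hφδ⟩ := Metric.nhds_basis_closedBall.eventually_iff.1 hφ.eventually_analyticAt
  refine ⟨min ε₁ δ, by positivity, fun ε hε0 hε => ?_⟩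
  let T : ℝ × ℝ → ℝ × ℝ := fun z => (z.1, φ z.1 + z.1 ^ p * z.2)
  have hg : Good (fun z => G (T z)) (dens fun z => C * z.1 ^ (c + p)) (Ioo 0 ε ×ˢ Icc (-M) M) := by
    refine (h ε hε0 (hε.trans (min_le_left _ _))).mono_ae (prod_mono subset_rfl Ioo_subset_Icc_self) ?_
    refine measure_mono_null ?_ (measure_union_null
      (dens_null (volume_prod_singleton univ (-M))) (dens_null (volume_prod_singleton univ M)))
    rintro z ⟨hz, hz', -⟩
    by_contra hne
    simp only [mem_union, mem_prod, mem_univ, true_and, mem_singleton_iff, not_or] at hne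
    exact hz' ⟨hz.1, lt_of_le_of_ne hz.2.1 (Ne.symm hne.1), lt_of_le_of_ne hz.2.2 hne.2⟩
  have hφ' : ∀ z ∈ Ioo 0 ε ×ˢ Icc (-M) M, AnalyticAt ℝ φ z.1 := fun z hz => hφδ (by
    rw [mem_closedBall_zero_iff, Real.norm_eq_abs, abs_of_pos hz.1.1]
    exact hz.1.2.le.trans (hε.trans (min_le_right _ _)))
  let E : ℝ × ℝ → ℝ × ℝ →L[ℝ] ℝ := fun z => deriv φ z.1 • ContinuousLinearMap.fst ℝ ℝ ℝ +
    (z.1 ^ p • ContinuousLinearMap.snd ℝ ℝ ℝ +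
      z.2 • (p * z.1 ^ (p - 1)) • ContinuousLinearMap.fst ℝ ℝ ℝ)
  refine hg.transport (Φ := T) (Φ' := fun z => (ContinuousLinearMap.fst ℝ ℝ ℝ).prod (E z))
    (measurableSet_Ioo.prod measurableSet_Icc) ?_
    (fun z hz => ?_) (fun z hz => rfl) (fun z hz => ?_) ?_
  · rintro z hz w hw hzw
    simp only [T, Prod.mk.injEq] at hzw
    obtain ⟨h1, h2⟩ := hzw
    rw [h1, add_right_inj] at h2
    exact Prod.ext h1 (mul_left_cancel₀ (pow_pos hw.1.1 p).ne' h2)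
  · refine hasFDerivAt_fst.prodMk (HasFDerivAt.add ?_
      ((hasFDerivAt_pow hasFDerivAt_fst p).mul hasFDerivAt_snd))
    exact HasDerivAt.comp_hasFDerivAt z (hφ' z hz).differentiableAt.hasDerivAt hasFDerivAt_fst
  · rw [det_prod 1 0 _ (z.1 ^ p) _ _ (by simp) (by simp) rfl (by simp [E]), zero_mul, sub_zero,
      one_mul, abs_of_pos (pow_pos hz.1.1 p), pow_add]
    simp only [T]
    ring
  · ext z
    constructor
    · rintro ⟨h1, h2⟩
      have h3 := pow_pos h1.1 p
      refine ⟨(z.1, (z.2 - φ z.1) / z.1 ^ p), ⟨h1, ?_⟩, ?_⟩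
      · rw [mem_Icc, ← abs_le, abs_div, abs_of_pos h3, div_le_iff₀ h3]
        exact h2
      · simp only [T]
        rw [mul_div_cancel₀ _ h3.ne']
        refine Prod.ext rfl ?_
        dsimp only
        ring
    · rintro ⟨w, hw, rfl⟩
      have h3 := pow_pos hw.1.1 p
      refine ⟨hw.1, ?_⟩
      simp only [T, add_sub_cancel_left]
      rw [abs_mul, abs_of_pos h3, mul_comm]
      exact mul_le_mul_of_nonneg_right (abs_le.2 hw.2) h3.le

theorem Reduced.good_lower (h : Reduced G φ B U d p m) {C : ℝ} (hC : 0 < C) (c : ℕ) :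
    ∃ η > 0, ∀ σ₀ a, 0 < σ₀ → σ₀ ≤ η → -η ≤ a → a < 0 → ∃ ε₀ > 0, ∀ ε, 0 < ε → ε ≤ ε₀ →
      Good G (dens fun z => C * z.1 ^ c)
        {z | z.1 ∈ Ioo 0 ε ∧ z.2 < φ z.1 - (z.1 / σ₀) ^ p ∧ a < z.2} := by
  obtain ⟨η, hη, H⟩ := h.neg.good_upper hC c
  refine ⟨η, hη, fun σ₀ a hσ0 hσ ha ha0 => ?_⟩
  obtain ⟨ε₀, hε₀, H⟩ := H σ₀ (-a) hσ0 hσ (by linarith) (by linarith)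
  obtain ⟨δ, hδ, hφδ⟩ := Metric.nhds_basis_closedBall.eventually_iff.1 h.hφ.eventually_analyticAt
  refine ⟨min ε₀ δ, by positivity, fun ε hε0 hε => ?_⟩
  have hc : ContinuousOn (fun z : ℝ × ℝ => φ z.1) (Ioo 0 ε ×ˢ univ) := by
    intro z hz
    refine ContinuousAt.continuousWithinAt (ContinuousAt.comp (f := Prod.fst) (g := φ)
      (hφδ ?_).continuousAt continuousAt_fst)
    rw [mem_closedBall_zero_iff, Real.norm_eq_abs, abs_of_pos hz.1.1]
    exact hz.1.2.le.trans (hε.trans (min_le_right _ _))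
  refine (H ε hε0 (hε.trans (min_le_left _ _))).transport (Φ := fun z => (z.1, -z.2))
    (Φ' := fun _ => (ContinuousLinearMap.fst ℝ ℝ ℝ).prod (-ContinuousLinearMap.snd ℝ ℝ ℝ))
    ?_ ?_ (fun z hz => hasFDerivAt_fst.prodMk hasFDerivAt_snd.neg) (fun z hz => rfl)
    (fun z hz => ?_) ?_
  · have hU : IsOpen (Ioo 0 ε ×ˢ (univ : Set ℝ)) := isOpen_Ioo.prod isOpen_univ
    have hf : ContinuousOn (fun z : ℝ × ℝ => -φ z.1 + (z.1 / σ₀) ^ p - z.2) (Ioo 0 ε ×ˢ univ) :=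
      (hc.neg.add (by fun_prop)).sub continuousOn_snd
    convert ((hf.isOpen_inter_preimage hU isOpen_Iio).inter
      (isOpen_Iio.preimage continuous_snd)).measurableSet (s := _ ∩ _ ⁻¹' Iio 0 ∩ _ ⁻¹' Iio (-a)) using 1
    ext z
    simp only [mem_inter_iff, mem_prod, mem_univ, and_true, mem_preimage, mem_Iio, sub_neg,
      mem_ofPred_eq, and_assoc]
  · rintro z hz w hw hzw
    simp only [Prod.mk.injEq, neg_inj] at hzw
    exact Prod.ext hzw.1 hzw.2
  · rw [det_prod 1 0 0 (-1)] <;> simp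
  · ext z
    constructor
    · rintro ⟨h1, h2, h3⟩
      exact ⟨(z.1, -z.2), ⟨h1, by dsimp only; linarith, by dsimp only; linarith⟩, by simp⟩
    · rintro ⟨w, ⟨h1, h2, h3⟩, rfl⟩
      exact ⟨h1, by dsimp only; linarith, by dsimp only; linarith⟩

/-- The neighbourhood of a reduced point is good as soon as the exceptional chart is. -/
theorem Reduced.evGood (h : Reduced G φ B U d p m) {C : ℝ} (hC : 0 < C) (c : ℕ) {M₀ : ℝ}
    (hM : ∀ M, M₀ ≤ M → EvGood (fun z => G (z.1, φ z.1 + z.1 ^ p * z.2))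
      (fun z => C * z.1 ^ (c + p)) (-M) M) :
    ∃ δ > 0, ∀ a b, -δ ≤ a → a < 0 → 0 < b → b ≤ δ → EvGood G (fun z => C * z.1 ^ c) a b := by
  have hp := h.hp.ne'
  obtain ⟨η₁, hη₁, hup⟩ := h.good_upper hC c
  obtain ⟨η₂, hη₂, hlow⟩ := h.good_lower hC c
  refine ⟨min η₁ η₂, by positivity, fun a b ha ha0 hb0 hb => ?_⟩
  obtain ⟨σ, hσ0, hσ1, hσ2, hσM⟩ : ∃ σ > 0, σ ≤ η₁ ∧ σ ≤ η₂ ∧ M₀ ≤ (1 / σ) ^ p := by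
    have hK : 0 < max M₀ 1 := by positivity
    refine ⟨min (min η₁ η₂) (1 / max M₀ 1), by positivity, (min_le_left _ _).trans (min_le_left _ _),
      (min_le_left _ _).trans (min_le_right _ _), ?_⟩
    set σ := min (min η₁ η₂) (1 / max M₀ 1)
    have hσ : 0 < σ := by positivity
    have h1 : max M₀ 1 ≤ 1 / σ := by
      rw [le_div_iff₀ hσ, mul_comm, ← le_div_iff₀ hK]
      exact min_le_right _ _
    calc M₀ ≤ max M₀ 1 := le_max_left _ _
      _ ≤ 1 / σ := h1
      _ ≤ (1 / σ) ^ p := le_self_pow₀ ((le_max_right _ _).trans h1) hp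
  obtain ⟨ε₁, hε₁, hup⟩ := hup σ b hσ0 hσ1 hb0 (hb.trans (min_le_left _ _))
  obtain ⟨ε₂, hε₂, hlow⟩ := hlow σ a hσ0 hσ2 (by linarith [min_le_right η₁ η₂]) ha0
  obtain ⟨ε₃, hε₃, hmid⟩ := good_middle h.hφ G p c (hM _ hσM)
  let M := (1 / σ) ^ p
  have hMr : ∀ r, (r / σ) ^ p = M * r ^ p := fun r => by
    rw [← mul_pow]
    ring
  have e1 : ∀ᶠ r in 𝓝 (0 : ℝ), φ r + M * r ^ p < b := by
    have : ContinuousAt (fun r => φ r + M * r ^ p) 0 := h.hφ.continuousAt.add (by fun_prop)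
    exact this.eventually (gt_mem_nhds (by simpa [h.hφ0, hp] using hb0))
  have e2 : ∀ᶠ r in 𝓝 (0 : ℝ), a < φ r - M * r ^ p := by
    have : ContinuousAt (fun r => φ r - M * r ^ p) 0 := h.hφ.continuousAt.sub (by fun_prop)
    exact this.eventually (lt_mem_nhds (by simpa [h.hφ0, hp] using ha0))
  obtain ⟨δ, hδ, hsm⟩ := Metric.nhds_basis_closedBall.eventually_iff.1 (e1.and e2)
  refine ⟨min (min ε₁ ε₂) (min ε₃ δ), by positivity, fun ε hε0 hε => ?_⟩
  have g1 := hup ε hε0 (hε.trans ((min_le_left _ _).trans (min_le_left _ _)))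
  have g2 := hlow ε hε0 (hε.trans ((min_le_left _ _).trans (min_le_right _ _)))
  have g3 := hmid ε hε0 (hε.trans ((min_le_right _ _).trans (min_le_left _ _)))
  have hεδ := hε.trans ((min_le_right _ _).trans (min_le_right _ _))
  have hsm' : ∀ r ∈ Ioo 0 ε, φ r + M * r ^ p < b ∧ a < φ r - M * r ^ p := fun r hr => hsm (by
    rw [mem_closedBall_zero_iff, Real.norm_eq_abs, abs_of_pos hr.1]; exact hr.2.le.trans hεδ)
  simp only [hMr] at g1 g2
  have hM0 : ∀ r ∈ Ioo 0 ε, 0 < M * r ^ p := fun r hr =>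
    mul_pos (pow_pos (one_div_pos.2 hσ0) p) (pow_pos hr.1 p)
  have hempty : ∀ s : Set (ℝ × ℝ), s = ∅ → dens (fun z => C * z.1 ^ c) s = 0 := fun s hs => by
    rw [hs, measure_empty]
  convert (g1.union g3 (hempty _ ?_)).union g2 (hempty _ ?_) using 1
  · ext z
    simp only [mem_union, mem_ofPred_eq, mem_prod]
    constructor
    · rintro ⟨h1, h2, h3⟩
      rcases lt_or_ge (φ z.1 + M * z.1 ^ p) z.2 with h4 | h4
      · exact Or.inl (Or.inl ⟨h1, h4, h3⟩)
      · rcases lt_or_ge z.2 (φ z.1 - M * z.1 ^ p) with h5 | h5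
        · exact Or.inr ⟨h1, h5, h2⟩
        · exact Or.inl (Or.inr ⟨h1, abs_le.2 ⟨by linarith, by linarith⟩⟩)
    · rintro ((⟨h1, h2, h3⟩ | ⟨h1, h2⟩) | ⟨h1, h2, h3⟩)
      · exact ⟨h1, by linarith [hM0 _ h1, (hsm' _ h1).2], h3⟩
      · have := abs_le.1 h2
        exact ⟨h1, by linarith [(hsm' _ h1).2], by linarith [(hsm' _ h1).1]⟩
      · exact ⟨h1, h3, by linarith [hM0 _ h1, (hsm' _ h1).1]⟩
  · ext z
    simp only [mem_inter_iff, mem_ofPred_eq, mem_empty_iff_false, iff_false]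
    rintro ⟨⟨_, h1, _⟩, _, h2⟩
    linarith [(abs_le.1 h2).2]
  · ext z
    simp only [mem_inter_iff, mem_union, mem_ofPred_eq, mem_empty_iff_false, iff_false]
    rintro ⟨(⟨h0, h1, _⟩ | ⟨_, h1⟩), _, h2, _⟩
    · linarith [hM0 _ h0]
    · linarith [(abs_le.1 h1).1]

end

section

theorem punctGood_corner {G V : ℝ × ℝ → ℝ} {a : ℕ} (ha : 0 < a) (e : ℕ) (hV : AnalyticAt ℝ V 0)
    (hV0 : V 0 ≠ 0) (hG : ∀ᶠ z in 𝓝 (0 : ℝ × ℝ), G z = z.1 ^ a * (z.2 ^ e * V z)) {C : ℝ} (hC : 0 < C)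
    (c : ℕ) : PunctGood G (fun z => C * z.1 ^ c) 0 := by
  have hD : ∀ z, AnalyticAt ℝ (fun z : ℝ × ℝ => C * z.1 ^ c) z := fun z =>
    analyticAt_const.mul (analyticAt_fst.pow c)
  have hn : AnalyticAt ℝ (fun z : ℝ × ℝ => (z.1, -z.2)) 0 := analyticAt_fst.prod analyticAt_snd.neg
  have hnt : Tendsto (fun z : ℝ × ℝ => (z.1, -z.2)) (𝓝 0) (𝓝 0) := by
    simpa [← Prod.zero_eq_mk] using hn.continuousAt.tendsto
  obtain ⟨δ₁, hδ₁, h1⟩ := good_corner (G := G) (D := fun z => C * z.1 ^ c) ha e hV hV0 (hD 0)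
    (Eventually.of_forall fun z hz _ => by positivity)
    (hG.mono fun z hz _ _ => by rw [hz]; ring)
  obtain ⟨δ₂, hδ₂, h2⟩ := good_corner (G := fun z => G (z.1, -z.2))
    (U := fun z => (-1) ^ e * V (z.1, -z.2)) (D := fun z => C * z.1 ^ c) ha e
    (analyticAt_const.mul (AnalyticAt.fun_comp (g := V) (by simpa [← Prod.zero_eq_mk] using hV) hn))
    (by simpa [← Prod.zero_eq_mk] using hV0) (hD 0)
    (Eventually.of_forall fun z hz _ => by positivity)
    (by
      filter_upwards [hnt.eventually hG] with z hz _ _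
      rw [hz, neg_pow z.2 e]
      ring)
  obtain ⟨δ₃, hδ₃, hbox⟩ := eventually_box (hG.and (hV.eventually_analyticAt.and
    (hV.continuousAt.eventually_ne hV0)))
  refine ⟨min (min δ₁ δ₂) (δ₃ / 2), by positivity, fun x y hx hx0 hy0 hy => ?_, fun x hx0 hx => ?_⟩
  · have hm1 : min (min δ₁ δ₂) (δ₃ / 2) ≤ δ₁ := (min_le_left _ _).trans (min_le_left _ _)
    have hm2 : min (min δ₁ δ₂) (δ₃ / 2) ≤ δ₂ := (min_le_left _ _).trans (min_le_right _ _)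
    have g1 : EvGood G (fun z => C * z.1 ^ c) 0 y := ⟨δ₁, hδ₁, fun ε hε hε' =>
      h1 ε y hε hε' hy0 (by linarith)⟩
    have g2 : EvGood G (fun z => C * z.1 ^ c) x 0 := by
      have : EvGood (fun z => G (z.1, -z.2)) (fun z => C * z.1 ^ c) 0 (-x) := ⟨δ₂, hδ₂, fun ε hε hε' =>
        h2 ε (-x) hε hε' (by linarith) (by linarith)⟩
      simpa using EvGood.reflect (G := G) (D := fun z => C * z.1 ^ c) this
    exact g2.trans g1 hx0.le hy0.le
  · rw [sub_zero] at hx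
    have hx' : |x| < δ₃ := by linarith [min_le_right (min δ₁ δ₂) (δ₃ / 2)]
    have hb := hbox 0 x (by simpa using hδ₃.le) hx'.le
    refine fullGood_of_analyticAt (U := fun z => z.2 ^ e * V z) (m := a)
      ((analyticAt_snd.pow e).mul hb.2.1) (mul_ne_zero (pow_ne_zero e hx0) hb.2.2) (hD _)
      (Eventually.of_forall fun z hz => by positivity) ?_
    filter_upwards [continuousAt_fst.abs.eventually
        (gt_mem_nhds (show |((0 : ℝ), x).1| < δ₃ by simpa using hδ₃)),
      continuousAt_snd.abs.eventually (gt_mem_nhds (show |((0 : ℝ), x).2| < δ₃ from hx'))] with z h3 h4 _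
    exact (hbox z.1 z.2 h3.le h4.le).1

/-- The local statement at a point of the exceptional divisor where the strict transform has order
`d`. -/
def LocalGood (d : ℕ) : Prop :=
  ∀ (G G₁ : ℝ × ℝ → ℝ) (u : ℝ → ℝ) (m : ℕ) (C : ℝ) (c : ℕ), 0 < C → AnalyticAt ℝ G 0 →
    AnalyticAt ℝ G₁ 0 → (∀ᶠ z in 𝓝 (0 : ℝ × ℝ), G z = z.1 ^ m * G₁ z) → AnalyticAt ℝ u 0 → u 0 ≠ 0 →
    (∀ᶠ t in 𝓝 (0 : ℝ), G₁ (0, t) = t ^ d * u t) → PunctGood G (fun z => C * z.1 ^ c) 0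

theorem LocalGood.of_analyticAt {d : ℕ} (h : LocalGood d) {G G₁ : ℝ × ℝ → ℝ} {u : ℝ → ℝ} {m : ℕ} {C : ℝ}
    {τ : ℝ} (c : ℕ) (hC : 0 < C) (hG : AnalyticAt ℝ G (0, τ)) (hG₁ : AnalyticAt ℝ G₁ (0, τ))
    (heq : ∀ᶠ z in 𝓝 (0, τ), G z = z.1 ^ m * G₁ z) (hu : AnalyticAt ℝ u 0) (hu0 : u 0 ≠ 0)
    (hord : ∀ᶠ t in 𝓝 (0 : ℝ), G₁ (0, t + τ) = t ^ d * u t) :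
    PunctGood G (fun z => C * z.1 ^ c) τ := by
  let s : ℝ × ℝ → ℝ × ℝ := fun z => (z.1, z.2 + τ)
  have hs : AnalyticAt ℝ s 0 := analyticAt_fst.prod (analyticAt_snd.add analyticAt_const)
  have hs0 : s 0 = (0, τ) := by simp [s]
  have hst : Tendsto s (𝓝 0) (𝓝 (0, τ)) := by simpa [hs0] using hs.continuousAt.tendsto
  exact PunctGood.shift (h (fun z => G (s z)) (fun z => G₁ (s z)) u m C c hC
    (AnalyticAt.fun_comp (g := G) (f := s) (by rwa [hs0]) hs)
    (AnalyticAt.fun_comp (g := G₁) (f := s) (by rwa [hs0]) hs) (hst.eventually heq) hu hu0 hord)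

variable {G U : ℝ × ℝ → ℝ} {φ : ℝ → ℝ} {B : ℕ → ℝ → ℝ} {d p m : ℕ}

/-- The strict transform of `wpoly` in the chart `(w, τ) ↦ (w, w ^ p * τ)`. -/
def wpolyMid (B : ℕ → ℝ → ℝ) (U : ℝ × ℝ → ℝ) (d p : ℕ) (z : ℝ × ℝ) : ℝ :=
  ∑ j ∈ Finset.range d, B j z.1 * z.2 ^ j + z.2 ^ d * U (z.1, z.1 ^ p * z.2)

theorem wpoly_mid (B : ℕ → ℝ → ℝ) (U : ℝ × ℝ → ℝ) (d p : ℕ) (w τ : ℝ) :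
    wpoly B U d p (w, w ^ p * τ) = w ^ (p * d) * wpolyMid B U d p (w, τ) := by
  simp only [wpoly, wpolyMid, mul_add, Finset.mul_sum]
  congr 1
  · refine Finset.sum_congr rfl fun j hj => ?_
    obtain ⟨k, rfl⟩ := Nat.exists_eq_add_of_lt (Finset.mem_range.1 hj)
    rw [show j + k + 1 - j = k + 1 by omega, mul_pow, ← pow_mul,
      show p * (j + k + 1) = p * (k + 1) + p * j by ring, pow_add]
    ring
  · rw [mul_pow, ← pow_mul]
    ring

open Polynomial in
/-- The restriction of the strict transform to the exceptional divisor. -/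
noncomputable def initialPoly (B : ℕ → ℝ → ℝ) (U : ℝ × ℝ → ℝ) (d : ℕ) : ℝ[X] :=
  ∑ j ∈ Finset.range d, C (B j 0) * X ^ j + C (U 0) * X ^ d

theorem initialPoly_coeff (B : ℕ → ℝ → ℝ) (U : ℝ × ℝ → ℝ) (d k : ℕ) :
    (initialPoly B U d).coeff k = if k < d then B k 0 else if k = d then U 0 else 0 := by
  simp only [initialPoly, Polynomial.coeff_add, Polynomial.finsetSum_coeff,
    Polynomial.coeff_C_mul_X_pow]
  rw [Finset.sum_ite_eq]
  simp only [Finset.mem_range]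
  split_ifs <;> first | omega | simp

theorem initialPoly_natDegree (hU0 : U 0 ≠ 0) : (initialPoly B U d).natDegree = d := by
  refine Polynomial.natDegree_eq_of_le_of_coeff_ne_zero ?_ ?_
  · refine Polynomial.natDegree_le_iff_coeff_eq_zero.2 fun N hN => ?_
    rw [initialPoly_coeff, if_neg (by omega), if_neg (by omega)]
  · rw [initialPoly_coeff, if_neg (by omega), if_pos rfl]
    exact hU0

theorem initialPoly_ne_zero (hU0 : U 0 ≠ 0) : initialPoly B U d ≠ 0 := by
  intro h
  have := initialPoly_coeff B U d d
  rw [h] at this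
  simp at this
  exact hU0 this.symm

theorem wpolyMid_zero (hp : 0 < p) (t : ℝ) :
    wpolyMid B U d p (0, t) = (initialPoly B U d).eval t := by
  simp only [wpolyMid, initialPoly, Polynomial.eval_add, Polynomial.eval_finsetSum,
    Polynomial.eval_mul, Polynomial.eval_C, Polynomial.eval_pow, Polynomial.eval_X]
  rw [zero_pow hp.ne', zero_mul, ← Prod.zero_eq_mk]
  ring

theorem eq_C_mul_of_rootMultiplicity {P : Polynomial ℝ} {d : ℕ} (hP : P ≠ 0) (hd : P.natDegree = d)
    {τ : ℝ} (h : d ≤ P.rootMultiplicity τ) :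
    P = Polynomial.C P.leadingCoeff * (Polynomial.X - Polynomial.C τ) ^ d := by
  have hdvd : (Polynomial.X - Polynomial.C τ) ^ d ∣ P :=
    (pow_dvd_pow _ h).trans (Polynomial.pow_rootMultiplicity_dvd P τ)
  obtain ⟨Q, hQ⟩ := hdvd
  have hm : ((Polynomial.X - Polynomial.C τ) ^ d).Monic := (Polynomial.monic_X_sub_C τ).pow d
  have hQd : Q.natDegree = 0 := by
    have hQ0 : Q ≠ 0 := by
      rintro rfl
      exact hP (by simpa using hQ)
    have := congrArg Polynomial.natDegree hQ
    rw [hm.natDegree_mul' hQ0, hd, (Polynomial.monic_X_sub_C τ).natDegree_pow,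
      Polynomial.natDegree_X_sub_C] at this
    omega
  have hlead : P.leadingCoeff = Q.coeff 0 := by
    rw [hQ, Polynomial.leadingCoeff_monic_mul hm, Polynomial.leadingCoeff, hQd]
  rw [hlead, ← Polynomial.eq_C_of_natDegree_eq_zero hQd, mul_comm]
  exact hQ

/-- A reduced point is good if lower order points are. -/
theorem Reduced.evGood_of_localGood (h : Reduced G φ B U d p m) (hB : B (d - 1) 0 = 0)
    (hcase : (∃ j < d, B j 0 ≠ 0) ∨ ∀ j < d, ∀ r, B j r = 0) (ih : ∀ k < d, LocalGood k) {C : ℝ}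
    (hC : 0 < C) (c : ℕ) :
    ∃ δ > 0, ∀ a b, -δ ≤ a → a < 0 → 0 < b → b ≤ δ → EvGood G (fun z => C * z.1 ^ c) a b := by
  have hp := h.hp.ne'
  set P := initialPoly B U d with hP
  have hP0 : P ≠ 0 := initialPoly_ne_zero h.hU0
  let T : ℝ × ℝ → ℝ × ℝ := fun z => (z.1, z.1 ^ p * z.2)
  let G' : ℝ × ℝ → ℝ := fun z => G (z.1, φ z.1 + z.1 ^ p * z.2)
  have hT : ∀ z, AnalyticAt ℝ T z := fun z =>
    analyticAt_fst.prod ((analyticAt_fst.pow p).mul analyticAt_snd)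
  have hT0 : ∀ τ, T (0, τ) = 0 := fun τ => by simp [T, hp]
  have hTt : ∀ τ, Tendsto T (𝓝 (0, τ)) (𝓝 0) := fun τ => by
    simpa [hT0] using (hT (0, τ)).continuousAt.tendsto
  have hG' : ∀ τ, AnalyticAt ℝ G' (0, τ) := fun τ => by
    have hφ' : AnalyticAt ℝ (fun z : ℝ × ℝ => φ z.1) (0, τ) :=
      AnalyticAt.fun_comp (g := φ) (f := Prod.fst) h.hφ analyticAt_fst
    refine AnalyticAt.fun_comp (g := G) ?_
      (analyticAt_fst.prod (hφ'.add ((analyticAt_fst.pow p).mul analyticAt_snd)))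
    simpa [h.hφ0, hp, ← Prod.zero_eq_mk] using h.hG
  have hUT : ∀ τ, AnalyticAt ℝ (fun z => U (T z)) (0, τ) := fun τ =>
    AnalyticAt.fun_comp (g := U) (by rw [hT0]; exact h.hU) (hT _)
  have hG2 : ∀ τ, AnalyticAt ℝ (wpolyMid B U d p) (0, τ) := fun τ => by
    refine AnalyticAt.add (Finset.analyticAt_fun_sum _ fun j _ => ?_)
      ((analyticAt_snd.pow d).mul (hUT τ))
    exact (AnalyticAt.fun_comp (g := B j) (f := Prod.fst) (h.hB j) analyticAt_fst).mul
      (analyticAt_snd.pow j)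
  have heq : ∀ τ, ∀ᶠ z in 𝓝 ((0 : ℝ), τ), G' z = z.1 ^ (m + p * d) * wpolyMid B U d p z := fun τ => by
    filter_upwards [(hTt τ).eventually h.eq] with z hz
    have := hz
    simp only [T] at this
    simp only [G']
    rw [this, wpoly_mid]
    ring
  have hfull : ∀ τ, P.eval τ ≠ 0 → FullGood G' (fun z => C * z.1 ^ (c + p)) τ := fun τ hτ => by
    refine fullGood_of_analyticAt (hG2 τ) (by rwa [wpolyMid_zero h.hp])
      (analyticAt_const.mul (analyticAt_fst.pow _)) (Eventually.of_forall fun z hz => by positivity)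
      ((heq τ).mono fun z hz _ => hz)
  have hpunct : ∀ τ, PunctGood G' (fun z => C * z.1 ^ (c + p)) τ := fun τ => by
    rcases lt_or_ge (P.rootMultiplicity τ) d with hlt | hge
    · obtain ⟨Q, hQ, hQ'⟩ := P.exists_eq_pow_rootMultiplicity_mul_and_not_dvd hP0 τ
      refine (ih _ hlt).of_analyticAt (u := fun t => Q.eval (t + τ)) (c + p) hC (hG' τ) (hG2 τ) (heq τ)
        ?_ ?_ (Eventually.of_forall fun t => ?_)
      · exact AnalyticAt.fun_comp (g := fun x => Q.eval x) (AnalyticAt.aeval_polynomial analyticAt_id Q)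
          (analyticAt_id.add analyticAt_const)
      · rw [Polynomial.dvd_iff_isRoot] at hQ'
        simpa using hQ'
      · rw [wpolyMid_zero h.hp, ← hP]
        conv_lhs => rw [hQ]
        simp
    · have hPe := eq_C_mul_of_rootMultiplicity hP0 (initialPoly_natDegree h.hU0) hge
      have hd := h.hd
      obtain ⟨e, rfl⟩ : ∃ e, d = e + 1 := ⟨d - 1, by omega⟩
      have hτ : τ = 0 := by
        have h1 := congrArg (fun Q => Polynomial.coeff Q e) hPe
        rw [hP, initialPoly_coeff, if_pos (by omega), ← hP] at h1
        simp only [Nat.add_sub_cancel] at hB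
        rw [hB, Polynomial.coeff_C_mul, sub_eq_add_neg, ← Polynomial.C_neg,
          Polynomial.coeff_X_add_C_pow] at h1
        simp at h1
        rcases h1 with h1 | h1 | h1
        · exact absurd h1 hP0
        · exact h1
        · exact absurd h1 (by positivity)
      subst hτ
      rcases hcase with ⟨j, hj, hBj⟩ | hB0
      · exfalso
        apply hBj
        have h1 := congrArg (fun Q => Polynomial.coeff Q j) hPe
        rw [hP, initialPoly_coeff, if_pos hj] at h1
        rw [h1]
        simp [Polynomial.coeff_X_pow, hj.ne]
      · refine punctGood_corner (a := m + p * (e + 1)) (V := fun z => U (T z))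
          (Nat.add_pos_right _ (Nat.mul_pos h.hp h.hd)) (e + 1) (hUT 0) ?_ ?_ hC (c + p)
        · rw [Prod.zero_eq_mk, hT0]
          exact h.hU0
        · rw [Prod.zero_eq_mk]
          filter_upwards [heq 0] with z hz
          rw [hz, wpolyMid, Finset.sum_eq_zero, zero_add]
          intro j hj
          rw [hB0 j (Finset.mem_range.1 hj), zero_mul]
  obtain ⟨M₀, hM₀⟩ : ∃ M₀ : ℝ, ∀ τ, M₀ ≤ |τ| → P.eval τ ≠ 0 := by
    obtain ⟨K, hK⟩ := (P.roots.toFinset.image fun x => |x|).bddAbove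
    refine ⟨K + 1, fun τ hτ h0 => ?_⟩
    have : |τ| ≤ K := hK (by
      simp only [Finset.coe_image, mem_image]
      exact ⟨τ, by simp [hP0, h0], rfl⟩)
    linarith
  refine h.evGood hC c (M₀ := max M₀ 0) fun M hM => ?_
  have hM0 : 0 ≤ M := (le_max_right _ _).trans hM
  have hM1 : M₀ ≤ M := (le_max_left _ _).trans hM
  exact EvGood.of_punctGood (by linarith) (fun x _ => hpunct x)
    (hfull _ (hM₀ _ (by rwa [abs_neg, abs_of_nonneg hM0]))) (hfull _ (hM₀ _ (by rwa [abs_of_nonneg hM0])))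

end

/-- The partial derivative in the second variable. -/
noncomputable def derivSnd (f : ℝ × ℝ → ℝ) (z : ℝ × ℝ) : ℝ := fderiv ℝ f z (0, 1)

theorem derivSnd_analyticAt {f : ℝ × ℝ → ℝ} {z : ℝ × ℝ} (hf : AnalyticAt ℝ f z) :
    AnalyticAt ℝ (derivSnd f) z :=
  ((ContinuousLinearMap.apply ℝ ℝ ((0 : ℝ), (1 : ℝ))).analyticAt _).comp hf.fderiv

theorem derivSnd_iterate_analyticAt {f : ℝ × ℝ → ℝ} {z : ℝ × ℝ} (hf : AnalyticAt ℝ f z) (k : ℕ) :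
    AnalyticAt ℝ (derivSnd^[k] f) z := by
  induction k generalizing f with
  | zero => exact hf
  | succ k ih => exact ih (derivSnd_analyticAt hf)

theorem derivSnd_congr {f g : ℝ × ℝ → ℝ} {z : ℝ × ℝ} (h : f =ᶠ[𝓝 z] g) :
    derivSnd f =ᶠ[𝓝 z] derivSnd g :=
  h.fderiv.mono fun w hw => by rw [derivSnd, derivSnd, hw]

theorem derivSnd_iterate_congr {f g : ℝ × ℝ → ℝ} {z : ℝ × ℝ} (h : f =ᶠ[𝓝 z] g) (k : ℕ) :
    derivSnd^[k] f =ᶠ[𝓝 z] derivSnd^[k] g := by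
  induction k generalizing f g with
  | zero => exact h
  | succ k ih => exact ih (derivSnd_congr h)

theorem hasDerivAt_slice {f : ℝ × ℝ → ℝ} {r t : ℝ} (hf : DifferentiableAt ℝ f (r, t)) :
    HasDerivAt (fun s => f (r, s)) (derivSnd f (r, t)) t := by
  have h1 : HasDerivAt (fun s : ℝ => (r, s)) ((0 : ℝ), (1 : ℝ)) t :=
    (hasDerivAt_const t r).prodMk (hasDerivAt_id t)
  exact hf.hasFDerivAt.comp_hasDerivAt t h1

theorem derivSnd_translate {f : ℝ × ℝ → ℝ} {φ : ℝ → ℝ} (hf : AnalyticAt ℝ f 0)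
    (hφ : AnalyticAt ℝ φ 0) (hφ0 : φ 0 = 0) (k : ℕ) :
    derivSnd^[k] (fun z => f (z.1, φ z.1 + z.2)) =ᶠ[𝓝 0]
      fun z => derivSnd^[k] f (z.1, φ z.1 + z.2) := by
  induction k generalizing f with
  | zero => exact EventuallyEq.rfl
  | succ k ih =>
    have hφ' : AnalyticAt ℝ (fun z : ℝ × ℝ => φ z.1) 0 :=
      AnalyticAt.fun_comp (g := φ) (f := Prod.fst) hφ analyticAt_fst
    have hs : AnalyticAt ℝ (fun z : ℝ × ℝ => (z.1, φ z.1 + z.2)) 0 :=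
      analyticAt_fst.prod (hφ'.add analyticAt_snd)
    have hst : Tendsto (fun z : ℝ × ℝ => (z.1, φ z.1 + z.2)) (𝓝 0) (𝓝 0) := by
      simpa [hφ0, ← Prod.zero_eq_mk] using hs.continuousAt.tendsto
    have h1 : derivSnd (fun z => f (z.1, φ z.1 + z.2)) =ᶠ[𝓝 0]
        fun z => derivSnd f (z.1, φ z.1 + z.2) := by
      filter_upwards [hs.eventually_analyticAt, hst.eventually hf.eventually_analyticAt] with z h2 h3
      have h4 := hasDerivAt_slice (f := fun z => f (z.1, φ z.1 + z.2)) (r := z.1) (t := z.2)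
        (AnalyticAt.fun_comp (g := f) (f := fun z : ℝ × ℝ => (z.1, φ z.1 + z.2)) h3 h2).differentiableAt
      have h5 := (hasDerivAt_slice (r := z.1) (t := φ z.1 + z.2) h3.differentiableAt).comp z.2
        ((hasDerivAt_id z.2).const_add (φ z.1))
      rw [mul_one] at h5
      exact h4.unique h5
    exact (derivSnd_iterate_congr h1 k).trans (ih (derivSnd_analyticAt hf))

theorem derivSnd_iterate_apply {f U : ℝ × ℝ → ℝ} {a : ℕ → ℝ → ℝ} {d : ℕ} (hf : AnalyticAt ℝ f 0)
    (hU : AnalyticAt ℝ U 0)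
    (h : ∀ᶠ z in 𝓝 (0 : ℝ × ℝ), f z = ∑ j ∈ Finset.range d, a j z.1 * z.2 ^ j + z.2 ^ d * U z)
    {k : ℕ} (hk : k < d) : ∀ᶠ r in 𝓝 (0 : ℝ), derivSnd^[k] f (r, 0) = k.factorial * a k r := by
  induction k generalizing f U a d with
  | zero =>
    obtain ⟨e, rfl⟩ : ∃ e, d = e + 1 := ⟨d - 1, by omega⟩
    filter_upwards [tendsto_prodMk_zero_right.eventually h] with r hr
    simp only [Function.iterate_zero, id, hr, Finset.sum_range_succ']
    simp
  | succ k ih =>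
    obtain ⟨e, rfl⟩ : ∃ e, d = e + 1 := ⟨d - 1, by omega⟩
    have hU' : AnalyticAt ℝ (fun z : ℝ × ℝ => (e + 1 : ℝ) * U z + z.2 * derivSnd U z) 0 :=
      (analyticAt_const.mul hU).add (analyticAt_snd.mul (derivSnd_analyticAt hU))
    have h1 := ih (f := derivSnd f) (U := fun z => (e + 1 : ℝ) * U z + z.2 * derivSnd U z)
      (a := fun j r => (j + 1 : ℝ) * a (j + 1) r) (d := e) (derivSnd_analyticAt hf) hU' ?_ (by omega)
    · filter_upwards [h1] with r hr
      rw [Function.iterate_succ_apply, hr, Nat.factorial_succ]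
      push_cast
      ring
    · filter_upwards [h.eventually_nhds, hf.eventually_analyticAt, hU.eventually_analyticAt]
        with ⟨r, t⟩ h2 h3 h4
      have h5 := hasDerivAt_slice h3.differentiableAt
      have h6 : (fun s => f (r, s)) =ᶠ[𝓝 t] fun s =>
          ∑ j ∈ Finset.range (e + 1), a j r * s ^ j + s ^ (e + 1) * U (r, s) :=
        ((Continuous.prodMk_right r).tendsto t).eventually h2
      have h7 : HasDerivAt (fun s =>
          ∑ j ∈ Finset.range (e + 1), a j r * s ^ j + s ^ (e + 1) * U (r, s))
          (∑ j ∈ Finset.range (e + 1), a j r * (j * t ^ (j - 1)) +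
            (((e + 1 : ℕ) : ℝ) * t ^ (e + 1 - 1) * U (r, t) + t ^ (e + 1) * derivSnd U (r, t))) t :=
        (HasDerivAt.fun_sum fun j _ => (hasDerivAt_pow j t).const_mul (a j r)).add
          ((hasDerivAt_pow (e + 1) t).mul (hasDerivAt_slice h4.differentiableAt))
      rw [h5.unique (h7.congr_of_eventuallyEq h6), Finset.sum_range_succ']
      simp only [Nat.add_sub_cancel]
      push_cast
      have h8 : ∀ j : ℕ, a (j + 1) r * ((j + 1 : ℝ) * t ^ j) = (j + 1 : ℝ) * a (j + 1) r * t ^ j :=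
        fun j => by ring
      simp only [h8]
      ring

theorem coeff_eq_zero {a : ℕ → ℝ} {w : ℝ → ℝ} {d : ℕ} (hw : ContinuousAt w 0)
    (h : ∀ᶠ t in 𝓝[≠] (0 : ℝ), ∑ j ∈ Finset.range d, a j * t ^ j + t ^ d * w t = 0) :
    (∀ j < d, a j = 0) ∧ w 0 = 0 := by
  induction d generalizing a with
  | zero =>
    refine ⟨fun j hj => absurd hj (Nat.not_lt_zero _), ?_⟩
    refine tendsto_nhds_unique (hw.tendsto.mono_left nhdsWithin_le_nhds) (l := 𝓝[≠] 0)
      (tendsto_const_nhds.congr' ?_)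
    filter_upwards [h] with t ht
    simpa using ht.symm
  | succ d ih =>
    have h0 : a 0 = 0 := by
      have hc : ContinuousAt (fun t => ∑ j ∈ Finset.range (d + 1), a j * t ^ j + t ^ (d + 1) * w t) 0 :=
        by fun_prop
      have := tendsto_nhds_unique (hc.tendsto.mono_left nhdsWithin_le_nhds) (l := 𝓝[≠] 0)
        (tendsto_const_nhds.congr' (h.mono fun t ht => ht.symm))
      simpa [Finset.sum_range_succ'] using this
    obtain ⟨h1, h2⟩ := ih (a := fun j => a (j + 1)) (by
      filter_upwards [h, self_mem_nhdsWithin] with t ht ht0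
      refine (mul_eq_zero.1 (?_ : t * _ = 0)).resolve_left ht0
      rw [Finset.sum_range_succ', h0, zero_mul, add_zero] at ht
      rw [← ht, mul_add, Finset.mul_sum]
      congr 1
      · exact Finset.sum_congr rfl fun j _ => by ring
      · ring)
    refine ⟨fun j hj => ?_, h2⟩
    rcases j with _ | j
    · exact h0
    · exact h1 j (by omega)

/-- Tschirnhaus transformation. -/
theorem exists_tschirnhaus {G : ℝ × ℝ → ℝ} {u : ℝ → ℝ} {d : ℕ} (hd : 0 < d) (hG : AnalyticAt ℝ G 0)
    (hu : AnalyticAt ℝ u 0) (hu0 : u 0 ≠ 0) (hord : ∀ᶠ t in 𝓝 (0 : ℝ), G (0, t) = t ^ d * u t) :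
    ∃ (φ : ℝ → ℝ) (b : ℕ → ℝ → ℝ) (V : ℝ × ℝ → ℝ), AnalyticAt ℝ φ 0 ∧ φ 0 = 0 ∧
      (∀ j, AnalyticAt ℝ (b j) 0) ∧ AnalyticAt ℝ V 0 ∧ V 0 ≠ 0 ∧ (∀ j < d, b j 0 = 0) ∧
      (∀ᶠ r in 𝓝 0, b (d - 1) r = 0) ∧ ∀ᶠ z in 𝓝 (0 : ℝ × ℝ),
        G (z.1, φ z.1 + z.2) = ∑ j ∈ Finset.range d, b j z.1 * z.2 ^ j + z.2 ^ d * V z := by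
  obtain ⟨a, W, ha, hW, haW⟩ := exists_div_pow hG (d + 1)
  have hsl : ∀ {W : ℝ × ℝ → ℝ}, AnalyticAt ℝ W 0 → ContinuousAt (fun t : ℝ => W (0, t)) 0 := fun hW =>
    ContinuousAt.comp (f := fun t : ℝ => ((0 : ℝ), t)) (by simpa [← Prod.zero_eq_mk] using hW.continuousAt)
      (by fun_prop)
  have hWc := hsl hW
  have huc := hu.continuousAt
  obtain ⟨ha0, had⟩ := coeff_eq_zero (a := fun j => a j 0) (d := d)
    (w := fun t => a d 0 + t * W (0, t) - u t) (by fun_prop) (by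
      filter_upwards [nhdsWithin_le_nhds hord,
        nhdsWithin_le_nhds (tendsto_prodMk_zero_left.eventually haW)] with t h1 h2
      rw [h1, Finset.sum_range_succ] at h2
      linear_combination -h2)
  simp only [zero_mul, add_zero, sub_eq_zero] at had
  obtain ⟨e, rfl⟩ : ∃ e, d = e + 1 := ⟨d - 1, by omega⟩
  have hE : AnalyticAt ℝ (derivSnd^[e] G) 0 := derivSnd_iterate_analyticAt hG e
  have hE0 : derivSnd^[e] G 0 = 0 := by
    have := (derivSnd_iterate_apply hG hW haW (k := e) (by omega)).self_of_nhds
    rw [ha0 e (by omega), mul_zero] at this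
    exact this
  have hE1 : fderiv ℝ (derivSnd^[e] G) 0 (0, 1) ≠ 0 := by
    have := (derivSnd_iterate_apply hG hW haW (k := e + 1) (by omega)).self_of_nhds
    rw [Function.iterate_succ_apply'] at this
    change derivSnd (derivSnd^[e] G) (0, 0) ≠ 0
    rw [this, had]
    exact mul_ne_zero (Nat.cast_ne_zero.2 (Nat.factorial_ne_zero _)) hu0
  obtain ⟨T, hT, hT0, hET, -⟩ := exists_partial_inverse hE hE0 hE1
  have hφ : AnalyticAt ℝ (fun r : ℝ => T (r, 0)) 0 :=
    AnalyticAt.fun_comp (g := T) (f := fun r : ℝ => (r, (0 : ℝ)))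
      (by simpa [← Prod.zero_eq_mk] using hT) (analyticAt_id.prod analyticAt_const)
  have hφ0 : (fun r : ℝ => T (r, 0)) 0 = 0 := by simpa [← Prod.zero_eq_mk] using hT0
  have hφ' : AnalyticAt ℝ (fun z : ℝ × ℝ => T (z.1, 0)) 0 :=
    AnalyticAt.fun_comp (g := fun r : ℝ => T (r, 0)) (f := Prod.fst) hφ analyticAt_fst
  have hg : AnalyticAt ℝ (fun z : ℝ × ℝ => G (z.1, T (z.1, 0) + z.2)) 0 := by
    refine AnalyticAt.fun_comp (g := G) ?_ (analyticAt_fst.prod (hφ'.add analyticAt_snd))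
    simpa [← Prod.zero_eq_mk, hT0] using hG
  obtain ⟨b, V, hb, hV, hbV⟩ := exists_div_pow hg (e + 1)
  have hVc := hsl hV
  obtain ⟨hb0, hb1⟩ := coeff_eq_zero (a := fun j => b j 0) (d := e + 1)
    (w := fun t => V (0, t) - u t) (by fun_prop) (by
      filter_upwards [nhdsWithin_le_nhds hord,
        nhdsWithin_le_nhds (tendsto_prodMk_zero_left.eventually hbV)] with t h1 h2
      rw [← Prod.zero_eq_mk, hT0, zero_add, h1] at h2
      linear_combination -h2)
  refine ⟨fun r => T (r, 0), b, V, hφ, hφ0, hb, hV, ?_, hb0, ?_, hbV⟩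
  · rw [sub_eq_zero] at hb1
    rw [Prod.zero_eq_mk, hb1]
    exact hu0
  · have h1 := derivSnd_iterate_apply hg hV hbV (k := e) (by omega)
    have h2 := tendsto_prodMk_zero_right.eventually (derivSnd_translate hG hφ hφ0 e)
    have h3 := tendsto_prodMk_zero_right.eventually hET
    filter_upwards [h1, h2, h3] with r h1 h2 h3
    simp only [add_zero] at h2
    rw [h1, h3] at h2
    exact (mul_eq_zero.1 h2).resolve_left (Nat.cast_ne_zero.2 (Nat.factorial_ne_zero _))

theorem exists_order {b : ℝ → ℝ} (hb : AnalyticAt ℝ b 0) (hb0 : b 0 = 0) :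
    ∃ (n : ℕ) (c : ℝ → ℝ), AnalyticAt ℝ c 0 ∧ (∀ᶠ r in 𝓝 0, b r = r ^ n * c r) ∧ 0 < n ∧
      (c 0 = 0 → ∀ r, c r = 0) := by
  by_cases h : ∀ᶠ r in 𝓝 0, b r = 0
  · exact ⟨1, fun _ => 0, analyticAt_const, by simpa using h, one_pos, fun _ _ => rfl⟩
  · obtain ⟨n, c, hc, hc0, hbc⟩ := hb.exists_eventuallyEq_pow_smul_nonzero_iff.2 h
    simp only [sub_zero, smul_eq_mul] at hbc
    refine ⟨n, c, hc, hbc, Nat.pos_of_ne_zero ?_, fun h => absurd h hc0⟩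
    rintro rfl
    have := hbc.self_of_nhds
    rw [hb0, pow_zero, one_mul] at this
    exact hc0 this.symm

/-- The first edge of the Newton polygon. -/
theorem exists_slope (d : ℕ) (n : ℕ → ℕ) (hn : ∀ j < d, 0 < n j) (S : ℕ → Prop) :
    ∃ p q : ℕ, 0 < p ∧ 0 < q ∧ (∀ j < d, S j → p * (d - j) ≤ q * n j) ∧
      ((∃ j < d, S j ∧ p * (d - j) = q * n j) ∨ ∀ j < d, ¬ S j) := by
  classical
  rcases ((Finset.range d).filter S).eq_empty_or_nonempty with h | h
  · have h' : ∀ j < d, ¬ S j := fun j hj hS => by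
      have : j ∈ (Finset.range d).filter S := by simp [hj, hS]
      simp [h] at this
    exact ⟨1, 1, one_pos, one_pos, fun j hj hS => absurd hS (h' j hj), Or.inr h'⟩
  · obtain ⟨i, hi, hmin⟩ := Finset.exists_min_image _ (fun j => (n j : ℚ) / ((d - j : ℕ) : ℚ)) h
    simp only [Finset.mem_filter, Finset.mem_range] at hi hmin
    refine ⟨n i, d - i, hn i hi.1, Nat.sub_pos_of_lt hi.1, fun j hj hS => ?_,
      Or.inl ⟨i, hi.1, hi.2, mul_comm _ _⟩⟩
    have h1 := hmin j ⟨hj, hS⟩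
    rw [div_le_div_iff₀ (Nat.cast_pos.2 (Nat.sub_pos_of_lt hi.1))
      (Nat.cast_pos.2 (Nat.sub_pos_of_lt hj))] at h1
    rw [mul_comm (d - i)]
    exact_mod_cast h1

theorem exists_reduced {G G₁ : ℝ × ℝ → ℝ} {u : ℝ → ℝ} {d m : ℕ} (hd : 0 < d) (hG : AnalyticAt ℝ G 0)
    (hG₁ : AnalyticAt ℝ G₁ 0) (heq : ∀ᶠ z in 𝓝 (0 : ℝ × ℝ), G z = z.1 ^ m * G₁ z)
    (hu : AnalyticAt ℝ u 0) (hu0 : u 0 ≠ 0) (hord : ∀ᶠ t in 𝓝 (0 : ℝ), G₁ (0, t) = t ^ d * u t) :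
    ∃ (q : ℕ) (φ : ℝ → ℝ) (B : ℕ → ℝ → ℝ) (V : ℝ × ℝ → ℝ) (p : ℕ), 0 < q ∧
      Reduced (fun z => G (z.1 ^ q, z.2)) φ B V d p (q * m) ∧ B (d - 1) 0 = 0 ∧
      ((∃ j < d, B j 0 ≠ 0) ∨ ∀ j < d, ∀ r, B j r = 0) := by
  obtain ⟨φ, b, V, hφ, hφ0, hb, hV, hV0, hb0, hbd, hbV⟩ := exists_tschirnhaus hd hG₁ hu hu0 hord
  have hex : ∀ j, ∃ (n : ℕ) (c : ℝ → ℝ), AnalyticAt ℝ c 0 ∧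
      (j < d → (∀ᶠ r in 𝓝 0, b j r = r ^ n * c r) ∧ 0 < n) ∧ (c 0 = 0 → ∀ r, c r = 0) := fun j => by
    by_cases hj : j < d
    · obtain ⟨n, c, h1, h2, h3, h4⟩ := exists_order (hb j) (hb0 j hj)
      exact ⟨n, c, h1, fun _ => ⟨h2, h3⟩, h4⟩
    · exact ⟨1, fun _ => 0, analyticAt_const, fun h => absurd h hj, fun _ _ => rfl⟩
  choose n c hc hbc hc0 using hex
  obtain ⟨p, q, hp, hq, hpq, hcase⟩ := exists_slope d n (fun j hj => (hbc j hj).2) fun j => c j 0 ≠ 0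
  let B : ℕ → ℝ → ℝ := fun j w => w ^ (q * n j - p * (d - j)) * c j (w ^ q)
  have hqa : AnalyticAt ℝ (fun w : ℝ => w ^ q) 0 := analyticAt_id.pow q
  have hq0 : (0 : ℝ) ^ q = 0 := zero_pow hq.ne'
  have hqt : Tendsto (fun w : ℝ => w ^ q) (𝓝 0) (𝓝 0) := by simpa [hq.ne'] using hqa.continuousAt.tendsto
  have hB : ∀ j, AnalyticAt ℝ (B j) 0 := fun j => (analyticAt_id.pow _).mul
    (AnalyticAt.fun_comp (g := c j) (f := fun w : ℝ => w ^ q) (by rw [hq0]; exact hc j) hqa)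
  have hr : AnalyticAt ℝ (fun z : ℝ × ℝ => (z.1 ^ q, z.2)) 0 :=
    (analyticAt_fst.pow q).prod analyticAt_snd
  have hr0 : ((0 : ℝ × ℝ).1 ^ q, (0 : ℝ × ℝ).2) = (0 : ℝ × ℝ) := by simp [hq.ne', ← Prod.zero_eq_mk]
  have hrt : Tendsto (fun z : ℝ × ℝ => (z.1 ^ q, z.2)) (𝓝 0) (𝓝 0) := by
    have := hr.continuousAt.tendsto
    rwa [hr0] at this
  have hcd : ∀ r, c (d - 1) r = 0 := by
    refine hc0 _ ?_
    have h1 : ∀ᶠ r in 𝓝[≠] (0 : ℝ), c (d - 1) r = 0 := by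
      filter_upwards [nhdsWithin_le_nhds (hbc (d - 1) (by omega)).1, nhdsWithin_le_nhds hbd,
        self_mem_nhdsWithin] with r h1 h2 h3
      rw [h2] at h1
      exact (mul_eq_zero.1 h1.symm).resolve_left (pow_ne_zero _ h3)
    exact tendsto_nhds_unique ((hc _).continuousAt.tendsto.mono_left nhdsWithin_le_nhds)
      (l := 𝓝[≠] 0) (tendsto_const_nhds.congr' (h1.mono fun r h => h.symm))
  refine ⟨q, fun w => φ (w ^ q), B, fun z => V (z.1 ^ q, z.2), p, hq, ⟨hd, hp, ?_, ?_, ?_, hB, ?_, ?_, ?_⟩,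
    ?_, ?_⟩
  · exact AnalyticAt.fun_comp (g := G) (f := fun z : ℝ × ℝ => (z.1 ^ q, z.2)) (by rwa [hr0]) hr
  · exact AnalyticAt.fun_comp (g := φ) (f := fun w : ℝ => w ^ q) (by rwa [hq0]) hqa
  · rw [zero_pow hq.ne', hφ0]
  · exact AnalyticAt.fun_comp (g := V) (f := fun z : ℝ × ℝ => (z.1 ^ q, z.2)) (by rwa [hr0]) hr
  · simpa [hq.ne', ← Prod.zero_eq_mk] using hV0
  · have hφ' : AnalyticAt ℝ (fun z : ℝ × ℝ => φ z.1) 0 :=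
      AnalyticAt.fun_comp (g := φ) (f := Prod.fst) hφ analyticAt_fst
    have hs : Tendsto (fun z : ℝ × ℝ => (z.1, φ z.1 + z.2)) (𝓝 0) (𝓝 0) := by
      simpa [hφ0, ← Prod.zero_eq_mk] using
        (analyticAt_fst.prod (hφ'.add analyticAt_snd)).continuousAt.tendsto
    have hbj : ∀ᶠ z in 𝓝 (0 : ℝ × ℝ), ∀ j ∈ Finset.range d,
        b j (z.1 ^ q) = (z.1 ^ q) ^ n j * c j (z.1 ^ q) :=
      (Finset.eventually_all _).2 fun j hj =>
        (hqt.comp (continuous_fst.tendsto' (0 : ℝ × ℝ) 0 rfl)).eventually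
          (hbc j (Finset.mem_range.1 hj)).1
    filter_upwards [hrt.eventually (hs.eventually heq), hrt.eventually hbV, hbj] with z h1 h2 h3
    rw [h1, h2, pow_mul, wpoly]
    congr 2
    refine Finset.sum_congr rfl fun j hj => ?_
    rw [h3 j hj]
    by_cases hcj : c j 0 = 0
    · simp [B, hc0 j hcj]
    · have h4 := hpq j (Finset.mem_range.1 hj) hcj
      simp only [B]
      rw [← pow_mul, ← mul_assoc, ← pow_add, Nat.add_sub_cancel' h4]
  · simp [B, hcd]
  · rcases hcase with ⟨j, hj, hcj, he⟩ | h
    · refine Or.inl ⟨j, hj, ?_⟩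
      simpa [B, he, hq.ne'] using hcj
    · refine Or.inr fun j hj r => ?_
      have := hc0 j (not_not.1 (h j hj))
      simp [B, this]

theorem localGood (d : ℕ) : LocalGood d := by
  induction d using Nat.strong_induction_on with
  | _ d ih =>
    intro G G₁ u m C c hC hG hG₁ heq hu hu0 hord
    have hD : ∀ z, AnalyticAt ℝ (fun z : ℝ × ℝ => C * z.1 ^ c) z := fun z =>
      analyticAt_const.mul (analyticAt_fst.pow c)
    rcases Nat.eq_zero_or_pos d with rfl | hd
    · refine (fullGood_zero (m := m) hG₁ ?_ (hD 0) (Eventually.of_forall fun z hz => by positivity)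
        (heq.mono fun z hz _ => hz)).punctGood
      have := hord.self_of_nhds
      rw [pow_zero, one_mul, ← Prod.zero_eq_mk] at this
      rwa [this]
    obtain ⟨q, φ, B, V, p, hq, hred, hBd, hcase⟩ := exists_reduced hd hG hG₁ heq hu hu0 hord
    have hqC : 0 < q * C := mul_pos (Nat.cast_pos.2 hq) hC
    obtain ⟨δ₁, hδ₁, h1⟩ := hred.evGood_of_localGood hBd hcase ih hqC (q - 1 + q * c)
    obtain ⟨δ₂, hδ₂, h2⟩ := eventually_box (heq.eventually_nhds.and hG₁.eventually_analyticAt)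
    obtain ⟨δ₃, hδ₃, h3⟩ := Metric.eventually_nhds_iff.1
      (hord.and (hu.continuousAt.eventually_ne hu0))
    refine ⟨min δ₁ (min δ₂ (δ₃ / 2)), by positivity, fun a b ha ha' hb hb' => ?_, fun x hx0 hx => ?_⟩
    · have hm := min_le_left δ₁ (min δ₂ (δ₃ / 2))
      refine EvGood.ramify hq.ne' ?_
      refine EvGood.congr (h1 a b (by linarith) ha' hb (by linarith)) one_pos (fun z _ => rfl)
        fun z _ => ?_
      simp only
      rw [pow_add, pow_mul]
      ring
    · rw [sub_zero] at hx
      have hx2 : |x| ≤ δ₂ := hx.trans ((min_le_right _ _).trans (min_le_left _ _))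
      have hx3 : |x| < δ₃ := by
        have : |x| ≤ δ₃ / 2 := hx.trans ((min_le_right _ _).trans (min_le_right _ _))
        linarith
      obtain ⟨h4, h5⟩ := h2 0 x (by simpa using hδ₂.le) hx2
      obtain ⟨h6, h7⟩ := h3 (show dist x 0 < δ₃ by simpa [Real.dist_eq] using hx3)
      refine fullGood_of_analyticAt (m := m) h5 ?_ (hD _)
        (Eventually.of_forall fun z hz => by positivity) (h4.mono fun z hz _ => hz)
      rw [h6]
      exact mul_ne_zero (pow_ne_zero _ hx0) h7

theorem punctGood_of_analyticAt {G : ℝ × ℝ → ℝ} {τ : ℝ} (hG : AnalyticAt ℝ G (0, τ)) :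
    PunctGood G (fun z => z.1) τ := by
  have hs : AnalyticAt ℝ (fun z : ℝ × ℝ => (z.1, z.2 + τ)) 0 :=
    analyticAt_fst.prod (analyticAt_snd.add analyticAt_const)
  have hf : AnalyticAt ℝ (fun z : ℝ × ℝ => G (z.1, z.2 + τ)) 0 :=
    AnalyticAt.fun_comp (g := G) (f := fun z : ℝ × ℝ => (z.1, z.2 + τ)) (by simpa using hG) hs
  refine PunctGood.shift ?_
  rcases exists_factor_fst hf with h | ⟨m, g, hg, hgf, hg0⟩
  · obtain ⟨δ, hδ, h1⟩ := eventually_box h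
    refine FullGood.punctGood ⟨δ, hδ, fun a b ha _ hb => ⟨δ, hδ, fun ε _ hε' => ?_⟩⟩
    refine Good.of_eq_zero fun z hz => ?_
    obtain ⟨⟨h2, h3⟩, h4, h5⟩ := hz
    exact h1 z.1 z.2 (abs_le.2 ⟨by linarith, by linarith⟩) (abs_le.2 ⟨by linarith, by linarith⟩)
  · have hg' : AnalyticAt ℝ (fun t : ℝ => g (0, t)) 0 :=
      AnalyticAt.fun_comp (g := g) (f := fun t : ℝ => ((0 : ℝ), t))
        (by simpa [← Prod.zero_eq_mk] using hg) (analyticAt_const.prod analyticAt_id)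
    obtain ⟨d, u, hu, hu0, hgu⟩ := hg'.exists_eventuallyEq_pow_smul_nonzero_iff.2 hg0
    simp only [sub_zero, smul_eq_mul] at hgu
    simpa using localGood d _ g u m 1 1 one_pos hf hg hgf hu hu0 hgu

theorem hasFDerivAt_polar (z : ℝ × ℝ) :
    HasFDerivAt (fun z : ℝ × ℝ => (z.1 * Real.cos z.2, z.1 * Real.sin z.2)) (fderivPolarCoordSymm z) z :=
  hasFDerivAt_polarCoord_symm z

theorem injOn_polar (A ρ : ℝ) :
    InjOn (fun z : ℝ × ℝ => (z.1 * Real.cos z.2, z.1 * Real.sin z.2))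
      (Ioo 0 ρ ×ˢ Ioo A (A + 2 * Real.pi)) := by
  rintro ⟨r, θ⟩ ⟨⟨hr, -⟩, hθ1, hθ2⟩ ⟨s, ψ⟩ ⟨⟨hs, -⟩, hψ1, hψ2⟩ h
  obtain ⟨h1, h2⟩ := Prod.mk.inj h
  simp only at hr hθ1 hθ2 hs hψ1 hψ2 h1 h2
  have hrs : r = s := by
    refine (pow_left_inj₀ hr.le hs.le two_ne_zero).1 ?_
    calc r ^ 2 = (r * Real.cos θ) ^ 2 + (r * Real.sin θ) ^ 2 := by
          linear_combination -r ^ 2 * Real.sin_sq_add_cos_sq θ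
      _ = (s * Real.cos ψ) ^ 2 + (s * Real.sin ψ) ^ 2 := by rw [h1, h2]
      _ = s ^ 2 := by linear_combination s ^ 2 * Real.sin_sq_add_cos_sq ψ
  subst hrs
  obtain ⟨k, hk⟩ := Real.Angle.angle_eq_iff_two_pi_dvd_sub.1
    (Real.Angle.cos_sin_inj (mul_left_cancel₀ hr.ne' h1) (mul_left_cancel₀ hr.ne' h2))
  have hπ := Real.pi_pos
  have hk1 : k < 1 := by
    by_contra hcon
    have : (1 : ℝ) ≤ k := by exact_mod_cast not_lt.1 hcon
    nlinarith
  have hk2 : -1 < k := by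
    by_contra hcon
    have : (k : ℝ) ≤ -1 := by exact_mod_cast not_lt.1 hcon
    nlinarith
  obtain rfl : k = 0 := by omega
  rw [Int.cast_zero, mul_zero, sub_eq_zero] at hk
  rw [hk]

theorem exists_polar (A : ℝ) (p : ℝ × ℝ) : ∃ r θ : ℝ, 0 ≤ r ∧ r ^ 2 = p.1 ^ 2 + p.2 ^ 2 ∧
    θ ∈ Ico A (A + 2 * Real.pi) ∧ p = (r * Real.cos θ, r * Real.sin θ) := by
  let w : ℂ := ⟨p.1, p.2⟩
  refine ⟨‖w‖, toIcoMod Real.two_pi_pos A w.arg, norm_nonneg _, ?_, toIcoMod_mem_Ico _ _ _, ?_⟩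
  · rw [Complex.sq_norm, Complex.normSq_apply]
    simp only [w]
    ring
  · have h1 := Real.cos_periodic.sub_zsmul_eq (x := w.arg) (toIcoDiv Real.two_pi_pos A w.arg)
    have h2 := Real.sin_periodic.sub_zsmul_eq (x := w.arg) (toIcoDiv Real.two_pi_pos A w.arg)
    rw [toIcoMod, h1, h2, Complex.norm_mul_cos_arg, Complex.norm_mul_sin_arg]

theorem exists_good_euclBall {H : ℝ × ℝ → ℝ} (hH : AnalyticAt ℝ H 0) :
    ∃ ρ₀ > (0 : ℝ), ∀ ρ, 0 < ρ → ρ < ρ₀ → Good H volume (euclBall ρ) := by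
  let Φ : ℝ × ℝ → ℝ × ℝ := fun z => (z.1 * Real.cos z.2, z.1 * Real.sin z.2)
  let G : ℝ × ℝ → ℝ := fun z => H (Φ z)
  have hΦ : ∀ z, AnalyticAt ℝ Φ z := fun z =>
    (analyticAt_fst.mul (AnalyticAt.fun_comp (g := Real.cos) (f := Prod.snd) Real.analyticAt_cos
      analyticAt_snd)).prod
      (analyticAt_fst.mul (AnalyticAt.fun_comp (g := Real.sin) (f := Prod.snd) Real.analyticAt_sin
        analyticAt_snd))
  have hΦ0 : ∀ θ, Φ (0, θ) = 0 := fun θ => by simp [Φ]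
  have hG : ∀ θ, PunctGood G (fun z => z.1) θ := fun θ => punctGood_of_analyticAt
    (AnalyticAt.fun_comp (g := H) (f := Φ) (by rwa [hΦ0]) (hΦ _))
  obtain ⟨A, -, hA⟩ : ∃ A : ℝ, A ≠ 0 ∧ FullGood G (fun z => z.1) A := by
    obtain ⟨δ, hδ, -, h⟩ := hG 0
    exact ⟨δ, hδ.ne', h δ hδ.ne' (by simp [abs_of_pos hδ])⟩
  have hA' : FullGood G (fun z => z.1) (A + 2 * Real.pi) := by
    refine FullGood.shift ?_
    have : (fun z : ℝ × ℝ => G (z.1, z.2 + 2 * Real.pi)) = G := by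
      ext z
      simp [G, Φ]
    rwa [this]
  have hπ := Real.two_pi_pos
  obtain ⟨ρ₀, hρ₀, hgood⟩ := EvGood.of_punctGood (by linarith) (fun θ _ => hG θ) hA hA'
  refine ⟨ρ₀, hρ₀, fun ρ hρ hρ' => ?_⟩
  have h1 : Good H (dens fun _ => 1) (Φ '' (Ioo 0 ρ ×ˢ Ioo A (A + 2 * Real.pi))) := by
    refine (hgood ρ hρ hρ'.le).transport (Φ := Φ) (Φ' := fderivPolarCoordSymm)
      (isOpen_box _ _ _ _).measurableSet (injOn_polar A ρ) (fun z _ => hasFDerivAt_polar z)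
      (fun z _ => rfl) (fun z hz => ?_) rfl
    rw [det_fderivPolarCoordSymm, mul_one, abs_of_pos hz.1.1]
  have hdens : (dens fun _ => 1) = volume := by
    simp only [dens, ENNReal.ofReal_one]
    exact withDensity_one
  rw [hdens] at h1
  refine h1.mono_ae ?_ ?_
  · rintro _ ⟨z, ⟨⟨hz1, hz2⟩, -⟩, rfl⟩
    change (z.1 * Real.cos z.2) ^ 2 + (z.1 * Real.sin z.2) ^ 2 ≤ ρ ^ 2
    have : (z.1 * Real.cos z.2) ^ 2 + (z.1 * Real.sin z.2) ^ 2 = z.1 ^ 2 := by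
      linear_combination z.1 ^ 2 * Real.sin_sq_add_cos_sq z.2
    rw [this]
    exact pow_le_pow_left₀ hz1.le hz2.le 2
  · have hnull : (volume : Measure (ℝ × ℝ)) ({0} ×ˢ univ ∪ {ρ} ×ˢ univ ∪ univ ×ˢ {A}) = 0 :=
      measure_union_null (measure_union_null (volume_singleton_prod _ _) (volume_singleton_prod _ _))
        (volume_prod_singleton _ _)
    refine measure_mono_null ?_ (addHaar_image_eq_zero_of_differentiableOn_of_addHaar_eq_zero volume
      (f := Φ) (fun z _ => (hasFDerivAt_polar z).differentiableAt.differentiableWithinAt) hnull)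
    rintro p ⟨hp, hpX, -⟩
    obtain ⟨r, θ, hr, hrp, ⟨hθ, hθ'⟩, hpr⟩ := exists_polar A p
    refine ⟨(r, θ), ?_, hpr.symm⟩
    by_contra hcon
    simp only [mem_union, mem_prod, mem_singleton_iff, mem_univ, and_true, true_and, not_or] at hcon
    obtain ⟨⟨h2, h3⟩, h4⟩ := hcon
    have h5 : r ^ 2 ≤ ρ ^ 2 := hrp.trans_le hp
    have h6 : r ≤ ρ := (pow_le_pow_iff_left₀ hr hρ.le two_ne_zero).1 h5
    exact hpX ⟨(r, θ), ⟨⟨lt_of_le_of_ne hr (Ne.symm h2), lt_of_le_of_ne h6 h3⟩,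
      lt_of_le_of_ne hθ (Ne.symm h4), hθ'⟩, hpr.symm⟩

theorem sector_logPuiseux {H : ℝ × ℝ → ℝ} {ρ : ℝ} (h : Good H volume (euclBall ρ)) (x₀ : ℝ × ℝ) :
    LogPuiseux fun h => (volume {p ∈ sector H ρ x₀ | |H p| < h}).toReal := by
  have hsub : sector H ρ x₀ ⊆ {p ∈ euclBall ρ | H p ≠ 0} := connectedComponentIn_subset _ _
  refine h.logPuiseux (fun z hz => (hsub hz).1) (fun z hz => (hsub hz).2) fun C hC hC0 hpre => ?_
  by_cases hd : Disjoint C (sector H ρ x₀)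
  · exact Or.inr hd
  · obtain ⟨x, hxC, hxS⟩ := not_disjoint_iff.1 hd
    left
    have h1 := hpre.subset_connectedComponentIn (F := {p ∈ euclBall ρ | H p ≠ 0}) hxC fun z hz =>
      ⟨hC hz, hC0 z hz⟩
    rwa [← connectedComponentIn_eq hxS] at h1

end SectorArea

/-- Areas of sublevel sets in a separatrix sector are log-Puiseux: for all
sufficiently small `ρ > 0` and every separatrix sector `S_ρ` of `B_ρ ∖ {H = 0}`,
there exist `h₀ > 0`, a positive integer `q`, an integer `k₀`, and real coefficients
`A k, B k` such that for every `h ∈ (0, h₀)` the log-Puiseux series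
`∑_{k ≥ k₀} (A k + B k · ln h) · h^{k/q}` converges to the Lebesgue area of
`S_ρ(h) = {p ∈ S_ρ : |H p| < h}`. -/
theorem sector_area_is_log_puiseux (H : ℝ × ℝ → ℝ)
    (hH : AnalyticAt ℝ H 0) (h0 : H 0 = 0) (hcrit : fderiv ℝ H 0 = 0)
    (hiso : ∀ᶠ p in nhds (0 : ℝ × ℝ), fderiv ℝ H p = 0 → p = 0)
    (hmax : ¬ IsLocalMax H 0) (hmin : ¬ IsLocalMin H 0) :
    ∃ ρ₀ > (0 : ℝ), ∀ ρ : ℝ, 0 < ρ → ρ < ρ₀ →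
      ∀ x₀ ∈ {p ∈ euclBall ρ | H p ≠ 0},
        ∃ h₀ > (0 : ℝ), ∃ q : ℕ, 0 < q ∧ ∃ (k₀ : ℤ) (A B : ℤ → ℝ),
          ∀ h ∈ Set.Ioo (0 : ℝ) h₀,
            HasSum
              (fun k : ℕ =>
                (A (k₀ + k) + B (k₀ + k) * Real.log h) *
                  h ^ (((k₀ + k : ℤ) : ℝ) / (q : ℝ)))
              ((MeasureTheory.volume {p ∈ sector H ρ x₀ | |H p| < h}).toReal) := by
  obtain ⟨ρ₀, hρ₀, hgood⟩ := SectorArea.exists_good_euclBall hH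
  exact ⟨ρ₀, hρ₀, fun ρ hρ hρ' x₀ _ =>
    (SectorArea.sector_logPuiseux (hgood ρ hρ hρ') x₀).exists_hasSum⟩
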